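/- Assume the inverse temperature sequence (β_N)_{N≥1} with β_N ∈ (0,1) satisfies lim_{N→∞} β_N = 1 and lim_{N→∞} N^{1/3}(1 − β_N²) = c for some finite constant c ∈ (0,∞). Then there exists a finite constant C such that for all N ≥ 2, |Var(F_N(β_N)) − (1/6)·ln N| ≤ C; that is, Var(F_N(β_N)) = (1/6)·ln N + O(1) as N → ∞. -/

import Mathlib

open MeasureTheory ProbabilityTheory Real Finset Filter

noncomputable section

/-- Spin configurations: each of the `N` sites carries a `±1` spin, encoded by a `Bool`. -/
abbrev Config (N : ℕ) := Fin N → Bool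

/-- The `±1` value of a spin. -/
def spin (b : Bool) : ℝ := if b then 1 else -1

/-- The value of the last spin `σ_N` (junk value `0` when `N = 0`). -/
def spinLast {N : ℕ} (σ : Config N) : ℝ :=
  if h : 0 < N then spin (σ ⟨N - 1, Nat.sub_lt h Nat.one_pos⟩) else 0

/-- The Gaussian disorder: i.i.d. standard Gaussians indexed by pairs `(i, j)`
(only the entries with `i < j` are used). -/
def gaussPi (N : ℕ) : Measure (Fin N × Fin N → ℝ) :=
  Measure.pi fun _ => gaussianReal 0 1

instance (N : ℕ) : IsProbabilityMeasure (gaussPi N) := by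
  unfold gaussPi; infer_instance

/-- Three independent copies `g, g', g''` of the disorder. -/
def disM3 (N : ℕ) :
    Measure ((Fin N × Fin N → ℝ) × (Fin N × Fin N → ℝ) × (Fin N × Fin N → ℝ)) :=
  (gaussPi N).prod ((gaussPi N).prod (gaussPi N))

/-- The SK Hamiltonian `H_{N,β}(σ) = (β/√N) ∑_{i<j} g_{ij} σ_i σ_j`. -/
def ham (N : ℕ) (β : ℝ) (g : Fin N × Fin N → ℝ) (σ : Config N) : ℝ :=
  (β / Real.sqrt N) *
    ∑ p ∈ Finset.univ.filter (fun p : Fin N × Fin N => p.1 < p.2),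
      g p * spin (σ p.1) * spin (σ p.2)

/-- The cavity Hamiltonian `H⁻_N(σ) = (β/√N) ∑_{i<j<N} g_{ij} σ_i σ_j` on the first
`N - 1` spins. -/
def hamCav (N : ℕ) (β : ℝ) (g : Fin N × Fin N → ℝ) (σ : Config N) : ℝ :=
  (β / Real.sqrt N) *
    ∑ p ∈ Finset.univ.filter
        (fun p : Fin N × Fin N => p.1 < p.2 ∧ (p.2 : ℕ) < N - 1),
      g p * spin (σ p.1) * spin (σ p.2)

/-- The overlap `R(σ¹,σ²) = (1/N) ∑_{i ≤ N} σ_i¹ σ_i²`. -/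
def ovlp (N : ℕ) (σ τ : Config N) : ℝ := (∑ i, spin (σ i) * spin (τ i)) / N

/-- The truncated overlap `R⁻(σ¹,σ²) = (1/N) ∑_{i ≤ N−1} σ_i¹ σ_i²`. -/
def ovlpm (N : ℕ) (σ τ : Config N) : ℝ :=
  (∑ i ∈ Finset.univ.filter (fun i : Fin N => (i : ℕ) < N - 1),
    spin (σ i) * spin (τ i)) / N

/-- The partition function `Z_N(β)`. -/
def partFun (N : ℕ) (β : ℝ) (g : Fin N × Fin N → ℝ) : ℝ :=
  ∑ σ : Config N, Real.exp (ham N β g σ)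

/-- The free energy `F_N(β) = ln Z_N(β)`. -/
def freeEnergy (N : ℕ) (β : ℝ) (g : Fin N × Fin N → ℝ) : ℝ :=
  Real.log (partFun N β g)

/-- Two-replica Gibbs average `⟨f⟩` for the single SK system. -/
def gibbs2 (N : ℕ) (β : ℝ) (g : Fin N × Fin N → ℝ)
    (f : Config N → Config N → ℝ) : ℝ :=
  (∑ σ : Config N, ∑ τ : Config N,
    f σ τ * Real.exp (ham N β g σ + ham N β g τ)) / (partFun N β g) ^ 2

/-- Disorder expectation of the two-replica Gibbs average. -/
def Egibbs2 (N : ℕ) (β : ℝ) (f : Config N → Config N → ℝ) : ℝ :=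
  ∫ g, gibbs2 N β g f ∂gaussPi N

/-- The interpolated Hamiltonian `√t · H_N + √(1−t) · H'_N`. -/
def hamT (N : ℕ) (β t : ℝ) (g g' : Fin N × Fin N → ℝ) (σ : Config N) : ℝ :=
  Real.sqrt t * ham N β g σ + Real.sqrt (1 - t) * ham N β g' σ

/-- The coupled Gibbs weight `exp(H¹_{N,t}(σ) + H²_{N,t}(τ))`. -/
def wT (N : ℕ) (β t : ℝ) (g g' g'' : Fin N × Fin N → ℝ)
    (ρ : Config N × Config N) : ℝ :=
  Real.exp (hamT N β t g g' ρ.1 + hamT N β t g g'' ρ.2)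

/-- The coupled Gibbs average `⟨f⟩_t` of a function of one pair `(σ, τ)`. -/
def gibbsT (N : ℕ) (β t : ℝ) (g g' g'' : Fin N × Fin N → ℝ)
    (f : Config N × Config N → ℝ) : ℝ :=
  (∑ ρ : Config N × Config N, f ρ * wT N β t g g' g'' ρ) /
    (∑ ρ : Config N × Config N, wT N β t g g' g'' ρ)

/-- The coupled Gibbs average `⟨f⟩_t` of a function of two pairs. -/
def gibbsT2 (N : ℕ) (β t : ℝ) (g g' g'' : Fin N × Fin N → ℝ)
    (f : Config N × Config N → Config N × Config N → ℝ) : ℝ :=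
  (∑ ρ₁ : Config N × Config N, ∑ ρ₂ : Config N × Config N,
    f ρ₁ ρ₂ * wT N β t g g' g'' ρ₁ * wT N β t g g' g'' ρ₂) /
    (∑ ρ : Config N × Config N, wT N β t g g' g'' ρ) ^ 2

/-- Disorder expectation `E⟨f⟩_t` (one pair). -/
def EgibbsT (N : ℕ) (β t : ℝ) (f : Config N × Config N → ℝ) : ℝ :=
  ∫ ω, gibbsT N β t ω.1 ω.2.1 ω.2.2 f ∂disM3 N

/-- Disorder expectation `E⟨f⟩_t` (two pairs). -/
def EgibbsT2 (N : ℕ) (β t : ℝ)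
    (f : Config N × Config N → Config N × Config N → ℝ) : ℝ :=
  ∫ ω, gibbsT2 N β t ω.1 ω.2.1 ω.2.2 f ∂disM3 N

/-- The `s`-dependent cavity field term
`(β/√N) σ_N ∑_{i<N} (√t g_{iN} + √(1−t) g'_{iN}) σ_i`. -/
def cavField (N : ℕ) (β t : ℝ) (g g' : Fin N × Fin N → ℝ) (σ : Config N) : ℝ :=
  if h : 0 < N then
    (β / Real.sqrt N) * spin (σ ⟨N - 1, Nat.sub_lt h Nat.one_pos⟩) *
      ∑ i ∈ Finset.univ.filter (fun i : Fin N => (i : ℕ) < N - 1),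
        (Real.sqrt t * g (i, ⟨N - 1, Nat.sub_lt h Nat.one_pos⟩) +
          Real.sqrt (1 - t) * g' (i, ⟨N - 1, Nat.sub_lt h Nat.one_pos⟩)) * spin (σ i)
  else 0

/-- The cavity-interpolated Hamiltonian `H^1_{N,t,s}` (resp. `H^2_{N,t,s}` with `g''`). -/
def hamTS (N : ℕ) (β t s : ℝ) (g g' : Fin N × Fin N → ℝ) (σ : Config N) : ℝ :=
  Real.sqrt t * hamCav N β g σ + Real.sqrt (1 - t) * hamCav N β g' σ +
    Real.sqrt s * cavField N β t g g' σ

/-- The coupled cavity Gibbs weight `exp(H¹_{N,t,s}(σ) + H²_{N,t,s}(τ))`. -/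
def wTS (N : ℕ) (β t s : ℝ) (g g' g'' : Fin N × Fin N → ℝ)
    (ρ : Config N × Config N) : ℝ :=
  Real.exp (hamTS N β t s g g' ρ.1 + hamTS N β t s g g'' ρ.2)

/-- The coupled cavity Gibbs average `⟨f⟩_{t,s}` of a function of one pair. -/
def gibbsTS1 (N : ℕ) (β t s : ℝ) (g g' g'' : Fin N × Fin N → ℝ)
    (f : Config N × Config N → ℝ) : ℝ :=
  (∑ ρ : Config N × Config N, f ρ * wTS N β t s g g' g'' ρ) /
    (∑ ρ : Config N × Config N, wTS N β t s g g' g'' ρ)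

/-- The coupled cavity Gibbs average `⟨f⟩_{t,s}` of a function of two pairs. -/
def gibbsTS2 (N : ℕ) (β t s : ℝ) (g g' g'' : Fin N × Fin N → ℝ)
    (f : Config N × Config N → Config N × Config N → ℝ) : ℝ :=
  (∑ ρ₁ : Config N × Config N, ∑ ρ₂ : Config N × Config N,
    f ρ₁ ρ₂ * wTS N β t s g g' g'' ρ₁ * wTS N β t s g g' g'' ρ₂) /
    (∑ ρ : Config N × Config N, wTS N β t s g g' g'' ρ) ^ 2

/-- The coupled cavity Gibbs average `⟨f⟩_{t,s}` of a function of `n` pairs. -/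
def gibbsTSn (N : ℕ) (β t s : ℝ) (g g' g'' : Fin N × Fin N → ℝ) {n : ℕ}
    (f : (Fin n → Config N × Config N) → ℝ) : ℝ :=
  (∑ ρ : Fin n → Config N × Config N, f ρ * ∏ l, wTS N β t s g g' g'' (ρ l)) /
    (∑ ρ₀ : Config N × Config N, wTS N β t s g g' g'' ρ₀) ^ n

/-- Disorder expectation `E⟨f⟩_{t,s}` (one pair). -/
def EgibbsTS1 (N : ℕ) (β t s : ℝ) (f : Config N × Config N → ℝ) : ℝ :=
  ∫ ω, gibbsTS1 N β t s ω.1 ω.2.1 ω.2.2 f ∂disM3 N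

/-- Disorder expectation `E⟨f⟩_{t,s}` (two pairs). -/
def EgibbsTS2 (N : ℕ) (β t s : ℝ)
    (f : Config N × Config N → Config N × Config N → ℝ) : ℝ :=
  ∫ ω, gibbsTS2 N β t s ω.1 ω.2.1 ω.2.2 f ∂disM3 N

/-- Disorder expectation `E⟨f⟩_{t,s}` (`n` pairs). -/
def EgibbsTSn (N : ℕ) (β t s : ℝ) {n : ℕ}
    (f : (Fin n → Config N × Config N) → ℝ) : ℝ :=
  ∫ ω, gibbsTSn N β t s ω.1 ω.2.1 ω.2.2 f ∂disM3 N

/-- The covariance kernel `U(ρ, ρ')` of the `s`-part of the coupled cavity Hamiltonians. -/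
def Ufun (N : ℕ) (β t : ℝ) (ρ ρ' : Config N × Config N) : ℝ :=
  β ^ 2 / 2 * (spinLast ρ.1 * spinLast ρ'.1 * ovlpm N ρ.1 ρ'.1 +
      spinLast ρ.2 * spinLast ρ'.2 * ovlpm N ρ.2 ρ'.2) +
    β ^ 2 * t / 2 * (spinLast ρ.1 * spinLast ρ'.2 * ovlpm N ρ.1 ρ'.2 +
      spinLast ρ.2 * spinLast ρ'.1 * ovlpm N ρ.2 ρ'.1)

/-- `ν(β) = −(1/2)·ln(1 − β²) − β²/2`. -/
def nuSK (b : ℝ) : ℝ := -(1 / 2) * Real.log (1 - b ^ 2) - b ^ 2 / 2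

namespace SKVariance

set_option linter.unusedSectionVars false

/-- The standard Gaussian measure on `ι → ℝ`. -/
def stdG (ι : Type*) [Fintype ι] : Measure (ι → ℝ) :=
  Measure.pi fun _ => gaussianReal 0 1

instance (ι : Type*) [Fintype ι] : IsProbabilityMeasure (stdG ι) := by
  unfold stdG; infer_instance


section GaussianVectors

variable {ι κ : Type*} [Fintype ι] [Fintype κ]

@[fun_prop]
lemma continuous_dot (x : ι → ℝ) : Continuous fun ω : ι → ℝ => x ⬝ᵥ ω := by
  unfold dotProduct; fun_prop

lemma integral_exp_dot (x : ι → ℝ) :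
    ∫ ω, exp (x ⬝ᵥ ω) ∂stdG ι = exp ((x ⬝ᵥ x) / 2) := by
  have h1 : ∀ ω : ι → ℝ, exp (x ⬝ᵥ ω) = ∏ i, exp (x i * ω i) := by
    intro ω; rw [dotProduct, exp_sum]
  simp_rw [h1]
  unfold stdG
  rw [integral_fintype_prod_eq_prod (fun i y => exp (x i * y))]
  have h2 : ∀ i, ∫ y, exp (x i * y) ∂gaussianReal 0 1 = exp (x i * x i / 2) := by
    intro i
    have := congrFun (mgf_id_gaussianReal (μ := 0) (v := 1)) (x i)
    simp only [mgf, id] at this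
    rw [this]; congr 1; push_cast; ring
  simp_rw [h2]
  rw [← exp_sum, dotProduct, Finset.sum_div]

lemma integrable_exp_dot (x : ι → ℝ) :
    Integrable (fun ω => exp (x ⬝ᵥ ω)) (stdG ι) := by
  have h1 : ∀ ω : ι → ℝ, exp (x ⬝ᵥ ω) = ∏ i, exp (x i * ω i) := by
    intro ω; rw [dotProduct, exp_sum]
  simp_rw [h1]
  exact Integrable.fintype_prod (f := fun i y => exp (x i * y))
    (fun i => integrable_exp_mul_gaussianReal (x i))

lemma integral_cexp_dot (x : ι → ℝ) :
    ∫ ω, Complex.exp (((x ⬝ᵥ ω : ℝ) : ℂ) * Complex.I) ∂stdG ι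
      = Complex.exp (-(((x ⬝ᵥ x : ℝ) : ℂ) / 2)) := by
  have h1 : ∀ ω : ι → ℝ, Complex.exp (((x ⬝ᵥ ω : ℝ) : ℂ) * Complex.I)
      = ∏ i, Complex.exp ((x i : ℂ) * (ω i : ℂ) * Complex.I) := by
    intro ω; rw [dotProduct, ← Complex.exp_sum]; push_cast; rw [Finset.sum_mul]
  simp_rw [h1]
  unfold stdG
  rw [integral_fintype_prod_eq_prod
    (fun i (y : ℝ) => Complex.exp ((x i : ℂ) * (y : ℂ) * Complex.I))]
  have h2 : ∀ i, ∫ y : ℝ, Complex.exp ((x i : ℂ) * (y : ℂ) * Complex.I) ∂gaussianReal 0 1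
      = Complex.exp (-((x i : ℂ) * x i / 2)) := by
    intro i
    have := charFun_gaussianReal (μ := 0) (v := 1) (x i)
    rw [charFun_apply_real] at this
    rw [this]; congr 1; push_cast; ring
  simp_rw [h2]
  rw [← Complex.exp_sum, dotProduct]; push_cast
  rw [Finset.sum_div, ← Finset.sum_neg_distrib]

/-- A random vector whose characteristic function is that of the standard Gaussian. -/
lemma measurePreserving_of_charFun {Ω : Type*} [MeasurableSpace Ω] {P : Measure Ω}
    [IsProbabilityMeasure P] {T : Ω → κ → ℝ} (hT : Measurable T)
    (h : ∀ x : κ → ℝ, ∫ ω, Complex.exp (((x ⬝ᵥ T ω : ℝ) : ℂ) * Complex.I) ∂P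
      = Complex.exp (-(((x ⬝ᵥ x : ℝ) : ℂ) / 2))) :
    MeasurePreserving T P (stdG κ) := by
  classical
  refine ⟨hT, ?_⟩
  have := Measure.isProbabilityMeasure_map (μ := P) hT.aemeasurable
  refine Measure.ext_of_charFunDual ?_
  ext L
  have hL : ∀ v : κ → ℝ, L v = (fun i => L (Pi.single i 1)) ⬝ᵥ v := by
    intro v
    conv_lhs => rw [pi_eq_sum_univ' v]
    rw [map_sum, dotProduct]
    refine Finset.sum_congr rfl fun i _ => ?_
    rw [map_smul, smul_eq_mul, mul_comm]
  rw [charFunDual_apply, charFunDual_apply, integral_map hT.aemeasurable (by fun_prop)]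
  have h1 := h fun i => L (Pi.single i 1)
  have h2 := integral_cexp_dot fun i => L (Pi.single i 1)
  simp_rw [← hL] at h1 h2
  rw [h1, h2]

lemma measurePreserving_of_dot {T : (ι → ℝ) → κ → ℝ} (hT : Measurable T)
    (h : ∀ x : κ → ℝ, ∃ y : ι → ℝ, (∀ ω, x ⬝ᵥ T ω = y ⬝ᵥ ω) ∧ y ⬝ᵥ y = x ⬝ᵥ x) :
    MeasurePreserving T (stdG ι) (stdG κ) := by
  refine measurePreserving_of_charFun hT fun x => ?_
  obtain ⟨y, hy, hyy⟩ := h x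
  simp_rw [hy]
  rw [integral_cexp_dot, hyy]

/-- Resampling the coordinates in `S`. -/
def mix (S : ι → Prop) [DecidablePred S] (p : (ι → ℝ) × (ι → ℝ)) : ι → ℝ :=
  fun i => if S i then p.2 i else p.1 i

lemma measurable_mix (S : ι → Prop) [DecidablePred S] : Measurable (mix S) := by
  refine measurable_pi_lambda _ fun i => ?_
  unfold mix
  by_cases h : S i
  · simp only [h, if_true]; fun_prop
  · simp only [h, if_false]; fun_prop

lemma dot_mix (S : ι → Prop) [DecidablePred S] (x : ι → ℝ) (p : (ι → ℝ) × (ι → ℝ)) :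
    x ⬝ᵥ mix S p = (fun i => if S i then 0 else x i) ⬝ᵥ p.1
      + (fun i => if S i then x i else 0) ⬝ᵥ p.2 := by
  simp only [dotProduct, mix, ← Finset.sum_add_distrib]
  refine Finset.sum_congr rfl fun i _ => ?_
  by_cases h : S i <;> simp [h]

lemma measurePreserving_mix (S : ι → Prop) [DecidablePred S] :
    MeasurePreserving (mix S) ((stdG ι).prod (stdG ι)) (stdG ι) := by
  refine measurePreserving_of_charFun (measurable_mix S) fun x => ?_
  simp_rw [dot_mix]
  push_cast
  simp_rw [add_mul, Complex.exp_add]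
  rw [integral_prod_mul (fun ω : ι → ℝ => Complex.exp
      ((((fun i => if S i then 0 else x i) ⬝ᵥ ω : ℝ) : ℂ) * Complex.I))
    (fun ω : ι → ℝ => Complex.exp
      ((((fun i => if S i then x i else 0) ⬝ᵥ ω : ℝ) : ℂ) * Complex.I)),
    integral_cexp_dot, integral_cexp_dot, ← Complex.exp_add]
  congr 1
  have : x ⬝ᵥ x = (fun i => if S i then 0 else x i) ⬝ᵥ (fun i => if S i then 0 else x i)
      + (fun i => if S i then x i else 0) ⬝ᵥ (fun i => if S i then x i else 0) := by
    simp only [dotProduct, ← Finset.sum_add_distrib]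
    refine Finset.sum_congr rfl fun i _ => ?_
    by_cases h : S i <;> simp [h]
  rw [this]; push_cast; ring

lemma integral_comp_of_mp {Ω Ω' : Type*} [MeasurableSpace Ω] [MeasurableSpace Ω']
    {P : Measure Ω} {P' : Measure Ω'} {T : Ω → Ω'} (hT : MeasurePreserving T P P')
    {f : Ω' → ℝ} (hf : AEStronglyMeasurable f P') :
    ∫ ω, f (T ω) ∂P = ∫ ω, f ω ∂P' := by
  rw [← hT.map_eq, integral_map hT.measurable.aemeasurable (by rwa [hT.map_eq])]

lemma integral_stdG_mix (S : ι → Prop) [DecidablePred S] {f : (ι → ℝ) → ℝ}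
    (hf : Integrable f (stdG ι)) :
    ∫ ω, f ω ∂stdG ι = ∫ a, ∫ b, f (mix S (a, b)) ∂stdG ι ∂stdG ι := by
  rw [← integral_comp_of_mp (measurePreserving_mix S) hf.1, integral_prod]
  exact (measurePreserving_mix S).integrable_comp_of_integrable hf

/-! ### Pairs of Gaussian vectors -/

/-- First component of a vector indexed by a sum. -/
def pr₁ (ω : ι ⊕ ι → ℝ) : ι → ℝ := fun i => ω (Sum.inl i)

/-- The vector `a g + b g'`, where `ω = (g, g')`. -/
def pr₂ (a b : ℝ) (ω : ι ⊕ ι → ℝ) : ι → ℝ := fun i => a * ω (Sum.inl i) + b * ω (Sum.inr i)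

lemma pr₂_one_zero (ω : ι ⊕ ι → ℝ) : pr₂ 1 0 ω = pr₁ ω := by
  ext i; simp [pr₁, pr₂]

lemma measurePreserving_pr₂ {a b : ℝ} (hab : a ^ 2 + b ^ 2 = 1) :
    MeasurePreserving (pr₂ a b) (stdG (ι ⊕ ι)) (stdG ι) := by
  refine measurePreserving_of_dot ?_ fun x => ⟨Sum.elim (fun i => a * x i) (fun i => b * x i), ?_, ?_⟩
  · unfold pr₂; fun_prop
  · intro ω
    simp only [dotProduct, pr₂, Fintype.sum_sum_type, Sum.elim_inl, Sum.elim_inr,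
      ← Finset.sum_add_distrib]
    exact Finset.sum_congr rfl fun i _ => by ring
  · simp only [dotProduct, Fintype.sum_sum_type, Sum.elim_inl, Sum.elim_inr,
      ← Finset.sum_add_distrib]
    refine Finset.sum_congr rfl fun i _ => ?_
    linear_combination (x i * x i) * hab

lemma measurePreserving_pr₁ : MeasurePreserving (pr₁ (ι := ι)) (stdG (ι ⊕ ι)) (stdG ι) := by
  have := measurePreserving_pr₂ (ι := ι) (a := 1) (b := 0) (by norm_num)
  convert this using 1
  ext ω; rw [pr₂_one_zero]

/-- The inverse rotation by `θ` on pairs of vectors. -/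
def rot (θ : ℝ) (η : ι ⊕ ι → ℝ) : ι ⊕ ι → ℝ :=
  Sum.elim (fun i => cos θ * η (Sum.inl i) - sin θ * η (Sum.inr i))
    (fun i => sin θ * η (Sum.inl i) + cos θ * η (Sum.inr i))

lemma measurePreserving_rot (θ : ℝ) :
    MeasurePreserving (rot (ι := ι) θ) (stdG (ι ⊕ ι)) (stdG (ι ⊕ ι)) := by
  refine measurePreserving_of_dot ?_ fun x =>
    ⟨Sum.elim (fun i => cos θ * x (Sum.inl i) + sin θ * x (Sum.inr i))
      (fun i => -sin θ * x (Sum.inl i) + cos θ * x (Sum.inr i)), ?_, ?_⟩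
  · refine measurable_pi_lambda _ fun i => ?_
    rcases i with i | i <;> simp only [rot, Sum.elim_inl, Sum.elim_inr] <;> fun_prop
  · intro ω
    simp only [dotProduct, rot, Fintype.sum_sum_type, Sum.elim_inl, Sum.elim_inr,
      ← Finset.sum_add_distrib]
    exact Finset.sum_congr rfl fun i _ => by ring
  · simp only [dotProduct, Fintype.sum_sum_type, Sum.elim_inl, Sum.elim_inr,
      ← Finset.sum_add_distrib]
    refine Finset.sum_congr rfl fun i _ => ?_
    linear_combination (x (Sum.inl i) * x (Sum.inl i) + x (Sum.inr i) * x (Sum.inr i))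
      * sin_sq_add_cos_sq θ

end GaussianVectors

/-! ### Gaussian integration by parts -/

lemma hasDerivAt_gaussianPDFReal (x : ℝ) :
    HasDerivAt (gaussianPDFReal 0 1) (-x * gaussianPDFReal 0 1 x) x := by
  have h1 : HasDerivAt (fun y : ℝ => -(y - 0) ^ 2 / (2 * ((1 : NNReal) : ℝ))) (-x) x := by
    have := ((((hasDerivAt_id x).sub_const 0).pow 2).neg).div_const (2 * ((1 : NNReal) : ℝ))
    refine this.congr_deriv ?_
    simp [neg_div]
  have h2 := (h1.exp).const_mul ((√(2 * π * ((1 : NNReal) : ℝ)))⁻¹)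
  have h3 : gaussianPDFReal 0 1 = fun y : ℝ => (√(2 * π * ((1 : NNReal) : ℝ)))⁻¹
      * exp (-(y - 0) ^ 2 / (2 * ((1 : NNReal) : ℝ))) := by
    ext y; rw [gaussianPDFReal]
  rw [h3]
  refine h2.congr_deriv ?_
  ring

lemma integrable_gaussianReal_iff {f : ℝ → ℝ} :
    Integrable f (gaussianReal 0 1) ↔ Integrable fun x => gaussianPDFReal 0 1 x * f x := by
  rw [gaussianReal_of_var_ne_zero 0 one_ne_zero,
    integrable_withDensity_iff_integrable_smul' (measurable_gaussianPDF _ _)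
      (ae_of_all _ fun _ ↦ gaussianPDF_lt_top)]
  simp [toReal_gaussianPDF]

lemma stein_real {f f' : ℝ → ℝ} (hd : ∀ x, HasDerivAt f (f' x) x)
    (hf : Integrable f (gaussianReal 0 1)) (hf' : Integrable f' (gaussianReal 0 1))
    (hfx : Integrable (fun x => f x * x) (gaussianReal 0 1)) :
    ∫ x, f x * x ∂gaussianReal 0 1 = ∫ x, f' x ∂gaussianReal 0 1 := by
  rw [integrable_gaussianReal_iff] at hf hf' hfx
  have h1 : ∀ x, HasDerivAt (fun x => gaussianPDFReal 0 1 x * f x)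
      (gaussianPDFReal 0 1 x * f' x - gaussianPDFReal 0 1 x * (f x * x)) x := by
    intro x
    refine ((hasDerivAt_gaussianPDFReal x).mul (hd x)).congr_deriv ?_
    ring
  have h2 := integral_eq_zero_of_hasDerivAt_of_integrable h1 (hf'.sub hfx) hf
  rw [integral_sub hf' hfx] at h2
  rw [integral_gaussianReal_eq_integral_smul one_ne_zero,
    integral_gaussianReal_eq_integral_smul one_ne_zero]
  simp only [smul_eq_mul]
  linarith


section Stein
variable {ι : Type*} [Fintype ι] [DecidableEq ι]

lemma mix_eq_update (q : ι) (a b : ι → ℝ) :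
    mix (fun i => i = q) (a, b) = Function.update a q (b q) := by
  ext i
  by_cases h : i = q
  · subst h; simp [mix]
  · simp [mix, h]

lemma stein {h h' : (ι → ℝ) → ℝ} (q : ι) (hm' : Measurable h')
    (hd : ∀ ω x, HasDerivAt (fun x => h (Function.update ω q x)) (h' (Function.update ω q x)) x)
    (hi : Integrable h (stdG ι)) (hi' : Integrable h' (stdG ι))
    (hix : Integrable (fun ω => h ω * ω q) (stdG ι)) :
    ∫ ω, h ω * ω q ∂stdG ι = ∫ ω, h' ω ∂stdG ι := by
  rw [integral_stdG_mix (fun i => i = q) hix, integral_stdG_mix (fun i => i = q) hi']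
  have mp := measurePreserving_mix (ι := ι) (fun i => i = q)
  have hev : MeasurePreserving (fun b : ι → ℝ => b q) (stdG ι) (gaussianReal 0 1) :=
    measurePreserving_eval (fun _ => gaussianReal 0 1) q
  have a1 := (mp.integrable_comp_of_integrable hi).prod_right_ae
  have a2 := (mp.integrable_comp_of_integrable hi').prod_right_ae
  have a3 := (mp.integrable_comp_of_integrable hix).prod_right_ae
  refine integral_congr_ae ?_
  filter_upwards [a1, a2, a3] with a b1 b2 b3
  simp only [Function.comp_def, mix_eq_update, Function.update_self] at b1 b2 b3 ⊢
  have hc : Continuous fun x => h (Function.update a q x) :=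
    continuous_iff_continuousAt.2 fun x => (hd a x).continuousAt
  have hc' : Measurable fun x => h' (Function.update a q x) := hm'.comp (by fun_prop)
  have key : ∀ f : ℝ → ℝ, Measurable f → Integrable (fun b : ι → ℝ => f (b q)) (stdG ι) →
      Integrable f (gaussianReal 0 1) := by
    intro f hf hfi
    rw [← hev.map_eq, integrable_map_measure hf.aestronglyMeasurable hev.measurable.aemeasurable]
    exact hfi
  have e1 := integral_comp_of_mp hev (f := fun x => h (Function.update a q x) * x)
    (hc.measurable.mul measurable_id).aestronglyMeasurable
  have e2 := integral_comp_of_mp hev (f := fun x => h' (Function.update a q x))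
    hc'.aestronglyMeasurable
  rw [e1, e2]
  exact stein_real (hd a) (key _ hc.measurable b1) (key _ hc' b2)
    (key _ (hc.measurable.mul measurable_id) b3)

end Stein

section Growth
variable {ι : Type*} [Fintype ι]

/-- A weight controlling functions of polynomial growth. -/
def growth (ω : ι → ℝ) : ℝ := 1 + ∑ i, |ω i|

lemma one_le_growth (ω : ι → ℝ) : 1 ≤ growth ω := by
  have : 0 ≤ ∑ i, |ω i| := Finset.sum_nonneg fun i _ => abs_nonneg _
  unfold growth; linarith

lemma abs_le_growth (ω : ι → ℝ) (i : ι) : |ω i| ≤ growth ω := by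
  have := Finset.single_le_sum (f := fun i => |ω i|) (fun i _ => abs_nonneg _) (Finset.mem_univ i)
  unfold growth; linarith

lemma memLp_abs_coord (k : ℕ) (i : ι) : MemLp (fun ω : ι → ℝ => |ω i|) k (stdG ι) := by
  have hev : MeasurePreserving (fun b : ι → ℝ => b i) (stdG ι) (gaussianReal 0 1) :=
    measurePreserving_eval (fun _ => gaussianReal 0 1) i
  have h0 := memLp_id_gaussianReal' (μ := 0) (v := 1) (k : ENNReal) (by simp)
  exact (h0.comp_measurePreserving hev).abs

lemma memLp_growth (k : ℕ) : MemLp (fun ω : ι → ℝ => growth ω) k (stdG ι) := by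
  have h2 : MemLp (fun ω : ι → ℝ => ∑ i, |ω i|) k (stdG ι) :=
    memLp_finsetSum (f := fun (i : ι) (ω : ι → ℝ) => |ω i|) Finset.univ fun i _ => memLp_abs_coord k i
  have h1 : MemLp (fun _ : ι → ℝ => (1 : ℝ)) k (stdG ι) := memLp_const 1
  exact h1.add h2

lemma integrable_growth_pow (k : ℕ) : Integrable (fun ω : ι → ℝ => growth ω ^ k) (stdG ι) := by
  have h := (memLp_growth (ι := ι) k).integrable_norm_pow'
  simp_rw [Real.norm_eq_abs, fun ω : ι → ℝ =>
    abs_of_nonneg (zero_le_one.trans (one_le_growth ω))] at h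
  exact h

lemma integrable_of_growth {f : (ι → ℝ) → ℝ} (hf : Measurable f) (C : ℝ) (k : ℕ)
    (h : ∀ ω, |f ω| ≤ C * growth ω ^ k) : Integrable f (stdG ι) :=
  ((integrable_growth_pow k).const_mul C).mono' hf.aestronglyMeasurable (ae_of_all _ h)

lemma integrable_of_bounded {f : (ι → ℝ) → ℝ} (hf : Measurable f) (C : ℝ)
    (h : ∀ ω, |f ω| ≤ C) : Integrable f (stdG ι) :=
  (integrable_const C).mono' hf.aestronglyMeasurable (ae_of_all _ h)

lemma abs_dot_le {x ω : ι → ℝ} {M : ℝ} (hM : ∀ i, |x i| ≤ M) (hM0 : 0 ≤ M) :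
    |x ⬝ᵥ ω| ≤ M * growth ω := by
  calc |x ⬝ᵥ ω| ≤ ∑ i, |x i * ω i| := Finset.abs_sum_le_sum_abs _ _
    _ ≤ ∑ i, M * |ω i| := by
        refine Finset.sum_le_sum fun i _ => ?_
        rw [abs_mul]; exact mul_le_mul_of_nonneg_right (hM i) (abs_nonneg _)
    _ = M * ∑ i, |ω i| := by rw [Finset.mul_sum]
    _ ≤ M * growth ω := by
        refine mul_le_mul_of_nonneg_left ?_ hM0
        unfold growth; linarith

end Growth

/-! ### Gibbs measures driven by a Gaussian vector -/

section Gibbs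
variable {ι S : Type*} [Fintype ι] [Fintype S] [Nonempty S] (V : S → ι → ℝ)

/-- Partition function of the energies `V s ⬝ᵥ ω`. -/
def Zf (ω : ι → ℝ) : ℝ := ∑ s, exp (V s ⬝ᵥ ω)

/-- Gibbs weights. -/
def wt (ω : ι → ℝ) (s : S) : ℝ := exp (V s ⬝ᵥ ω) / Zf V ω

lemma Zf_pos (ω : ι → ℝ) : 0 < Zf V ω :=
  Finset.sum_pos (fun _ _ => exp_pos _) Finset.univ_nonempty

lemma wt_pos (ω : ι → ℝ) (s : S) : 0 < wt V ω s := div_pos (exp_pos _) (Zf_pos V ω)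

lemma wt_nonneg (ω : ι → ℝ) (s : S) : 0 ≤ wt V ω s := (wt_pos V ω s).le

lemma sum_wt (ω : ι → ℝ) : ∑ s, wt V ω s = 1 := by
  unfold wt
  rw [← Finset.sum_div]
  exact div_self (Zf_pos V ω).ne'

lemma wt_le_one (ω : ι → ℝ) (s : S) : wt V ω s ≤ 1 := by
  rw [← sum_wt V ω]
  exact Finset.single_le_sum (f := wt V ω) (fun s _ => wt_nonneg V ω s) (Finset.mem_univ s)

lemma continuous_Zf : Continuous (Zf V) := by unfold Zf; fun_prop

lemma continuous_wt (s : S) : Continuous fun ω => wt V ω s :=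
  Continuous.div (by fun_prop) (continuous_Zf V) fun ω => (Zf_pos V ω).ne'

lemma continuous_logZf : Continuous fun ω => log (Zf V ω) :=
  (continuous_Zf V).log fun ω => (Zf_pos V ω).ne'

lemma abs_sum_wt_mul_le (ω : ι → ℝ) {f : S → ℝ} {M : ℝ} (hM : ∀ s, |f s| ≤ M) :
    |∑ s, wt V ω s * f s| ≤ M := by
  calc |∑ s, wt V ω s * f s| ≤ ∑ s, |wt V ω s * f s| := Finset.abs_sum_le_sum_abs _ _
    _ ≤ ∑ s, wt V ω s * M := by
        refine Finset.sum_le_sum fun s _ => ?_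
        rw [abs_mul, abs_of_nonneg (wt_nonneg V ω s)]
        exact mul_le_mul_of_nonneg_left (hM s) (wt_nonneg V ω s)
    _ = M := by rw [← Finset.sum_mul, sum_wt, one_mul]

lemma exists_growth_logZf : ∃ C : ℝ, 0 ≤ C ∧ ∀ ω, |log (Zf V ω)| ≤ C * growth ω := by
  obtain ⟨M, hM0, hM⟩ : ∃ M : ℝ, 0 ≤ M ∧ ∀ s i, |V s i| ≤ M := by
    refine ⟨∑ s, ∑ i, |V s i|, by positivity, fun s i => ?_⟩
    calc |V s i| ≤ ∑ i, |V s i| :=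
          Finset.single_le_sum (f := fun i => |V s i|) (fun i _ => abs_nonneg _) (Finset.mem_univ i)
      _ ≤ _ := Finset.single_le_sum (f := fun s => ∑ i, |V s i|) (fun s _ => by positivity)
          (Finset.mem_univ s)
  have hc : (1 : ℝ) ≤ Fintype.card S := by exact_mod_cast Fintype.card_pos
  have hl : 0 ≤ log (Fintype.card S) := log_nonneg hc
  refine ⟨log (Fintype.card S) + M, by positivity, fun ω => ?_⟩
  have hg := one_le_growth ω
  have hd : ∀ s, |V s ⬝ᵥ ω| ≤ M * growth ω := fun s => abs_dot_le (hM s) hM0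
  have hlg : log (Fintype.card S) ≤ log (Fintype.card S) * growth ω := le_mul_of_one_le_right hl hg
  rw [abs_le]
  constructor
  · obtain ⟨s⟩ := ‹Nonempty S›
    have h1 : exp (V s ⬝ᵥ ω) ≤ Zf V ω :=
      Finset.single_le_sum (f := fun s => exp (V s ⬝ᵥ ω)) (fun s _ => (exp_pos _).le)
        (Finset.mem_univ s)
    have h2 := log_le_log (exp_pos _) h1
    rw [log_exp] at h2
    have := (abs_le.1 (hd s)).1
    nlinarith
  · have h1 : Zf V ω ≤ Fintype.card S * exp (M * growth ω) := by
      calc Zf V ω ≤ ∑ _s : S, exp (M * growth ω) :=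
            Finset.sum_le_sum fun s _ => exp_le_exp.2 (abs_le.1 (hd s)).2
        _ = _ := by simp
    have h2 := log_le_log (Zf_pos V ω) h1
    rw [log_mul (by positivity) (exp_pos _).ne', log_exp] at h2
    nlinarith

/-- Derivative of the free energy along a smooth curve. -/
lemma hasDerivAt_logZf {c : ℝ → ι → ℝ} {c' : ι → ℝ} {x : ℝ}
    (hc : ∀ i, HasDerivAt (fun x => c x i) (c' i) x) :
    HasDerivAt (fun x => log (Zf V (c x))) (∑ s, wt V (c x) s * (V s ⬝ᵥ c')) x := by
  have h1 : ∀ s, HasDerivAt (fun x => V s ⬝ᵥ c x) (V s ⬝ᵥ c') x := fun s =>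
    HasDerivAt.fun_sum fun i _ => (hc i).const_mul (V s i)
  have h2 : HasDerivAt (fun x => Zf V (c x)) (∑ s, exp (V s ⬝ᵥ c x) * (V s ⬝ᵥ c')) x :=
    HasDerivAt.fun_sum fun s _ => (h1 s).exp
  refine (h2.log (Zf_pos V (c x)).ne').congr_deriv ?_
  rw [Finset.sum_div]
  refine Finset.sum_congr rfl fun s _ => ?_
  unfold wt; ring

end Gibbs

/-! ### The variance of the free energy -/

section Coupling
variable {ι S : Type*} [Fintype ι] [Fintype S] [Nonempty S] (V : S → ι → ℝ)

/-- Average over two replicas, the second one driven by the correlated disorder `a g + b g'`. -/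
def cpl (a b : ℝ) (f : S → S → ℝ) (ω : ι ⊕ ι → ℝ) : ℝ :=
  ∑ s, ∑ t, wt V (pr₁ ω) s * wt V (pr₂ a b ω) t * f s t

/-- Disorder expectation of `cpl`. -/
def Ecpl (a b : ℝ) (f : S → S → ℝ) : ℝ := ∫ ω, cpl V a b f ω ∂stdG (ι ⊕ ι)

lemma continuous_pr₁ : Continuous (pr₁ (ι := ι)) := by unfold pr₁; fun_prop

lemma continuous_pr₂ (a b : ℝ) : Continuous (pr₂ (ι := ι) a b) := by unfold pr₂; fun_prop

lemma continuous_cpl (a b : ℝ) (f : S → S → ℝ) : Continuous (cpl V a b f) := by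
  unfold cpl
  refine continuous_finsetSum _ fun s _ => continuous_finsetSum _ fun t _ => ?_
  exact (((continuous_wt V s).comp continuous_pr₁).mul
    ((continuous_wt V t).comp (continuous_pr₂ a b))).mul continuous_const

lemma abs_cpl_le (a b : ℝ) {f : S → S → ℝ} {M : ℝ} (hM : ∀ s t, |f s t| ≤ M)
    (ω : ι ⊕ ι → ℝ) : |cpl V a b f ω| ≤ M := by
  unfold cpl
  simp_rw [mul_assoc, ← Finset.mul_sum]
  exact abs_sum_wt_mul_le V _ fun s => abs_sum_wt_mul_le V _ fun t => hM s t

lemma exists_bound (f : S → S → ℝ) : ∃ M : ℝ, 0 ≤ M ∧ ∀ s t, |f s t| ≤ M := by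
  refine ⟨∑ s, ∑ t, |f s t|, by positivity, fun s t => ?_⟩
  calc |f s t| ≤ ∑ t, |f s t| :=
        Finset.single_le_sum (f := fun t => |f s t|) (fun i _ => abs_nonneg _) (Finset.mem_univ t)
    _ ≤ _ := Finset.single_le_sum (f := fun s => ∑ t, |f s t|) (fun s _ => by positivity)
        (Finset.mem_univ s)

lemma integrable_cpl (a b : ℝ) (f : S → S → ℝ) : Integrable (cpl V a b f) (stdG (ι ⊕ ι)) := by
  obtain ⟨M, -, hM⟩ := exists_bound f
  exact integrable_of_bounded (continuous_cpl V a b f).measurable M (abs_cpl_le V a b hM)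

lemma continuous_Ecpl (f : S → S → ℝ) : Continuous fun θ => Ecpl V (cos θ) (sin θ) f := by
  obtain ⟨M, -, hM⟩ := exists_bound f
  unfold Ecpl
  refine continuous_of_dominated (bound := fun _ => M)
    (fun θ => (continuous_cpl V _ _ f).aestronglyMeasurable)
    (fun θ => ae_of_all _ fun ω => abs_cpl_le V _ _ hM ω) (integrable_const M)
    (ae_of_all _ fun ω => ?_)
  unfold cpl
  have h : ∀ t, Continuous fun θ => wt V (pr₂ (cos θ) (sin θ) ω) t := fun t =>
    (continuous_wt V t).comp (by unfold pr₂; fun_prop)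
  fun_prop

lemma growth_pr₁_le (ω : ι ⊕ ι → ℝ) : growth (pr₁ ω) ≤ growth ω := by
  unfold growth pr₁
  rw [Fintype.sum_sum_type]
  have : 0 ≤ ∑ i : ι, |ω (Sum.inr i)| := Finset.sum_nonneg fun i _ => abs_nonneg _
  linarith

lemma growth_pr₂_le {a b : ℝ} (ha : |a| ≤ 1) (hb : |b| ≤ 1) (ω : ι ⊕ ι → ℝ) :
    growth (pr₂ a b ω) ≤ growth ω := by
  unfold growth pr₂
  rw [Fintype.sum_sum_type, ← Finset.sum_add_distrib]
  refine add_le_add_right (Finset.sum_le_sum fun i _ => ?_) 1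
  calc |a * ω (Sum.inl i) + b * ω (Sum.inr i)|
      ≤ |a * ω (Sum.inl i)| + |b * ω (Sum.inr i)| := abs_add_le _ _
    _ ≤ _ := by
      rw [abs_mul, abs_mul]
      nlinarith [abs_nonneg (ω (Sum.inl i)), abs_nonneg (ω (Sum.inr i))]

lemma pr₁_rot (θ : ℝ) (η : ι ⊕ ι → ℝ) : pr₁ (rot θ η) = pr₂ (cos θ) (-sin θ) η := by
  ext i; simp only [pr₁, pr₂, rot, Sum.elim_inl]; ring

lemma pr₂_rot (θ : ℝ) (η : ι ⊕ ι → ℝ) : pr₂ (cos θ) (sin θ) (rot θ η) = pr₁ η := by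
  ext i
  simp only [pr₁, pr₂, rot, Sum.elim_inl, Sum.elim_inr]
  linear_combination η (Sum.inl i) * sin_sq_add_cos_sq θ

lemma pr₂_rot' (θ : ℝ) (η : ι ⊕ ι → ℝ) :
    pr₂ (-sin θ) (cos θ) (rot θ η) = fun i => η (Sum.inr i) := by
  ext i
  simp only [pr₂, rot, Sum.elim_inl, Sum.elim_inr]
  linear_combination η (Sum.inr i) * sin_sq_add_cos_sq θ

lemma integral_mul_of_sum {f f' : (ι → ℝ) → ℝ} (hf : Continuous f) (hf' : Continuous f') :
    ∫ ω : ι ⊕ ι → ℝ, f (fun i => ω (Sum.inl i)) * f' (fun i => ω (Sum.inr i)) ∂stdG (ι ⊕ ι)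
      = (∫ ω, f ω ∂stdG ι) * ∫ ω, f' ω ∂stdG ι := by
  have hm : Measurable fun p : (ι → ℝ) × (ι → ℝ) => (Sum.elim p.1 p.2 : ι ⊕ ι → ℝ) := by
    refine measurable_pi_lambda _ fun i => ?_
    rcases i with i | i <;> simp only [Sum.elim_inl, Sum.elim_inr] <;> fun_prop
  have mp : MeasurePreserving (fun p : (ι → ℝ) × (ι → ℝ) => (Sum.elim p.1 p.2 : ι ⊕ ι → ℝ))
      ((stdG ι).prod (stdG ι)) (stdG (ι ⊕ ι)) := by
    refine measurePreserving_of_charFun hm fun x => ?_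
    have h1 : ∀ p : (ι → ℝ) × (ι → ℝ), x ⬝ᵥ (Sum.elim p.1 p.2 : ι ⊕ ι → ℝ)
        = (fun i => x (Sum.inl i)) ⬝ᵥ p.1 + (fun i => x (Sum.inr i)) ⬝ᵥ p.2 := by
      intro p; simp [dotProduct, Fintype.sum_sum_type]
    simp_rw [h1]
    push_cast
    simp_rw [add_mul, Complex.exp_add]
    rw [integral_prod_mul (fun ω : ι → ℝ => Complex.exp
        ((((fun i => x (Sum.inl i)) ⬝ᵥ ω : ℝ) : ℂ) * Complex.I))
      (fun ω : ι → ℝ => Complex.exp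
        ((((fun i => x (Sum.inr i)) ⬝ᵥ ω : ℝ) : ℂ) * Complex.I)),
      integral_cexp_dot, integral_cexp_dot, ← Complex.exp_add]
    congr 1
    have : x ⬝ᵥ x = (fun i => x (Sum.inl i)) ⬝ᵥ (fun i => x (Sum.inl i))
        + (fun i => x (Sum.inr i)) ⬝ᵥ (fun i => x (Sum.inr i)) := by
      simp [dotProduct, Fintype.sum_sum_type]
    rw [this]; push_cast; ring
  rw [← integral_comp_of_mp mp (by
    refine Continuous.aestronglyMeasurable ?_
    exact (hf.comp (by fun_prop)).mul (hf'.comp (by fun_prop)))]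
  exact integral_prod_mul f f'

/-- Gaussian integration by parts for the coupled free energies. -/
lemma integral_logZf_mul_deriv [DecidableEq ι] (θ : ℝ) :
    ∫ ω, log (Zf V (pr₁ ω)) * ∑ s, wt V (pr₂ (cos θ) (sin θ) ω) s
        * (V s ⬝ᵥ pr₂ (-sin θ) (cos θ) ω) ∂stdG (ι ⊕ ι)
      = -(sin θ * Ecpl V (cos θ) (sin θ) fun s t => V s ⬝ᵥ V t) := by
  obtain ⟨C, hC0, hC⟩ := exists_growth_logZf V
  have hF := continuous_logZf V
  have mp := measurePreserving_rot (ι := ι) θ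
  have hcos := abs_cos_le_one θ
  have hsin : |-sin θ| ≤ 1 := by rw [abs_neg]; exact abs_sin_le_one θ
  have hFg : ∀ η : ι ⊕ ι → ℝ, |log (Zf V (pr₂ (cos θ) (-sin θ) η))| ≤ C * growth η := fun η =>
    (hC _).trans (mul_le_mul_of_nonneg_left (growth_pr₂_le hcos hsin η) hC0)
  have hFc := hF.comp (continuous_pr₂ (ι := ι) (cos θ) (-sin θ))
  simp only [Function.comp_def] at hFc
  have hwc : ∀ s, Continuous fun η : ι ⊕ ι → ℝ => wt V (pr₁ η) s := fun s =>
    (continuous_wt V s).comp continuous_pr₁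
  have hwc2 : ∀ s, Continuous fun η : ι ⊕ ι → ℝ => wt V (pr₂ (cos θ) (-sin θ) η) s := fun s =>
    (continuous_wt V s).comp (continuous_pr₂ _ _)
  have hw1 : ∀ (η : ι ⊕ ι → ℝ) s, |wt V (pr₁ η) s| ≤ 1 := fun η s => by
    rw [abs_of_nonneg (wt_nonneg V _ s)]; exact wt_le_one V _ s
  -- rotate
  rw [← integral_comp_of_mp mp (by
    refine Continuous.aestronglyMeasurable ?_
    refine (hF.comp continuous_pr₁).mul (continuous_finsetSum _ fun s _ => ?_)
    exact ((continuous_wt V s).comp (continuous_pr₂ _ _)).mul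
      ((continuous_dot (V s)).comp (continuous_pr₂ _ _)))]
  simp_rw [pr₁_rot, pr₂_rot, pr₂_rot']
  have hst : ∀ (s : S) (p : ι),
      ∫ η : ι ⊕ ι → ℝ, (log (Zf V (pr₂ (cos θ) (-sin θ) η)) * wt V (pr₁ η) s) * η (Sum.inr p)
        ∂stdG (ι ⊕ ι)
      = ∫ η : ι ⊕ ι → ℝ, (∑ t, wt V (pr₂ (cos θ) (-sin θ) η) t * (V t p * -sin θ))
          * wt V (pr₁ η) s ∂stdG (ι ⊕ ι) := by
    intro s p
    obtain ⟨M, -, hM⟩ := exists_bound fun (t : S) (_ : S) => V t p * -sin θ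
    refine stein (h := fun η : ι ⊕ ι → ℝ =>
        log (Zf V (pr₂ (cos θ) (-sin θ) η)) * wt V (pr₁ η) s)
      (h' := fun η : ι ⊕ ι → ℝ => (∑ t, wt V (pr₂ (cos θ) (-sin θ) η) t * (V t p * -sin θ))
          * wt V (pr₁ η) s) (Sum.inr p) ?_ ?_ ?_ ?_ ?_
    · refine Continuous.measurable ?_
      fun_prop
    · intro ω x
      have hp1 : ∀ x, pr₁ (Function.update ω (Sum.inr p) x) = pr₁ ω := by
        intro x; ext i; simp [pr₁]
      simp_rw [hp1]
      refine HasDerivAt.mul_const ?_ _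
      refine (hasDerivAt_logZf V (c := fun x => pr₂ (cos θ) (-sin θ)
        (Function.update ω (Sum.inr p) x)) (c' := fun i => if i = p then -sin θ else 0)
        ?_).congr_deriv ?_
      · intro i
        by_cases h : i = p
        · subst h
          simp only [pr₂, Function.update_self, if_true]
          have := ((hasDerivAt_id x).const_mul (-sin θ)).const_add (cos θ * ω (Sum.inl i))
          simpa [Function.update] using this
        · have : ∀ x, Function.update ω (Sum.inr p) x (Sum.inr i) = ω (Sum.inr i) := by
            intro x; simp [Function.update, h]
          simp only [pr₂, this, h, if_false]
          simp [Function.update, hasDerivAt_const]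
      · refine Finset.sum_congr rfl fun t _ => ?_
        simp [dotProduct]
    · refine integrable_of_growth (hFc.mul (hwc s)).measurable C 1 fun η => ?_
      rw [abs_mul, pow_one]
      calc _ ≤ (C * growth η) * 1 := mul_le_mul (hFg η) (hw1 η s) (abs_nonneg _)
            ((abs_nonneg _).trans (hFg η))
        _ = _ := mul_one _
    · refine integrable_of_bounded (Continuous.measurable (by fun_prop)) M fun η => ?_
      rw [abs_mul]
      have := abs_sum_wt_mul_le V (pr₂ (cos θ) (-sin θ) η) fun t => hM t t
      calc _ ≤ M * 1 := mul_le_mul this (hw1 η s) (abs_nonneg _) ((abs_nonneg _).trans this)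
        _ = _ := mul_one _
    · refine integrable_of_growth (Continuous.measurable (by fun_prop)) C 2 fun η => ?_
      rw [abs_mul, abs_mul, pow_two, ← mul_assoc]
      refine mul_le_mul ?_ (abs_le_growth η _) (abs_nonneg _) ((abs_nonneg _).trans (hFg η))
      calc _ ≤ (C * growth η) * 1 := mul_le_mul (hFg η) (hw1 η s) (abs_nonneg _)
            ((abs_nonneg _).trans (hFg η))
        _ = _ := mul_one _
  have hint1 : ∀ (s : S) (p : ι), Integrable (fun η : ι ⊕ ι → ℝ => V s p *
      ((log (Zf V (pr₂ (cos θ) (-sin θ) η)) * wt V (pr₁ η) s) * η (Sum.inr p)))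
      (stdG (ι ⊕ ι)) := by
    intro s p
    refine Integrable.const_mul ?_ _
    refine integrable_of_growth (Continuous.measurable (by fun_prop)) C 2 fun η => ?_
    rw [abs_mul, abs_mul, pow_two, ← mul_assoc]
    refine mul_le_mul ?_ (abs_le_growth η _) (abs_nonneg _) ((abs_nonneg _).trans (hFg η))
    calc _ ≤ (C * growth η) * 1 := mul_le_mul (hFg η) (hw1 η s) (abs_nonneg _)
          ((abs_nonneg _).trans (hFg η))
      _ = _ := mul_one _
  have hint2 : ∀ (s : S) (p : ι), Integrable (fun η : ι ⊕ ι → ℝ => V s p *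
      ((∑ t, wt V (pr₂ (cos θ) (-sin θ) η) t * (V t p * -sin θ)) * wt V (pr₁ η) s))
      (stdG (ι ⊕ ι)) := by
    intro s p
    obtain ⟨M, -, hM⟩ := exists_bound fun (t : S) (_ : S) => V t p * -sin θ
    refine Integrable.const_mul ?_ _
    refine integrable_of_bounded (Continuous.measurable (by fun_prop)) M fun η => ?_
    rw [abs_mul]
    have := abs_sum_wt_mul_le V (pr₂ (cos θ) (-sin θ) η) fun t => hM t t
    calc _ ≤ M * 1 := mul_le_mul this (hw1 η s) (abs_nonneg _) ((abs_nonneg _).trans this)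
      _ = _ := mul_one _
  calc _ = ∫ η : ι ⊕ ι → ℝ, ∑ s, ∑ p, V s p *
        ((log (Zf V (pr₂ (cos θ) (-sin θ) η)) * wt V (pr₁ η) s) * η (Sum.inr p))
        ∂stdG (ι ⊕ ι) := by
        refine integral_congr_ae (ae_of_all _ fun η => ?_)
        simp only [dotProduct, Finset.mul_sum]
        refine Finset.sum_congr rfl fun s _ => Finset.sum_congr rfl fun p _ => ?_
        ring
    _ = ∑ s, ∑ p, V s p * ∫ η : ι ⊕ ι → ℝ,
        (log (Zf V (pr₂ (cos θ) (-sin θ) η)) * wt V (pr₁ η) s) * η (Sum.inr p)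
        ∂stdG (ι ⊕ ι) := by
        rw [integral_finsetSum _ fun s _ => integrable_finsetSum _ fun p _ => hint1 s p]
        refine Finset.sum_congr rfl fun s _ => ?_
        rw [integral_finsetSum _ fun p _ => hint1 s p]
        refine Finset.sum_congr rfl fun p _ => ?_
        rw [integral_const_mul]
    _ = ∫ η : ι ⊕ ι → ℝ, ∑ s, ∑ p, V s p *
        ((∑ t, wt V (pr₂ (cos θ) (-sin θ) η) t * (V t p * -sin θ)) * wt V (pr₁ η) s)
        ∂stdG (ι ⊕ ι) := by
        rw [integral_finsetSum _ fun s _ => integrable_finsetSum _ fun p _ => hint2 s p]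
        refine Finset.sum_congr rfl fun s _ => ?_
        rw [integral_finsetSum _ fun p _ => hint2 s p]
        refine Finset.sum_congr rfl fun p _ => ?_
        rw [integral_const_mul, hst]
    _ = -(sin θ * ∫ η : ι ⊕ ι → ℝ, ∑ s, ∑ t, wt V (pr₂ (cos θ) (-sin θ) η) s
          * wt V (pr₁ η) t * (V s ⬝ᵥ V t) ∂stdG (ι ⊕ ι)) := by
        rw [← integral_const_mul, ← integral_neg]
        refine integral_congr_ae (ae_of_all _ fun η => ?_)
        simp only [dotProduct, Finset.mul_sum, Finset.sum_mul, ← Finset.sum_neg_distrib]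
        rw [Finset.sum_comm' (t' := univ) (s' := fun _ => univ) (by simp)]
        rw [Finset.sum_comm]
        conv_rhs => rw [Finset.sum_comm]
        refine Finset.sum_congr rfl fun s _ => ?_
        conv_rhs => rw [Finset.sum_comm]
        refine Finset.sum_congr rfl fun p _ => Finset.sum_congr rfl fun t _ => ?_
        ring
    _ = _ := by
        unfold Ecpl
        rw [← integral_comp_of_mp mp (continuous_cpl V _ _ _).aestronglyMeasurable]
        simp_rw [cpl, pr₁_rot, pr₂_rot]

/-- Interpolation formula for the variance of the free energy. -/
theorem variance_logZf [DecidableEq ι] :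
    variance (fun ω => log (Zf V ω)) (stdG ι)
      = ∫ θ in (0 : ℝ)..(π / 2), sin θ * Ecpl V (cos θ) (sin θ) fun s t => V s ⬝ᵥ V t := by
  obtain ⟨C, hC0, hC⟩ := exists_growth_logZf V
  have hF := continuous_logZf V
  obtain ⟨M, hM0, hM⟩ := exists_bound fun (s : S) (_ : S) => ∑ i, |V s i|
  have hM' : ∀ s i, |V s i| ≤ M := fun s i =>
    (Finset.single_le_sum (f := fun i => |V s i|) (fun i _ => abs_nonneg _)
      (Finset.mem_univ i)).trans ((le_abs_self _).trans (hM s s))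
  set Ψ : ℝ → ℝ := fun θ => ∫ ω, log (Zf V (pr₁ ω)) * log (Zf V (pr₂ (cos θ) (sin θ) ω))
    ∂stdG (ι ⊕ ι) with hΨ
  have hInt : ∀ θ, Integrable (fun ω => log (Zf V (pr₁ ω)) * log (Zf V (pr₂ (cos θ) (sin θ) ω)))
      (stdG (ι ⊕ ι)) := by
    intro θ
    refine integrable_of_growth ((hF.comp continuous_pr₁).mul
      (hF.comp (continuous_pr₂ _ _))).measurable (C * C) 2 fun ω => ?_
    rw [abs_mul]
    have h1 := (hC (pr₁ ω)).trans (mul_le_mul_of_nonneg_left (growth_pr₁_le ω) hC0)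
    have h2 := (hC (pr₂ (cos θ) (sin θ) ω)).trans (mul_le_mul_of_nonneg_left
      (growth_pr₂_le (abs_cos_le_one θ) (abs_sin_le_one θ) ω) hC0)
    calc _ ≤ (C * growth ω) * (C * growth ω) :=
          mul_le_mul h1 h2 (abs_nonneg _) ((abs_nonneg _).trans h1)
      _ = _ := by ring
  have hd : ∀ θ, HasDerivAt Ψ
      (-(sin θ * Ecpl V (cos θ) (sin θ) fun s t => V s ⬝ᵥ V t)) θ := by
    intro θ
    rw [← integral_logZf_mul_deriv]
    refine (hasDerivAt_integral_of_dominated_loc_of_deriv_le (s := Set.univ)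
      (bound := fun ω => (C * M) * growth ω ^ 2)
      (F' := fun θ ω => log (Zf V (pr₁ ω)) * ∑ s, wt V (pr₂ (cos θ) (sin θ) ω) s
        * (V s ⬝ᵥ pr₂ (-sin θ) (cos θ) ω)) Filter.univ_mem
      (Eventually.of_forall fun θ => (hInt θ).1) (hInt θ) ?_ ?_ ?_ ?_).2
    · refine Continuous.aestronglyMeasurable ?_
      refine (hF.comp continuous_pr₁).mul (continuous_finsetSum _ fun s _ => ?_)
      exact ((continuous_wt V s).comp (continuous_pr₂ _ _)).mul
        ((continuous_dot (V s)).comp (continuous_pr₂ _ _))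
    · refine ae_of_all _ fun ω θ _ => ?_
      rw [Real.norm_eq_abs, abs_mul]
      have h1 := (hC (pr₁ ω)).trans (mul_le_mul_of_nonneg_left (growth_pr₁_le ω) hC0)
      have h2 : |∑ s, wt V (pr₂ (cos θ) (sin θ) ω) s * (V s ⬝ᵥ pr₂ (-sin θ) (cos θ) ω)|
          ≤ M * growth ω := abs_sum_wt_mul_le V _ fun s =>
        (abs_dot_le (hM' s) hM0).trans (mul_le_mul_of_nonneg_left
          (growth_pr₂_le (by rw [abs_neg]; exact abs_sin_le_one θ) (abs_cos_le_one θ) ω) hM0)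
      calc _ ≤ (C * growth ω) * (M * growth ω) :=
            mul_le_mul h1 h2 (abs_nonneg _) ((abs_nonneg _).trans h1)
        _ = _ := by ring
    · exact (integrable_growth_pow 2).const_mul _
    · refine ae_of_all _ fun ω θ _ => HasDerivAt.const_mul _ ?_
      refine hasDerivAt_logZf V fun i => ?_
      have := ((hasDerivAt_cos θ).mul_const (ω (Sum.inl i))).add
        ((hasDerivAt_sin θ).mul_const (ω (Sum.inr i)))
      exact this
  have hcont : Continuous fun θ => sin θ * Ecpl V (cos θ) (sin θ) fun s t => V s ⬝ᵥ V t :=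
    continuous_sin.mul (continuous_Ecpl V _)
  have hFTC := intervalIntegral.integral_eq_sub_of_hasDerivAt (a := 0) (b := π / 2)
    (fun θ _ => hd θ) hcont.neg.continuousOn.intervalIntegrable
  rw [intervalIntegral.integral_neg] at hFTC
  have h0 : Ψ 0 = ∫ ω, log (Zf V ω) ^ 2 ∂stdG ι := by
    simp only [hΨ, cos_zero, sin_zero, pr₂_one_zero]
    rw [← integral_comp_of_mp measurePreserving_pr₁ (f := fun ω => log (Zf V ω) ^ 2)
      (hF.pow 2).aestronglyMeasurable]
    simp only [pow_two]
  have h1 : Ψ (π / 2) = (∫ ω, log (Zf V ω) ∂stdG ι) ^ 2 := by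
    simp only [hΨ, cos_pi_div_two, sin_pi_div_two]
    rw [pow_two, ← integral_mul_of_sum hF hF]
    refine integral_congr_ae (ae_of_all _ fun ω => ?_)
    have h2 : pr₂ 0 1 ω = fun i => ω (Sum.inr i) := by ext i; simp [pr₂]
    simp only [h2]
    rfl
  have hmem : MemLp (fun ω => log (Zf V ω)) 2 (stdG ι) := by
    rw [memLp_two_iff_integrable_sq hF.aestronglyMeasurable]
    refine integrable_of_growth (hF.pow 2).measurable (C ^ 2) 2 fun ω => ?_
    rw [abs_pow, ← mul_pow]
    exact pow_le_pow_left₀ (abs_nonneg _) (hC ω) 2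
  rw [variance_eq_sub hmem]
  simp only [Pi.pow_apply]
  rw [← h0, ← h1]
  linarith

end Coupling

/-! ### A Gaussian Prékopa–Leindler inequality -/

section PrekopaLeindler
open scoped ENNReal

lemma volume_add_le_of_isCompact {K L C : Set ℝ} (hK : IsCompact K) (hL : IsCompact L)
    (hKn : K.Nonempty) (hLn : L.Nonempty) (h : ∀ x ∈ K, ∀ y ∈ L, (x + y) / 2 ∈ C) :
    volume K + volume L ≤ 2 * volume C := by
  obtain ⟨m, hmK, hm⟩ := hK.exists_isMaxOn hKn continuousOn_id
  obtain ⟨l, hlL, hl⟩ := hL.exists_isMinOn hLn continuousOn_id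
  set C' : Set ℝ := (fun z => (1 / 2 : ℝ) * z) ⁻¹' C with hC'
  have hvol : volume C' = 2 * volume C := by
    rw [hC', Real.volume_preimage_mul_left (by norm_num)]
    norm_num
  rw [← hvol]
  set K' : Set ℝ := (fun z => -l + z) ⁻¹' K with hK'
  set L' : Set ℝ := (fun z => -m + z) ⁻¹' L with hL'
  have e1 : volume K' = volume K := measure_preimage_add _ _ _
  have e2 : volume L' = volume L := measure_preimage_add _ _ _
  have hsub : K' ∪ L' ⊆ C' := by
    rintro z (hz | hz)
    · have := h _ hz _ hlL
      simp only [hC', Set.mem_preimage]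
      convert this using 1
      ring
    · have := h _ hmK _ hz
      simp only [hC', Set.mem_preimage]
      convert this using 1
      ring
  have hmeas : MeasurableSet L' := (measurable_const_add (-m)) hL.measurableSet
  have hdisj : AEDisjoint volume K' L' := by
    refine measure_mono_null (t := {m + l}) ?_ (measure_singleton _)
    rintro z ⟨hz1, hz2⟩
    have h1 : -l + z ≤ m := hm hz1
    have h2 : l ≤ -m + z := hl hz2
    have : z = m + l := by linarith
    simp [this]
  calc volume K + volume L = volume (K' ∪ L') := by
        rw [measure_union₀ hmeas.nullMeasurableSet hdisj, e1, e2]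
    _ ≤ volume C' := measure_mono hsub

lemma volume_add_le {A B C : Set ℝ} (hA : MeasurableSet A) (hB : MeasurableSet B)
    (hAn : A.Nonempty) (hBn : B.Nonempty) (h : ∀ x ∈ A, ∀ y ∈ B, (x + y) / 2 ∈ C) :
    volume A + volume B ≤ 2 * volume C := by
  obtain ⟨x, hx⟩ := hAn
  obtain ⟨y, hy⟩ := hBn
  have key : ∀ r < volume A, ∀ s < volume B, r + s ≤ 2 * volume C := by
    intro r hr s hs
    obtain ⟨K, hKA, hK, hrK⟩ := hA.exists_lt_isCompact hr
    obtain ⟨L, hLB, hL, hsL⟩ := hB.exists_lt_isCompact hs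
    have h1 := volume_add_le_of_isCompact (C := C) (hK.union (isCompact_singleton (x := x)))
      (hL.union (isCompact_singleton (x := y))) ⟨x, by simp⟩ ⟨y, by simp⟩ (by
        intro u hu v hv
        refine h _ ?_ _ ?_
        · rcases hu with hu | hu
          · exact hKA hu
          · rw [Set.mem_singleton_iff.1 hu]; exact hx
        · rcases hv with hv | hv
          · exact hLB hv
          · rw [Set.mem_singleton_iff.1 hv]; exact hy)
    refine le_trans (add_le_add ?_ ?_) h1
    · exact hrK.le.trans (measure_mono Set.subset_union_left)
    · exact hsL.le.trans (measure_mono Set.subset_union_left)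
  have sing : ∀ {B : Set ℝ}, MeasurableSet B → B.Nonempty → ∀ {x : ℝ},
      (∀ y ∈ B, (x + y) / 2 ∈ C) → volume B ≤ 2 * volume C := by
    intro B hB hBn x hxB
    refine le_of_forall_lt_imp_le_of_dense fun s hs => ?_
    obtain ⟨L, hLB, hL, hsL⟩ := hB.exists_lt_isCompact hs
    have hLn : L.Nonempty := by
      by_contra h0
      rw [Set.not_nonempty_iff_eq_empty] at h0
      simp [h0] at hsL
    have := volume_add_le_of_isCompact (C := C) (isCompact_singleton (x := x)) hL ⟨x, by simp⟩ hLn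
      (by
        intro u hu v hv
        rw [Set.mem_singleton_iff.1 hu]
        exact hxB v (hLB hv))
    simp only [measure_singleton, zero_add] at this
    exact hsL.le.trans this
  by_cases hA0 : volume A = 0
  · rw [hA0, zero_add]
    exact sing hB ⟨y, hy⟩ fun v hv => h x hx v hv
  by_cases hB0 : volume B = 0
  · rw [hB0, add_zero]
    exact sing (x := y) hA ⟨x, hx⟩ fun v hv => by rw [add_comm]; exact h v hv y hy
  rcases eq_or_ne (2 * volume C) ∞ with hC | hC
  · rw [hC]; exact le_top
  have k2 : ∀ r < volume A, r + volume B ≤ 2 * volume C := by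
    intro r hr
    have hr0 : r ≤ 2 * volume C := by simpa using key r hr 0 (pos_iff_ne_zero.2 hB0)
    refine add_le_of_le_tsub_left_of_le hr0 ?_
    exact le_of_forall_lt_imp_le_of_dense fun s hs =>
      ENNReal.le_sub_of_add_le_left hr.ne_top (key r hr s hs)
  have hB1 : volume B ≤ 2 * volume C := by simpa using k2 0 (pos_iff_ne_zero.2 hA0)
  have hBt : volume B ≠ ∞ := ne_top_of_le_ne_top hC hB1
  refine add_le_of_le_tsub_right_of_le hB1 ?_
  exact le_of_forall_lt_imp_le_of_dense fun r hr =>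
    ENNReal.le_sub_of_add_le_right hBt (k2 r hr)

lemma lintegral_add_le_of_midpoint {f g h : ℝ → ℝ} (hf : Measurable f) (hg : Measurable g)
    (hh : Measurable h) (hf0 : ∀ x, 0 ≤ f x) (hg0 : ∀ x, 0 ≤ g x) (hh0 : ∀ x, 0 ≤ h x)
    (hf1 : ∀ x, f x ≤ 1) (hg1 : ∀ x, g x ≤ 1)
    (hfs : ∀ t < 1, ∃ x, t < f x) (hgs : ∀ t < 1, ∃ x, t < g x)
    (H : ∀ x y, f x * g y ≤ h ((x + y) / 2) ^ 2) :
    (∫⁻ x, ENNReal.ofReal (f x)) + ∫⁻ x, ENNReal.ofReal (g x)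
      ≤ 2 * ∫⁻ x, ENNReal.ofReal (h x) := by
  have lc : ∀ {u : ℝ → ℝ}, Measurable u → (∀ x, 0 ≤ u x) →
      ∫⁻ x, ENNReal.ofReal (u x) = ∫⁻ t in Set.Ioi 0, volume {x | t < u x} := fun hu hu0 =>
    lintegral_eq_lintegral_meas_lt volume (ae_of_all _ hu0) hu.aemeasurable
  have mm : ∀ u : ℝ → ℝ, Measurable fun t : ℝ => volume {x | t < u x} := by
    intro u
    refine Antitone.measurable fun s t hst => measure_mono fun x hx => ?_
    exact lt_of_le_of_lt hst hx
  rw [lc hf hf0, lc hg hg0, lc hh hh0, ← lintegral_add_left (mm f),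
    ← lintegral_const_mul _ (mm h)]
  refine setLIntegral_mono ((mm h).const_mul 2) fun t ht => ?_
  have ht0 : 0 < t := ht
  by_cases ht1 : t < 1
  · refine volume_add_le (measurableSet_lt measurable_const hf)
      (measurableSet_lt measurable_const hg) (hfs t ht1) (hgs t ht1) fun x hx y hy => ?_
    have h1 : t < f x := hx
    have h2 : t < g y := hy
    have h3 := H x y
    have h4 : t * t < f x * g y := mul_lt_mul'' h1 h2 ht0.le ht0.le
    have h5 := hh0 ((x + y) / 2)
    change t < h ((x + y) / 2)
    nlinarith
  · have e1 : {x | t < f x} = ∅ := by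
      ext x; simpa using (hf1 x).trans (not_lt.1 ht1)
    have e2 : {x | t < g x} = ∅ := by
      ext x; simpa using (hg1 x).trans (not_lt.1 ht1)
    rw [e1, e2]; simp

lemma lintegral_mul_le_of_midpoint {f g h : ℝ → ℝ} (hf : Measurable f) (hg : Measurable g)
    (hh : Measurable h) (hf0 : ∀ x, 0 ≤ f x) (hg0 : ∀ x, 0 ≤ g x) (hh0 : ∀ x, 0 ≤ h x)
    {M : ℝ} (hfM : ∀ x, f x ≤ M) (hgM : ∀ x, g x ≤ M)
    (H : ∀ x y, f x * g y ≤ h ((x + y) / 2) ^ 2) :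
    (∫⁻ x, ENNReal.ofReal (f x)) * ∫⁻ x, ENNReal.ofReal (g x)
      ≤ (∫⁻ x, ENNReal.ofReal (h x)) ^ 2 := by
  have bf : BddAbove (Set.range f) := ⟨M, by rintro _ ⟨x, rfl⟩; exact hfM x⟩
  have bg : BddAbove (Set.range g) := ⟨M, by rintro _ ⟨x, rfl⟩; exact hgM x⟩
  set A := ⨆ x, f x with hA
  set B := ⨆ x, g x with hB
  have hA0 : 0 ≤ A := Real.iSup_nonneg hf0
  have hB0 : 0 ≤ B := Real.iSup_nonneg hg0
  have hfA : ∀ x, f x ≤ A := fun x => le_ciSup bf x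
  have hgB : ∀ x, g x ≤ B := fun x => le_ciSup bg x
  rcases hA0.eq_or_lt with h0 | hApos
  · have : ∀ x, ENNReal.ofReal (f x) = 0 := fun x =>
      ENNReal.ofReal_eq_zero.2 (h0 ▸ hfA x)
    simp [this]
  rcases hB0.eq_or_lt with h0 | hBpos
  · have : ∀ x, ENNReal.ofReal (g x) = 0 := fun x =>
      ENNReal.ofReal_eq_zero.2 (h0 ▸ hgB x)
    simp [this]
  have hs : 0 < √(A * B) := sqrt_pos.2 (mul_pos hApos hBpos)
  have hss : √(A * B) ^ 2 = A * B := sq_sqrt (mul_pos hApos hBpos).le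
  have main := lintegral_add_le_of_midpoint (f := fun x => A⁻¹ * f x) (g := fun x => B⁻¹ * g x)
    (h := fun x => (√(A * B))⁻¹ * h x) (hf.const_mul _) (hg.const_mul _) (hh.const_mul _)
    (fun x => by have := hf0 x; positivity) (fun x => by have := hg0 x; positivity)
    (fun x => by have := hh0 x; positivity)
    (fun x => by rw [inv_mul_le_iff₀ hApos, mul_one]; exact hfA x)
    (fun x => by rw [inv_mul_le_iff₀ hBpos, mul_one]; exact hgB x)
    (fun t ht => by
      obtain ⟨x, hx⟩ := exists_lt_of_lt_ciSup (f := f) (b := A * t) (by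
        rw [← hA]; nlinarith)
      exact ⟨x, by rwa [lt_inv_mul_iff₀ hApos]⟩)
    (fun t ht => by
      obtain ⟨x, hx⟩ := exists_lt_of_lt_ciSup (f := g) (b := B * t) (by
        rw [← hB]; nlinarith)
      exact ⟨x, by rwa [lt_inv_mul_iff₀ hBpos]⟩)
    (fun x y => by
      rw [mul_pow, inv_pow, hss, mul_inv]
      have := H x y
      calc A⁻¹ * f x * (B⁻¹ * g y) = A⁻¹ * B⁻¹ * (f x * g y) := by ring
        _ ≤ _ := by gcongr)
  have sc : ∀ (c : ℝ), 0 ≤ c → ∀ u : ℝ → ℝ, Measurable u →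
      ∫⁻ x, ENNReal.ofReal (c * u x) = ENNReal.ofReal c * ∫⁻ x, ENNReal.ofReal (u x) := by
    intro c hc u hu
    simp_rw [ENNReal.ofReal_mul hc]
    exact lintegral_const_mul _ hu.ennreal_ofReal
  rw [sc _ (by positivity) _ hf, sc _ (by positivity) _ hg, sc _ (by positivity) _ hh] at main
  by_cases hhtop : ∫⁻ x, ENNReal.ofReal (h x) = ∞
  · rw [hhtop]; simp
  set IF := ∫⁻ x, ENNReal.ofReal (f x)
  set IG := ∫⁻ x, ENNReal.ofReal (g x)
  set IH := ∫⁻ x, ENNReal.ofReal (h x)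
  have hrt : 2 * (ENNReal.ofReal (√(A * B))⁻¹ * IH) ≠ ∞ :=
    ENNReal.mul_ne_top (by simp) (ENNReal.mul_ne_top ENNReal.ofReal_ne_top hhtop)
  have hFt : IF ≠ ∞ := by
    intro h
    rw [h, ENNReal.mul_top (by simpa using hApos)] at main
    simp only [top_add, top_le_iff] at main
    exact hrt main
  have hGt : IG ≠ ∞ := by
    intro h
    rw [h, ENNReal.mul_top (by simpa using hBpos)] at main
    simp only [add_top, top_le_iff] at main
    exact hrt main
  have m2 := ENNReal.toReal_mono hrt main
  rw [ENNReal.toReal_add (ENNReal.mul_ne_top ENNReal.ofReal_ne_top hFt)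
    (ENNReal.mul_ne_top ENNReal.ofReal_ne_top hGt)] at m2
  simp only [ENNReal.toReal_mul] at m2
  rw [ENNReal.toReal_ofReal (by positivity), ENNReal.toReal_ofReal (by positivity),
    ENNReal.toReal_ofReal (by positivity), ENNReal.toReal_ofNat] at m2
  rw [← ENNReal.toReal_le_toReal (ENNReal.mul_ne_top hFt hGt) (ENNReal.pow_ne_top hhtop),
    ENNReal.toReal_mul, ENNReal.toReal_pow]
  have pF : 0 ≤ IF.toReal := ENNReal.toReal_nonneg
  have pG : 0 ≤ IG.toReal := ENNReal.toReal_nonneg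
  have pH : 0 ≤ IH.toReal := ENNReal.toReal_nonneg
  generalize IF.toReal = u at *
  generalize IG.toReal = v at *
  generalize IH.toReal = w at *
  have k1 : (A⁻¹ * u) * (B⁻¹ * v) ≤ ((√(A * B))⁻¹ * w) ^ 2 := by
    nlinarith [sq_nonneg (A⁻¹ * u - B⁻¹ * v), mul_nonneg (inv_nonneg.2 hApos.le) pF,
      mul_nonneg (inv_nonneg.2 hBpos.le) pG, mul_nonneg (inv_nonneg.2 hs.le) pH]
  rw [mul_pow, inv_pow, hss] at k1
  have k2 := mul_le_mul_of_nonneg_left k1 (mul_pos hApos hBpos).le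
  field_simp at k2
  linarith

/-- One-dimensional Gaussian transport inequality in product form. -/
lemma lintegral_gaussianReal_mul_le {a b : ℝ → ℝ≥0∞} (ha : Measurable a) (hb : Measurable b)
    {M : ℝ≥0∞} (hM : M ≠ ∞) (haM : ∀ x, a x ≤ M) (hbM : ∀ x, b x ≤ M) {K : ℝ} (hK : 0 ≤ K)
    (H : ∀ x y, a x * b y ≤ ENNReal.ofReal (K * exp ((x - y) ^ 2 / 4))) :
    (∫⁻ x, a x ∂gaussianReal 0 1) * ∫⁻ x, b x ∂gaussianReal 0 1 ≤ ENNReal.ofReal K := by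
  have hat : ∀ x, a x ≠ ∞ := fun x => ne_top_of_le_ne_top hM (haM x)
  have hbt : ∀ x, b x ≠ ∞ := fun x => ne_top_of_le_ne_top hM (hbM x)
  set φ := gaussianPDFReal 0 1 with hφ
  have hφm : Measurable φ := measurable_gaussianPDFReal 0 1
  have hφ0 : ∀ x, 0 ≤ φ x := fun x => gaussianPDFReal_nonneg 0 1 x
  have conv : ∀ {u : ℝ → ℝ≥0∞}, Measurable u → (∀ x, u x ≠ ∞) →
      ∫⁻ x, u x ∂gaussianReal 0 1 = ∫⁻ x, ENNReal.ofReal ((u x).toReal * φ x) := by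
    intro u hu hut
    rw [gaussianReal_of_var_ne_zero 0 one_ne_zero,
      lintegral_withDensity_eq_lintegral_mul _ (measurable_gaussianPDF 0 1) hu]
    refine lintegral_congr fun x => ?_
    rw [ENNReal.ofReal_mul ENNReal.toReal_nonneg, ENNReal.ofReal_toReal (hut x), mul_comm]
    rfl
  have hφ1 : ∀ x, φ x ≤ 1 := by
    intro x
    rw [hφ, gaussianPDFReal]
    have h1 : exp (-(x - 0) ^ 2 / (2 * ((1 : NNReal) : ℝ))) ≤ 1 := by
      rw [exp_le_one_iff]
      have : 0 ≤ (x - 0) ^ 2 := sq_nonneg _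
      push_cast; linarith
    have h2 : (√(2 * π * ((1 : NNReal) : ℝ)))⁻¹ ≤ 1 := by
      refine inv_le_one_of_one_le₀ ?_
      rw [one_le_sqrt]; push_cast
      linarith [pi_gt_three]
    exact mul_le_one₀ h2 (exp_pos _).le h1
  have hMx : ∀ {u : ℝ → ℝ≥0∞}, (∀ x, u x ≤ M) → ∀ x, (u x).toReal * φ x ≤ M.toReal := by
    intro u hu x
    have := ENNReal.toReal_mono hM (hu x)
    calc (u x).toReal * φ x ≤ (u x).toReal * 1 :=
          mul_le_mul_of_nonneg_left (hφ1 x) ENNReal.toReal_nonneg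
      _ ≤ _ := by rwa [mul_one]
  have main := lintegral_mul_le_of_midpoint (f := fun x => (a x).toReal * φ x)
    (g := fun x => (b x).toReal * φ x) (h := fun x => √K * φ x)
    (ha.ennreal_toReal.mul hφm) (hb.ennreal_toReal.mul hφm) (hφm.const_mul _)
    (fun x => mul_nonneg ENNReal.toReal_nonneg (hφ0 x))
    (fun x => mul_nonneg ENNReal.toReal_nonneg (hφ0 x))
    (fun x => mul_nonneg (sqrt_nonneg _) (hφ0 x)) (hMx haM) (hMx hbM) (by
      intro x y
      have h1 := ENNReal.toReal_mono ENNReal.ofReal_ne_top (H x y)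
      rw [ENNReal.toReal_mul, ENNReal.toReal_ofReal (by positivity)] at h1
      have h2 : exp ((x - y) ^ 2 / 4) * (φ x * φ y) = φ ((x + y) / 2) ^ 2 := by
        simp only [hφ, gaussianPDFReal]
        have : ∀ c X Y Z W : ℝ, W + X + Y = 2 * Z →
            exp W * (c * exp X * (c * exp Y)) = (c * exp Z) ^ 2 := by
          intro c X Y Z W h
          calc _ = c ^ 2 * (exp W * exp X * exp Y) := by ring
            _ = c ^ 2 * exp (2 * Z) := by rw [← exp_add, ← exp_add, h]
            _ = _ := by rw [mul_pow, two_mul, exp_add]; ring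
        apply this
        push_cast; ring
      calc (a x).toReal * φ x * ((b y).toReal * φ y)
          = (a x).toReal * (b y).toReal * (φ x * φ y) := by ring
        _ ≤ K * exp ((x - y) ^ 2 / 4) * (φ x * φ y) :=
            mul_le_mul_of_nonneg_right h1 (mul_nonneg (hφ0 x) (hφ0 y))
        _ = K * (exp ((x - y) ^ 2 / 4) * (φ x * φ y)) := by ring
        _ = (√K * φ ((x + y) / 2)) ^ 2 := by rw [h2, mul_pow, sq_sqrt hK])
  rw [conv ha hat, conv hb hbt]
  refine main.trans ?_
  simp_rw [ENNReal.ofReal_mul (sqrt_nonneg K)]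
  rw [lintegral_const_mul _ hφm.ennreal_ofReal]
  have : ∫⁻ x, ENNReal.ofReal (φ x) = 1 := lintegral_gaussianPDFReal_eq_one 0 one_ne_zero
  rw [this, mul_one, ← ENNReal.ofReal_pow (sqrt_nonneg K), sq_sqrt hK]

/-- The Gaussian transport inequality in product form. -/
theorem lintegral_stdG_mul_le {ι : Type*} [Fintype ι] [DecidableEq ι] {a b : (ι → ℝ) → ℝ≥0∞}
    (ha : Measurable a) (hb : Measurable b) {M : ℝ≥0∞} (hM : M ≠ ∞) (haM : ∀ x, a x ≤ M)
    (hbM : ∀ x, b x ≤ M)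
    (H : ∀ x y, a x * b y ≤ ENNReal.ofReal (exp (∑ i, (x i - y i) ^ 2 / 4))) :
    (∫⁻ x, a x ∂stdG ι) * ∫⁻ x, b x ∂stdG ι ≤ 1 := by
  set μ : ι → Measure ℝ := fun _ => gaussianReal 0 1 with hμ
  have key : ∀ s : Finset ι, (∀ x, lmarginal μ s a x ≤ M) ∧ (∀ x, lmarginal μ s b x ≤ M) ∧
      ∀ x y, lmarginal μ s a x * lmarginal μ s b y
        ≤ ENNReal.ofReal (exp (∑ i ∈ sᶜ, (x i - y i) ^ 2 / 4)) := by
    intro s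
    induction s using Finset.induction with
    | empty => simpa using ⟨haM, hbM, H⟩
    | insert i s hi ih =>
      obtain ⟨h1, h2, h3⟩ := ih
      have bnd : ∀ {u : (ι → ℝ) → ℝ≥0∞}, Measurable u → (∀ x, lmarginal μ s u x ≤ M) →
          ∀ x, lmarginal μ (insert i s) u x ≤ M := by
        intro u hu hus x
        rw [lmarginal_insert _ hu hi]
        calc _ ≤ ∫⁻ _, M ∂(μ i) := lintegral_mono fun y => hus _
          _ = M := by simp [hμ]
      refine ⟨bnd ha h1, bnd hb h2, fun x y => ?_⟩
      rw [lmarginal_insert _ ha hi, lmarginal_insert _ hb hi]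
      refine lintegral_gaussianReal_mul_le
        ((ha.lmarginal μ).comp (measurable_update x)) ((hb.lmarginal μ).comp (measurable_update y))
        hM (fun u => h1 _) (fun u => h2 _) (exp_pos _).le fun u v => ?_
      refine (h3 _ _).trans (le_of_eq ?_)
      rw [← exp_add]
      congr 2
      have hc : sᶜ = insert i (insert i s)ᶜ := by
        ext j; by_cases hj : j = i
        · subst hj; simp [hi]
        · simp [hj]
      rw [hc, Finset.sum_insert (by simp), Function.update_self, Function.update_self, add_comm]
      congr 1
      refine Finset.sum_congr rfl fun j hj => ?_
      have : j ≠ i := by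
        rintro rfl; simp at hj
      rw [Function.update_of_ne this, Function.update_of_ne this]
  have h := (key Finset.univ).2.2 0 0
  rw [lmarginal_univ, lmarginal_univ] at h
  simpa [stdG, hμ] using h

end PrekopaLeindler

/-! ### Lower tail of the partition function and overlap tails -/

section LowerTail
open scoped ENNReal

variable {ι S : Type*} [Fintype ι] [Fintype S] [Nonempty S] (V : S → ι → ℝ)

lemma logZf_ge (g h : ι → ℝ) :
    log (Zf V g) + ∑ s, wt V g s * (V s ⬝ᵥ (h - g)) ≤ log (Zf V h) := by
  have h1 : exp (∑ s, wt V g s • (V s ⬝ᵥ (h - g))) ≤ ∑ s, wt V g s • exp (V s ⬝ᵥ (h - g)) :=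
    convexOn_exp.map_sum_le (fun s _ => wt_nonneg V g s) (sum_wt V g) fun s _ => Set.mem_univ _
  have h2 : ∑ s, wt V g s • exp (V s ⬝ᵥ (h - g)) = Zf V h / Zf V g := by
    rw [Zf, Finset.sum_div]
    refine Finset.sum_congr rfl fun s _ => ?_
    rw [smul_eq_mul, wt, div_mul_eq_mul_div, ← exp_add, dotProduct_sub]
    congr 2; ring
  rw [h2] at h1
  have h3 := (le_log_iff_exp_le (div_pos (Zf_pos V h) (Zf_pos V g))).2 h1
  rw [log_div (Zf_pos V h).ne' (Zf_pos V g).ne'] at h3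
  simp only [smul_eq_mul] at h3
  linarith

lemma logZf_ge_sub (g h : ι → ℝ) {κ Λ : ℝ} (hκ : 0 ≤ κ)
    (hΛ : ∑ s, ∑ t, wt V g s * wt V g t * (V s ⬝ᵥ V t) ≤ Λ) :
    κ * (log (Zf V g) - log (Zf V h)) ≤ κ ^ 2 * Λ + ∑ i, (g i - h i) ^ 2 / 4 := by
  set u : ι → ℝ := fun i => ∑ s, wt V g s * V s i with hu
  have h1 : ∑ s, wt V g s * (V s ⬝ᵥ (h - g)) = ∑ i, u i * (h i - g i) := by
    simp only [hu, dotProduct, Finset.mul_sum, Finset.sum_mul, Pi.sub_apply]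
    rw [Finset.sum_comm]
    refine Finset.sum_congr rfl fun i _ => Finset.sum_congr rfl fun s _ => by ring
  have h2 : ∑ s, ∑ t, wt V g s * wt V g t * (V s ⬝ᵥ V t) = ∑ i, u i ^ 2 := by
    have h3 : ∀ s t, wt V g s * wt V g t * (V s ⬝ᵥ V t)
        = ∑ i, (wt V g s * V s i) * (wt V g t * V t i) := by
      intro s t
      rw [dotProduct, Finset.mul_sum]
      refine Finset.sum_congr rfl fun i _ => by ring
    simp_rw [h3, hu, sq, Finset.sum_mul_sum]
    rw [Finset.sum_comm (s := (Finset.univ : Finset ι))]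
    exact Finset.sum_congr rfl fun s _ => Finset.sum_comm
  have h3 := logZf_ge V g h
  rw [h1] at h3
  rw [h2] at hΛ
  have h4 : -(κ * ∑ i, u i * (h i - g i)) ≤ κ ^ 2 * ∑ i, u i ^ 2 + ∑ i, (g i - h i) ^ 2 / 4 := by
    rw [Finset.mul_sum, Finset.mul_sum, ← Finset.sum_neg_distrib, ← Finset.sum_add_distrib]
    refine Finset.sum_le_sum fun i _ => ?_
    nlinarith [sq_nonneg (κ * u i - (g i - h i) / 2)]
  have h5 := mul_le_mul_of_nonneg_left hΛ (sq_nonneg κ)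
  have h6 := mul_le_mul_of_nonneg_left h3 hκ
  nlinarith

lemma one_le_Zf (h0 : ∀ i, ∑ s, V s i = 0) (ω : ι → ℝ) : 1 ≤ Zf V ω := by
  have h1 : ∑ s, (V s ⬝ᵥ ω + 1) ≤ Zf V ω := Finset.sum_le_sum fun s _ => add_one_le_exp _
  have h2 : ∑ s, V s ⬝ᵥ ω = 0 := by
    simp only [dotProduct]
    rw [Finset.sum_comm]
    simp_rw [← Finset.sum_mul, h0]
    simp
  rw [Finset.sum_add_distrib, h2, zero_add] at h1
  have h3 : (1 : ℝ) ≤ Fintype.card S := by exact_mod_cast Fintype.card_pos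
  simp only [Finset.sum_const, Finset.card_univ, nsmul_eq_mul, mul_one] at h1
  linarith

variable {Θ : S → S → ℝ} {v K γ : ℝ}

/-- The tilted second moment weight. -/
def tilt (Θ : S → S → ℝ) (ω : ι → ℝ) : ℝ := ∑ s, ∑ t, exp (V s ⬝ᵥ ω) * exp (V t ⬝ᵥ ω) * Θ s t

lemma integrable_tilt : Integrable (tilt V Θ) (stdG ι) := by
  unfold tilt
  refine integrable_finsetSum _ fun s _ => integrable_finsetSum _ fun t _ => ?_
  simp_rw [← exp_add, ← add_dotProduct]
  exact (integrable_exp_dot _).mul_const _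

lemma integral_tilt (hv : ∀ s, V s ⬝ᵥ V s = v) :
    ∫ ω, tilt V Θ ω ∂stdG ι = exp v * ∑ s, ∑ t, exp (V s ⬝ᵥ V t) * Θ s t := by
  unfold tilt
  rw [integral_finsetSum _ fun s _ => integrable_finsetSum _ fun t _ => by
    simp_rw [← exp_add, ← add_dotProduct]
    exact (integrable_exp_dot _).mul_const _, Finset.mul_sum]
  refine Finset.sum_congr rfl fun s _ => ?_
  rw [integral_finsetSum _ fun t _ => by
    simp_rw [← exp_add, ← add_dotProduct]
    exact (integrable_exp_dot _).mul_const _, Finset.mul_sum]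
  refine Finset.sum_congr rfl fun t _ => ?_
  simp_rw [← exp_add, ← add_dotProduct]
  rw [integral_mul_const, integral_exp_dot, ← mul_assoc, ← exp_add]
  congr 2
  rw [add_dotProduct, dotProduct_add, dotProduct_add, hv, hv, dotProduct_comm (V t) (V s)]
  ring

lemma sq_Zf_le_tilt (hΘ : ∀ s t, 1 ≤ Θ s t) (ω : ι → ℝ) : Zf V ω ^ 2 ≤ tilt V Θ ω := by
  rw [sq, Zf, Finset.sum_mul_sum, tilt]
  refine Finset.sum_le_sum fun s _ => Finset.sum_le_sum fun t _ => ?_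
  exact le_mul_of_one_le_right (by positivity) (hΘ s t)

lemma tilt_eq (ω : ι → ℝ) :
    tilt V Θ ω = Zf V ω ^ 2 * ∑ s, ∑ t, wt V ω s * wt V ω t * Θ s t := by
  rw [tilt, Finset.mul_sum]
  refine Finset.sum_congr rfl fun s _ => ?_
  rw [Finset.mul_sum]
  refine Finset.sum_congr rfl fun t _ => ?_
  have := (Zf_pos V ω).ne'
  rw [wt, wt]; field_simp

lemma integral_Zf (hv : ∀ s, V s ⬝ᵥ V s = v) :
    ∫ ω, Zf V ω ∂stdG ι = Fintype.card S * exp (v / 2) := by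
  unfold Zf
  rw [integral_finsetSum _ fun s _ => integrable_exp_dot _]
  simp_rw [integral_exp_dot, hv]
  simp

/-- The good event, on which the partition function is large and the tilted moment is small. -/
def goodSet (Θ : S → S → ℝ) (m K : ℝ) : Set (ι → ℝ) :=
  {ω | m / 2 ≤ Zf V ω ∧ tilt V Θ ω ≤ 64 * K ^ 2 * m ^ 2}

lemma continuous_tilt : Continuous (tilt V Θ) := by unfold tilt; fun_prop

lemma measurableSet_goodSet (m : ℝ) : MeasurableSet (goodSet V Θ m K) :=
  (measurableSet_le measurable_const (continuous_Zf V).measurable).inter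
    (measurableSet_le (continuous_tilt V).measurable measurable_const)

lemma measure_goodSet_ge {m : ℝ} (hm : m = Fintype.card S * exp (v / 2))
    (hv : ∀ s, V s ⬝ᵥ V s = v) (hΘ : ∀ s t, 1 ≤ Θ s t) (hK : 1 ≤ K)
    (hsum : ∑ s, ∑ t, exp (V s ⬝ᵥ V t) * Θ s t ≤ (Fintype.card S : ℝ) ^ 2 * K) :
    1 / (8 * K) ≤ (stdG ι).real (goodSet V Θ m K) := by
  have hm0 : 0 < m := by
    rw [hm]
    have : (0 : ℝ) < Fintype.card S := by exact_mod_cast Fintype.card_pos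
    positivity
  have hEZ := integral_Zf V hv
  rw [← hm] at hEZ
  have hET : ∫ ω, tilt V Θ ω ∂stdG ι ≤ m ^ 2 * K := by
    rw [integral_tilt V hv, hm, mul_pow, ← exp_nat_mul]
    calc exp v * ∑ s, ∑ t, exp (V s ⬝ᵥ V t) * Θ s t
        ≤ exp v * ((Fintype.card S : ℝ) ^ 2 * K) := by gcongr
      _ = _ := by push_cast; ring_nf
  set A := goodSet V Θ m K with hA
  have hAm := measurableSet_goodSet V (Θ := Θ) (K := K) m
  have pw : ∀ ω, Zf V ω ≤ m / 2 + A.indicator (fun _ => 2 * K * m) ω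
      + tilt V Θ ω / (4 * K * m) := by
    intro ω
    have hZ := Zf_pos V ω
    have hT := sq_Zf_le_tilt V hΘ ω
    have hT0 : 0 ≤ tilt V Θ ω := (sq_nonneg _).trans hT
    by_cases hω : ω ∈ A
    · rw [Set.indicator_of_mem hω]
      have : Zf V ω ≤ 2 * K * m + tilt V Θ ω / (4 * K * m) := by
        rw [← sub_le_iff_le_add', le_div_iff₀ (by positivity)]
        nlinarith [sq_nonneg (Zf V ω - 2 * K * m)]
      linarith
    · rw [Set.indicator_of_notMem hω]
      by_cases h1 : m / 2 ≤ Zf V ω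
      · have h2 : 64 * K ^ 2 * m ^ 2 < tilt V Θ ω := by
          by_contra h
          exact hω ⟨h1, not_lt.1 h⟩
        have : Zf V ω ≤ tilt V Θ ω / (4 * K * m) := by
          rw [le_div_iff₀ (by positivity)]
          nlinarith [sq_nonneg (Zf V ω - 4 * K * m), mul_pos hZ hm0,
            mul_nonneg (mul_nonneg hZ.le (by linarith : (0:ℝ) ≤ K)) hm0.le]
        linarith
      · have : 0 ≤ tilt V Θ ω / (4 * K * m) := by positivity
        linarith
  have iZ : Integrable (Zf V) (stdG ι) := by
    unfold Zf; exact integrable_finsetSum _ fun s _ => integrable_exp_dot _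
  have iT := integrable_tilt V (Θ := Θ)
  have iA : Integrable (A.indicator (fun _ => 2 * K * m)) (stdG ι) :=
    (integrable_const _).indicator hAm
  have i1 : Integrable (fun ω => m / 2 + A.indicator (fun _ => 2 * K * m) ω) (stdG ι) :=
    (integrable_const _).add iA
  have h1 := integral_mono iZ (i1.add (iT.div_const _)) pw
  simp only [Pi.add_apply] at h1
  rw [hEZ, integral_add i1 (iT.div_const _), integral_add (integrable_const _) iA,
    integral_div (4 * K * m) (tilt V Θ), integral_indicator_const _ hAm] at h1
  simp only [integral_const, probReal_univ, smul_eq_mul, one_mul] at h1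
  have h2 : (∫ ω, tilt V Θ ω ∂stdG ι) / (4 * K * m) ≤ m / 4 := by
    rw [div_le_iff₀ (by positivity)]
    nlinarith
  rw [div_le_iff₀ (by positivity)]
  have h3 : m / 4 ≤ (stdG ι).real A * (2 * K * m) := by linarith
  have : m * (1 - (stdG ι).real A * (8 * K)) ≤ 0 := by nlinarith
  nlinarith

lemma gibbs_le_of_mem_goodSet {m : ℝ} (hm : 0 < m) (hΘ : ∀ s t, 1 ≤ Θ s t) (hK : 1 ≤ K)
    (hγ : 0 ≤ γ) (hG : ∀ s t, V s ⬝ᵥ V t ≤ γ * log (Θ s t)) {g : ι → ℝ}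
    (hg : g ∈ goodSet V Θ m K) :
    ∑ s, ∑ t, wt V g s * wt V g t * (V s ⬝ᵥ V t) ≤ γ * log (256 * K ^ 2) := by
  obtain ⟨h1, h2⟩ := hg
  rw [tilt_eq] at h2
  set c := 256 * K ^ 2 with hc
  have hc0 : 0 < c := by positivity
  set X := ∑ s, ∑ t, wt V g s * wt V g t * Θ s t with hX
  have hsum : ∑ s, ∑ t, wt V g s * wt V g t = 1 := by
    rw [← Finset.sum_mul_sum, sum_wt, one_mul]
  have hXc : X ≤ c := by
    have hX0 : 0 ≤ X := Finset.sum_nonneg fun s _ => Finset.sum_nonneg fun t _ =>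
      mul_nonneg (mul_nonneg (wt_nonneg V g s) (wt_nonneg V g t)) (zero_le_one.trans (hΘ s t))
    have h3 : (m / 2) ^ 2 ≤ Zf V g ^ 2 := by gcongr
    have h4 : (m / 2) ^ 2 * X ≤ 64 * K ^ 2 * m ^ 2 :=
      (mul_le_mul_of_nonneg_right h3 hX0).trans h2
    have h5 : m ^ 2 * X ≤ m ^ 2 * c := by rw [hc]; nlinarith
    exact le_of_mul_le_mul_left h5 (by positivity)
  have hlog : ∀ s t, V s ⬝ᵥ V t ≤ γ * (Θ s t / c - 1 + log c) := by
    intro s t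
    refine (hG s t).trans (mul_le_mul_of_nonneg_left ?_ hγ)
    have hpos : 0 < Θ s t := zero_lt_one.trans_le (hΘ s t)
    have := log_le_sub_one_of_pos (div_pos hpos hc0)
    rw [log_div hpos.ne' hc0.ne'] at this
    linarith
  calc ∑ s, ∑ t, wt V g s * wt V g t * (V s ⬝ᵥ V t)
      ≤ ∑ s, ∑ t, wt V g s * wt V g t * (γ * (Θ s t / c - 1 + log c)) :=
        Finset.sum_le_sum fun s _ => Finset.sum_le_sum fun t _ =>
          mul_le_mul_of_nonneg_left (hlog s t) (mul_nonneg (wt_nonneg V g s) (wt_nonneg V g t))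
    _ = γ / c * X + γ * (log c - 1) * ∑ s, ∑ t, wt V g s * wt V g t := by
        rw [hX, Finset.mul_sum, Finset.mul_sum, ← Finset.sum_add_distrib]
        refine Finset.sum_congr rfl fun s _ => ?_
        rw [Finset.mul_sum, Finset.mul_sum, ← Finset.sum_add_distrib]
        refine Finset.sum_congr rfl fun t _ => by ring
    _ = γ * (X / c) + γ * (log c - 1) := by rw [hsum]; ring
    _ ≤ γ * 1 + γ * (log c - 1) := by
        gcongr; exact (div_le_one hc0).2 hXc
    _ = _ := by ring

/-- Exponential integrability of the lower tail of the free energy. -/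
lemma integral_exp_neg_logZf_le [DecidableEq ι] {m : ℝ} (hm : m = Fintype.card S * exp (v / 2))
    (hv : ∀ s, V s ⬝ᵥ V s = v) (h0 : ∀ i, ∑ s, V s i = 0) (hΘ : ∀ s t, 1 ≤ Θ s t) (hK : 1 ≤ K)
    (hsum : ∑ s, ∑ t, exp (V s ⬝ᵥ V t) * Θ s t ≤ (Fintype.card S : ℝ) ^ 2 * K)
    (hγ : 0 ≤ γ) (hG : ∀ s t, V s ⬝ᵥ V t ≤ γ * log (Θ s t)) {κ : ℝ} (hκ : 0 ≤ κ) :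
    Integrable (fun ω => exp (κ * (log (m / 2) - log (Zf V ω)))) (stdG ι) ∧
    ∫ ω, exp (κ * (log (m / 2) - log (Zf V ω))) ∂stdG ι
      ≤ 8 * K * exp (κ ^ 2 * (γ * log (256 * K ^ 2))) := by
  have hm0 : 0 < m := by
    rw [hm]
    have : (0 : ℝ) < Fintype.card S := by exact_mod_cast Fintype.card_pos
    positivity
  set Λ := γ * log (256 * K ^ 2) with hΛ
  set L := log (m / 2) with hL
  set b : (ι → ℝ) → ℝ := fun ω => exp (κ * (L - log (Zf V ω))) with hb
  have hbm : Measurable b := by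
    have := (continuous_logZf V).measurable
    rw [hb]; fun_prop
  have hbM : ∀ ω, b ω ≤ exp (κ * L) := by
    intro ω
    refine exp_le_exp.2 ?_
    have := log_nonneg (one_le_Zf V h0 ω)
    nlinarith
  have hInt : Integrable b (stdG ι) := integrable_of_bounded hbm (exp (κ * L)) fun ω => by
    rw [abs_of_pos (exp_pos _)]; exact hbM ω
  refine ⟨hInt, ?_⟩
  set A := goodSet V Θ m K with hA
  have hAm : MeasurableSet A := measurableSet_goodSet V m
  have hPA := measure_goodSet_ge V hm hv hΘ hK hsum
  have key := lintegral_stdG_mul_le (a := A.indicator 1)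
    (b := fun ω => ENNReal.ofReal (exp (-(κ ^ 2 * Λ)) * b ω))
    (measurable_one.indicator hAm) (hbm.const_mul _).ennreal_ofReal
    (M := max 1 (ENNReal.ofReal (exp (-(κ ^ 2 * Λ)) * exp (κ * L)))) (by simp)
    (fun x => le_max_of_le_left (by
      by_cases hx : x ∈ A <;> simp [hx]))
    (fun x => le_max_of_le_right (ENNReal.ofReal_le_ofReal
      (mul_le_mul_of_nonneg_left (hbM x) (exp_pos _).le))) (by
      intro x y
      by_cases hx : x ∈ A
      · rw [Set.indicator_of_mem hx, Pi.one_apply, one_mul]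
        refine ENNReal.ofReal_le_ofReal ?_
        rw [hb, ← exp_add]
        refine exp_le_exp.2 ?_
        have h1 := gibbs_le_of_mem_goodSet V hm0 hΘ hK hγ hG hx
        have h2 := logZf_ge_sub V x y hκ h1
        have h3 : L ≤ log (Zf V x) := log_le_log (by positivity) hx.1
        have h4 := mul_le_mul_of_nonneg_left h3 hκ
        rw [← hΛ] at h2
        linarith
      · rw [Set.indicator_of_notMem hx, zero_mul]; exact zero_le)
  rw [lintegral_indicator_one hAm, ← ofReal_integral_eq_lintegral_ofReal (hInt.const_mul _)
    (ae_of_all _ fun ω => by positivity), integral_const_mul] at key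
  have hP : stdG ι A = ENNReal.ofReal ((stdG ι).real A) := by
    rw [measureReal_def, ENNReal.ofReal_toReal (measure_ne_top _ _)]
  rw [hP, ← ENNReal.ofReal_mul measureReal_nonneg, ← ENNReal.ofReal_one,
    ENNReal.ofReal_le_ofReal_iff zero_le_one] at key
  set I := ∫ ω, b ω ∂stdG ι with hI
  have hI0 : 0 ≤ I := integral_nonneg fun ω => (exp_pos _).le
  have h1 : 1 / (8 * K) * (exp (-(κ ^ 2 * Λ)) * I) ≤ 1 :=
    (mul_le_mul_of_nonneg_right hPA (by positivity)).trans key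
  rw [exp_neg] at h1
  field_simp at h1
  have : (0:ℝ) < exp (κ ^ 2 * Λ) := exp_pos _
  linarith

/-- Tail bound for two-replica events. -/
theorem integral_gibbs_le [DecidableEq ι]
    (hv : ∀ s, V s ⬝ᵥ V s = v) (h0 : ∀ i, ∑ s, V s i = 0) (hΘ : ∀ s t, 1 ≤ Θ s t) (hK : 1 ≤ K)
    (hsum : ∑ s, ∑ t, exp (V s ⬝ᵥ V t) * Θ s t ≤ (Fintype.card S : ℝ) ^ 2 * K)
    (hγ : 0 ≤ γ) (hG : ∀ s t, V s ⬝ᵥ V t ≤ γ * log (Θ s t)) {κ : ℝ} (hκ : 0 ≤ κ)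
    {f : S → S → ℝ} {z : ℝ} (hf1 : ∀ s t, f s t ≤ 1) (hfz : ∀ s t, f s t ≤ exp (-z) * Θ s t)
    (y : ℝ) :
    ∫ ω, (∑ s, ∑ t, wt V ω s * wt V ω t * f s t) ∂stdG ι
      ≤ 8 * K * exp (κ ^ 2 * (γ * log (256 * K ^ 2)) - κ * y) + 4 * K * exp (2 * y - z) := by
  set m : ℝ := Fintype.card S * exp (v / 2) with hm
  have hm0 : 0 < m := by
    rw [hm]
    have : (0 : ℝ) < Fintype.card S := by exact_mod_cast Fintype.card_pos
    positivity
  obtain ⟨i1, h1⟩ := integral_exp_neg_logZf_le V hm hv h0 hΘ hK hsum hγ hG hκ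
  have i2 := integrable_tilt V (Θ := Θ)
  set L := log (m / 2) with hL
  have pw : ∀ ω, ∑ s, ∑ t, wt V ω s * wt V ω t * f s t
      ≤ exp (-(κ * y)) * exp (κ * (L - log (Zf V ω))) +
        4 * exp (2 * y - z) / m ^ 2 * tilt V Θ ω := by
    intro ω
    have hw : ∀ s t, 0 ≤ wt V ω s * wt V ω t := fun s t =>
      mul_nonneg (wt_nonneg V ω s) (wt_nonneg V ω t)
    have hT0 : 0 ≤ tilt V Θ ω := (sq_nonneg _).trans (sq_Zf_le_tilt V hΘ ω)
    by_cases hω : log (Zf V ω) ≤ L - y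
    · have h2 : ∑ s, ∑ t, wt V ω s * wt V ω t * f s t ≤ 1 := by
        calc _ ≤ ∑ s, ∑ t, wt V ω s * wt V ω t := Finset.sum_le_sum fun s _ =>
              Finset.sum_le_sum fun t _ => mul_le_of_le_one_right (hw s t) (hf1 s t)
          _ = 1 := by rw [← Finset.sum_mul_sum, sum_wt, one_mul]
      have h3 : 1 ≤ exp (-(κ * y)) * exp (κ * (L - log (Zf V ω))) := by
        rw [← exp_add]
        refine one_le_exp ?_
        nlinarith
      have h4 : 0 ≤ 4 * exp (2 * y - z) / m ^ 2 * tilt V Θ ω := by positivity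
      linarith
    · have h2 : ∑ s, ∑ t, wt V ω s * wt V ω t * f s t
          ≤ exp (-z) * ∑ s, ∑ t, wt V ω s * wt V ω t * Θ s t := by
        rw [Finset.mul_sum]
        refine Finset.sum_le_sum fun s _ => ?_
        rw [Finset.mul_sum]
        refine Finset.sum_le_sum fun t _ => ?_
        nlinarith [mul_le_mul_of_nonneg_left (hfz s t) (hw s t)]
      have h3 : m / 2 * exp (-y) ≤ Zf V ω := by
        have h5 : L - y ≤ log (Zf V ω) := (not_le.1 hω).le
        rw [le_log_iff_exp_le (Zf_pos V ω), sub_eq_add_neg, exp_add, hL,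
          exp_log (by positivity)] at h5
        exact h5
      set X := ∑ s, ∑ t, wt V ω s * wt V ω t * Θ s t with hX
      have hX0 : 0 ≤ X := Finset.sum_nonneg fun s _ => Finset.sum_nonneg fun t _ =>
        mul_nonneg (hw s t) (zero_le_one.trans (hΘ s t))
      have h4 : exp (-z) * X ≤ 4 * exp (2 * y - z) / m ^ 2 * tilt V Θ ω := by
        rw [tilt_eq, ← hX]
        have h6 : (m / 2 * exp (-y)) ^ 2 ≤ Zf V ω ^ 2 := by gcongr
        calc exp (-z) * X
            = 4 * exp (2 * y - z) / m ^ 2 * ((m / 2 * exp (-y)) ^ 2 * X) := by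
              have : exp (2 * y - z) * exp (-y) ^ 2 = exp (-z) := by
                rw [← exp_nat_mul, ← exp_add]; congr 1; push_cast; ring
              rw [← this]; field_simp; ring
          _ ≤ _ := by gcongr
      have h5 : 0 ≤ exp (-(κ * y)) * exp (κ * (L - log (Zf V ω))) := by positivity
      linarith
  have iL : Integrable (fun ω => ∑ s, ∑ t, wt V ω s * wt V ω t * f s t) (stdG ι) := by
    obtain ⟨M, -, hM⟩ := exists_bound f
    refine integrable_of_bounded ?_ M fun ω => ?_
    · refine (continuous_finsetSum _ fun s _ => continuous_finsetSum _ fun t _ => ?_).measurable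
      exact ((continuous_wt V s).mul (continuous_wt V t)).mul continuous_const
    · simp_rw [mul_assoc, ← Finset.mul_sum]
      exact abs_sum_wt_mul_le V _ fun s => abs_sum_wt_mul_le V _ fun t => hM s t
  have h2 := integral_mono iL ((i1.const_mul (exp (-(κ * y)))).add
    (i2.const_mul (4 * exp (2 * y - z) / m ^ 2))) pw
  refine h2.trans ?_
  simp only [Pi.add_apply]
  rw [integral_add (i1.const_mul _) (i2.const_mul _), integral_const_mul, integral_const_mul]
  refine add_le_add ?_ ?_
  · calc _ ≤ exp (-(κ * y)) * (8 * K * exp (κ ^ 2 * (γ * log (256 * K ^ 2)))) := by gcongr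
      _ = _ := by rw [sub_eq_add_neg, exp_add]; ring
  · rw [integral_tilt V hv]
    calc _ ≤ 4 * exp (2 * y - z) / m ^ 2 * (exp v * ((Fintype.card S : ℝ) ^ 2 * K)) := by gcongr
      _ = 4 * exp (2 * y - z) / m ^ 2 * (m ^ 2 * K) := by
        congr 1
        rw [hm, mul_pow, ← exp_nat_mul]; push_cast; ring_nf
      _ ≤ _ := by field_simp; exact le_rfl

end LowerTail

/-! ### The SK model as a Gaussian Gibbs measure -/

section SKModel

lemma spin_mul_self (b : Bool) : spin b * spin b = 1 := by cases b <;> simp [spin]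

lemma spin_not (b : Bool) : spin (!b) = -spin b := by cases b <;> simp [spin]

lemma abs_spin (b : Bool) : |spin b| = 1 := by cases b <;> simp [spin]

variable (N : ℕ) (β : ℝ)

/-- Coefficient vector of the SK Hamiltonian. -/
def hv (σ : Config N) (p : Fin N × Fin N) : ℝ :=
  if p.1 < p.2 then β / √N * (spin (σ p.1) * spin (σ p.2)) else 0

lemma ham_eq (g : Fin N × Fin N → ℝ) (σ : Config N) : ham N β g σ = hv N β σ ⬝ᵥ g := by
  rw [ham, Finset.mul_sum, dotProduct, Finset.sum_filter]
  refine Finset.sum_congr rfl fun p _ => ?_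
  unfold hv
  split_ifs
  · ring
  · simp

lemma freeEnergy_eq : freeEnergy N β = fun g => log (Zf (hv N β) g) := by
  ext g
  simp only [freeEnergy, partFun, Zf, ham_eq]

lemma sum_lt_mul_mul (a : Fin N → ℝ) :
    ∑ p : Fin N × Fin N, (if p.1 < p.2 then a p.1 * a p.2 else 0)
      = ((∑ i, a i) ^ 2 - ∑ i, a i ^ 2) / 2 := by
  have h1 : (∑ i, a i) ^ 2 = ∑ p : Fin N × Fin N, a p.1 * a p.2 := by
    rw [sq, Finset.sum_mul_sum, Fintype.sum_prod_type]
  have h2 : ∑ p : Fin N × Fin N, (if p.2 < p.1 then a p.1 * a p.2 else 0)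
      = ∑ p : Fin N × Fin N, (if p.1 < p.2 then a p.1 * a p.2 else 0) := by
    refine Fintype.sum_equiv (Equiv.prodComm _ _) _ _ fun p => ?_
    simp [mul_comm]
  have h3 : ∑ i, a i ^ 2 = ∑ p : Fin N × Fin N, (if p.1 = p.2 then a p.1 * a p.2 else 0) := by
    rw [Fintype.sum_prod_type]
    refine Finset.sum_congr rfl fun i _ => ?_
    simp [sq]
  have h4 : ∑ p : Fin N × Fin N, a p.1 * a p.2
      = ∑ p : Fin N × Fin N, (if p.1 < p.2 then a p.1 * a p.2 else 0)
        + ∑ p : Fin N × Fin N, (if p.2 < p.1 then a p.1 * a p.2 else 0)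
        + ∑ p : Fin N × Fin N, (if p.1 = p.2 then a p.1 * a p.2 else 0) := by
    rw [← Finset.sum_add_distrib, ← Finset.sum_add_distrib]
    refine Finset.sum_congr rfl fun p _ => ?_
    rcases lt_trichotomy p.1 p.2 with h | h | h
    · simp [h, h.not_gt, h.ne]
    · simp [h]
    · simp [h, h.not_gt, h.ne']
  rw [h1, h3, h4, h2]; ring

lemma hv_dot (hN : 0 < N) (σ τ : Config N) :
    hv N β σ ⬝ᵥ hv N β τ = β ^ 2 / 2 * (N * ovlp N σ τ ^ 2 - 1) := by
  have hN' : (0 : ℝ) < N := by exact_mod_cast hN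
  have h1 : hv N β σ ⬝ᵥ hv N β τ = β ^ 2 / N * ∑ p : Fin N × Fin N,
      (if p.1 < p.2 then (spin (σ p.1) * spin (τ p.1)) * (spin (σ p.2) * spin (τ p.2)) else 0) := by
    rw [dotProduct, Finset.mul_sum]
    refine Finset.sum_congr rfl fun p _ => ?_
    unfold hv
    split_ifs
    · have : √(N : ℝ) ^ 2 = N := sq_sqrt hN'.le
      field_simp
      rw [this]; ring
    · simp
  rw [h1, sum_lt_mul_mul N fun i => spin (σ i) * spin (τ i)]
  have h2 : ∑ i, (spin (σ i) * spin (τ i)) ^ 2 = N := by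
    have : ∀ i, (spin (σ i) * spin (τ i)) ^ 2 = 1 := fun i => by
      calc _ = (spin (σ i) * spin (σ i)) * (spin (τ i) * spin (τ i)) := by ring
        _ = 1 := by rw [spin_mul_self, spin_mul_self, one_mul]
    simp [this]
  rw [h2, ovlp]
  field_simp

lemma ovlp_self (hN : 0 < N) (σ : Config N) : ovlp N σ σ = 1 := by
  have hN' : (N : ℝ) ≠ 0 := by exact_mod_cast hN.ne'
  simp [ovlp, spin_mul_self, hN']

lemma hv_dot_self (hN : 0 < N) (σ : Config N) :
    hv N β σ ⬝ᵥ hv N β σ = β ^ 2 / 2 * (N - 1) := by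
  rw [hv_dot N β hN, ovlp_self N hN]; ring

lemma abs_ovlp_le_one (σ τ : Config N) : |ovlp N σ τ| ≤ 1 := by
  rw [ovlp, abs_div, Nat.abs_cast]
  refine div_le_one_of_le₀ ?_ (Nat.cast_nonneg N)
  calc _ ≤ ∑ i, |spin (σ i) * spin (τ i)| := Finset.abs_sum_le_sum_abs _ _
    _ = N := by simp [abs_mul, abs_spin]

variable {N}

/-- Flip of the spin at site `i`. -/
def flip (i : Fin N) (σ : Config N) : Config N := Function.update σ i (!σ i)

lemma flip_flip (i : Fin N) (σ : Config N) : flip i (flip i σ) = σ := by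
  unfold flip; simp

/-- Spin flips as permutations. -/
def flipEquiv (i : Fin N) : Config N ≃ Config N where
  toFun := flip i
  invFun := flip i
  left_inv := flip_flip i
  right_inv := flip_flip i

lemma spin_flip_self (i : Fin N) (σ : Config N) : spin (flip i σ i) = -spin (σ i) := by
  simp [flip, spin_not]

lemma spin_flip_of_ne {i j : Fin N} (h : j ≠ i) (σ : Config N) :
    spin (flip i σ j) = spin (σ j) := by
  simp [flip, h]

variable (N)

lemma sum_hv (p : Fin N × Fin N) : ∑ σ, hv N β σ p = 0 := by
  have h1 : ∑ σ, hv N β (flip p.1 σ) p = ∑ σ, hv N β σ p :=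
    (flipEquiv p.1).sum_comp fun σ => hv N β σ p
  have h2 : ∀ σ, hv N β (flip p.1 σ) p = -hv N β σ p := by
    intro σ
    unfold hv
    split_ifs with h
    · rw [spin_flip_self, spin_flip_of_ne h.ne']; ring
    · simp
  simp_rw [h2, Finset.sum_neg_distrib] at h1
  linarith

lemma integral_exp_sq_gaussianReal {a : ℝ} (ha : a < 1) :
    Integrable (fun z => exp (a * z ^ 2 / 2)) (gaussianReal 0 1) ∧
    ∫ z, exp (a * z ^ 2 / 2) ∂gaussianReal 0 1 = (√(1 - a))⁻¹ := by
  have hb : 0 < (1 - a) / 2 := by linarith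
  have h1 : ∀ z, gaussianPDFReal 0 1 z * exp (a * z ^ 2 / 2)
      = (√(2 * π))⁻¹ * exp (-((1 - a) / 2) * z ^ 2) := by
    intro z
    rw [gaussianPDFReal, mul_assoc, ← exp_add]
    push_cast
    rw [mul_one]
    congr 2; ring
  constructor
  · rw [integrable_gaussianReal_iff]
    simp_rw [h1]
    exact (integrable_exp_neg_mul_sq hb).const_mul _
  · rw [integral_gaussianReal_eq_integral_smul one_ne_zero]
    simp_rw [smul_eq_mul, h1]
    rw [integral_const_mul, integral_gaussian]
    rw [← sqrt_inv, ← sqrt_mul (by positivity), ← sqrt_inv]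
    congr 1
    have := pi_pos.ne'
    have : (1 - a) ≠ 0 := by linarith
    field_simp

lemma sum_exp_ovlp_le {a : ℝ} (hN : 0 < N) (ha0 : 0 ≤ a) (ha : a < 1) :
    ∑ σ : Config N, ∑ τ : Config N, exp (a * (N * ovlp N σ τ ^ 2) / 2)
      ≤ (Fintype.card (Config N) : ℝ) ^ 2 * (√(1 - a))⁻¹ := by
  have hN' : (0 : ℝ) < N := by exact_mod_cast hN
  set q := √(a / N) with hq
  have hq2 : q ^ 2 = a / N := sq_sqrt (by positivity)
  have h1 : ∀ σ τ : Config N, exp (a * (N * ovlp N σ τ ^ 2) / 2)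
      = ∫ z, exp ((q * ∑ i, spin (σ i) * spin (τ i)) * z) ∂gaussianReal 0 1 := by
    intro σ τ
    have := mgf_id_gaussianReal (μ := 0) (v := 1)
    have h2 := congrFun this (q * ∑ i, spin (σ i) * spin (τ i))
    simp only [mgf, id] at h2
    rw [h2, ovlp, mul_pow, hq2]
    congr 1
    push_cast
    field_simp
    ring
  have hi : ∀ σ τ : Config N, Integrable
      (fun z => exp ((q * ∑ i, spin (σ i) * spin (τ i)) * z)) (gaussianReal 0 1) :=
    fun σ τ => integrable_exp_mul_gaussianReal _
  simp_rw [h1]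
  have h2 : ∀ (σ : Config N) (z : ℝ),
      ∑ τ : Config N, exp ((q * ∑ i, spin (σ i) * spin (τ i)) * z) ≤ 2 ^ N * exp (a * z ^ 2 / 2) := by
    intro σ z
    have h3 : ∀ τ : Config N, exp ((q * ∑ i, spin (σ i) * spin (τ i)) * z)
        = ∏ i, exp (q * z * spin (σ i) * spin (τ i)) := by
      intro τ
      rw [← exp_sum, Finset.mul_sum, Finset.sum_mul]
      congr 1
      exact Finset.sum_congr rfl fun i _ => by ring
    simp_rw [h3]
    have h4 := Finset.prod_univ_sum (fun _ : Fin N => (Finset.univ : Finset Bool))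
      (fun i b => exp (q * z * spin (σ i) * spin b))
    rw [Fintype.piFinset_univ] at h4
    rw [← h4]
    calc ∏ i, ∑ b, exp (q * z * spin (σ i) * spin b)
        ≤ ∏ _i : Fin N, (2 * exp ((q * z) ^ 2 / 2)) := by
          refine Finset.prod_le_prod (fun i _ => by positivity) fun i _ => ?_
          have h5 := cosh_le_exp_half_sq (q * z * spin (σ i))
          rw [cosh_eq] at h5
          have h6 : (q * z * spin (σ i)) ^ 2 = (q * z) ^ 2 := by
            rw [mul_pow, sq (spin _), spin_mul_self, mul_one]
          rw [h6] at h5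
          simp only [Fintype.sum_bool, spin, if_true, mul_one] at h5 ⊢
          simp only [Bool.false_eq_true, if_false, mul_neg, mul_one]
          linarith
      _ = 2 ^ N * exp (a * z ^ 2 / 2) := by
          rw [Finset.prod_const, Finset.card_univ, Fintype.card_fin, mul_pow, ← exp_nat_mul]
          congr 2
          rw [mul_pow, hq2]; field_simp
  obtain ⟨hi2, hi3⟩ := integral_exp_sq_gaussianReal ha
  calc ∑ σ : Config N, ∑ τ : Config N,
        ∫ z, exp ((q * ∑ i, spin (σ i) * spin (τ i)) * z) ∂gaussianReal 0 1
      = ∑ σ : Config N,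
        ∫ z, ∑ τ : Config N, exp ((q * ∑ i, spin (σ i) * spin (τ i)) * z) ∂gaussianReal 0 1 :=
        Finset.sum_congr rfl fun σ _ => (integral_finsetSum _ fun τ _ => hi σ τ).symm
    _ ≤ ∑ σ : Config N, ∫ z, 2 ^ N * exp (a * z ^ 2 / 2) ∂gaussianReal 0 1 :=
        Finset.sum_le_sum fun σ _ => integral_mono (integrable_finsetSum _ fun τ _ => hi σ τ)
          (hi2.const_mul _) (h2 σ)
    _ = _ := by
        rw [integral_const_mul, hi3]
        simp
        ring

/-- The expected two-replica Gibbs average of the indicator of large overlaps is small. -/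
theorem integral_ovlp_tail {δ : ℝ} (hN : 0 < N) (hδ : δ = 1 - β ^ 2) (hδ0 : 0 < δ) (hδ1 : δ ≤ 1)
    {κ : ℝ} (hκ : 0 ≤ κ) (x y : ℝ) :
    ∫ ω, (∑ σ, ∑ τ, wt (hv N β) ω σ * wt (hv N β) ω τ *
        (if x ^ 2 < ovlp N σ τ ^ 2 then 1 else 0)) ∂stdG (Fin N × Fin N)
      ≤ 8 * (√(δ / 2))⁻¹ * exp (κ ^ 2 * (2 / δ * log (512 / δ)) - κ * y)
        + 4 * (√(δ / 2))⁻¹ * exp (2 * y - δ * N * x ^ 2 / 4) := by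
  have hN' : (0 : ℝ) < N := by exact_mod_cast hN
  have hK : 1 ≤ (√(δ / 2))⁻¹ := by
    rw [one_le_inv₀ (sqrt_pos.2 (by positivity)), sqrt_le_one]
    linarith
  have h := integral_gibbs_le (hv N β) (v := β ^ 2 / 2 * (N - 1)) (K := (√(δ / 2))⁻¹)
    (γ := 2 / δ) (Θ := fun σ τ => exp (δ * (N * ovlp N σ τ ^ 2) / 4))
    (hv_dot_self N β hN) (sum_hv N β) (fun σ τ => one_le_exp (by positivity)) hK (by
      have h1 := sum_exp_ovlp_le N (a := 1 - δ / 2) hN (by linarith) (by linarith)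
      rw [sub_sub_cancel] at h1
      refine le_trans ?_ h1
      refine Finset.sum_le_sum fun σ _ => Finset.sum_le_sum fun τ _ => ?_
      rw [← exp_add, exp_le_exp, hv_dot N β hN, show β ^ 2 = 1 - δ by linarith]
      nlinarith) (by positivity) (by
      intro σ τ
      rw [log_exp, hv_dot N β hN, show β ^ 2 = 1 - δ by linarith]
      have e1 : 2 / δ * (δ * (N * ovlp N σ τ ^ 2) / 4) = N * ovlp N σ τ ^ 2 / 2 := by
        field_simp; ring
      have : 0 ≤ δ * (N * ovlp N σ τ ^ 2) := by positivity
      rw [e1]; nlinarith) hκ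
    (f := fun σ τ => if x ^ 2 < ovlp N σ τ ^ 2 then 1 else 0) (z := δ * N * x ^ 2 / 4)
    (fun σ τ => by split_ifs <;> norm_num) (fun σ τ => by
      split_ifs with h1
      · rw [← exp_add]
        refine one_le_exp ?_
        have : δ * N * x ^ 2 ≤ δ * N * ovlp N σ τ ^ 2 := by gcongr
        linarith
      · positivity) y
  have e2 : 256 * ((√(δ / 2))⁻¹) ^ 2 = 512 / δ := by
    rw [inv_pow, sq_sqrt (by positivity)]
    field_simp; norm_num
  rw [e2] at h
  exact h

end SKModel

/-! ### Functions of exponential growth -/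

section ExpGrowth

variable {κ : Type*} [Fintype κ]

/-- Continuous functions of at most exponential growth. -/
def ExpGr (f : (κ → ℝ) → ℝ) : Prop :=
  Continuous f ∧ ∃ C : ℝ, 0 ≤ C ∧ ∀ ω, |f ω| ≤ exp (C * growth ω)

lemma ExpGr.integrable {f : (κ → ℝ) → ℝ} (hf : ExpGr f) : Integrable f (stdG κ) := by
  obtain ⟨hc, C, hC, h⟩ := hf
  have h1 : Integrable (fun ω : κ → ℝ => exp (C * growth ω)) (stdG κ) := by
    have h2 : ∀ ω : κ → ℝ, exp (C * growth ω) = exp C * ∏ i, exp (C * |ω i|) := by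
      intro ω
      rw [growth, mul_add, mul_one, exp_add, Finset.mul_sum, exp_sum]
    simp_rw [h2]
    refine Integrable.const_mul ?_ _
    exact Integrable.fintype_prod (f := fun _ y => exp (C * |y|)) fun i =>
      integrable_exp_mul_abs (integrable_exp_mul_gaussianReal C)
        (integrable_exp_mul_gaussianReal (-C))
  exact h1.mono' hc.aestronglyMeasurable (ae_of_all _ h)

lemma ExpGr.const (c : ℝ) : ExpGr fun _ : κ → ℝ => c := by
  refine ⟨continuous_const, |c|, abs_nonneg c, fun ω => ?_⟩
  have h1 := one_le_growth ω
  have h2 := add_one_le_exp (|c| * growth ω)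
  nlinarith [abs_nonneg c]

lemma ExpGr.mul {f g : (κ → ℝ) → ℝ} (hf : ExpGr f) (hg : ExpGr g) :
    ExpGr fun ω => f ω * g ω := by
  obtain ⟨hf, C, hC, h⟩ := hf
  obtain ⟨hg, C', hC', h'⟩ := hg
  refine ⟨hf.mul hg, C + C', by positivity, fun ω => ?_⟩
  rw [abs_mul, add_mul, exp_add]
  exact mul_le_mul (h ω) (h' ω) (abs_nonneg _) (exp_pos _).le

lemma ExpGr.add {f g : (κ → ℝ) → ℝ} (hf : ExpGr f) (hg : ExpGr g) :
    ExpGr fun ω => f ω + g ω := by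
  obtain ⟨hf, C, hC, h⟩ := hf
  obtain ⟨hg, C', hC', h'⟩ := hg
  refine ⟨hf.add hg, 1 + C + C', by positivity, fun ω => ?_⟩
  have hg1 := one_le_growth ω
  have e1 : exp (C * growth ω) ≤ exp ((C + C') * growth ω) := exp_le_exp.2 (by nlinarith)
  have e2 : exp (C' * growth ω) ≤ exp ((C + C') * growth ω) := exp_le_exp.2 (by nlinarith)
  have e3 : 2 ≤ exp (growth ω) := by
    have := add_one_le_exp (growth ω); linarith
  have e4 : exp ((1 + C + C') * growth ω) = exp (growth ω) * exp ((C + C') * growth ω) := by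
    rw [← exp_add]; ring_nf
  have e5 : (0:ℝ) < exp ((C + C') * growth ω) := exp_pos _
  calc |f ω + g ω| ≤ |f ω| + |g ω| := abs_add_le _ _
    _ ≤ 2 * exp ((C + C') * growth ω) := by linarith [h ω, h' ω]
    _ ≤ _ := by rw [e4]; gcongr

lemma ExpGr.sub {f g : (κ → ℝ) → ℝ} (hf : ExpGr f) (hg : ExpGr g) :
    ExpGr fun ω => f ω - g ω := by
  have := hf.add ((ExpGr.const (-1)).mul hg)
  simpa [sub_eq_add_neg] using this

lemma ExpGr.pow {f : (κ → ℝ) → ℝ} (hf : ExpGr f) (n : ℕ) : ExpGr fun ω => f ω ^ n := by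
  induction n with
  | zero => simpa using ExpGr.const 1
  | succ n ih => simpa [pow_succ] using ih.mul hf

lemma ExpGr.abs {f : (κ → ℝ) → ℝ} (hf : ExpGr f) : ExpGr fun ω => |f ω| := by
  obtain ⟨hf, C, hC, h⟩ := hf
  exact ⟨hf.abs, C, hC, fun ω => by rw [abs_abs]; exact h ω⟩

lemma ExpGr.sum {α : Type*} (s : Finset α) {f : α → (κ → ℝ) → ℝ} (hf : ∀ a, ExpGr (f a)) :
    ExpGr fun ω => ∑ a ∈ s, f a ω := by
  classical
  induction s using Finset.induction with
  | empty => simpa using ExpGr.const 0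
  | insert a s ha ih =>
    simp_rw [Finset.sum_insert ha]
    exact (hf a).add ih

lemma ExpGr.inv {f : (κ → ℝ) → ℝ} (hf : ExpGr f) {c : ℝ} (hc : 0 < c) (h : ∀ ω, c ≤ f ω) :
    ExpGr fun ω => (f ω)⁻¹ := by
  have hpos : ∀ ω, 0 < f ω := fun ω => hc.trans_le (h ω)
  refine ⟨hf.1.inv₀ fun ω => (hpos ω).ne', c⁻¹, by positivity, fun ω => ?_⟩
  rw [abs_of_pos (inv_pos.2 (hpos ω))]
  have h1 : (f ω)⁻¹ ≤ c⁻¹ := inv_anti₀ hc (h ω)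
  have h2 := add_one_le_exp (c⁻¹ * growth ω)
  have h3 := one_le_growth ω
  have h4 : 0 < c⁻¹ := inv_pos.2 hc
  nlinarith

lemma ExpGr.exp_dot (u : κ → ℝ) : ExpGr fun ω => exp (u ⬝ᵥ ω) := by
  refine ⟨by fun_prop, ∑ i, |u i|, by positivity, fun ω => ?_⟩
  rw [abs_of_pos (exp_pos _), exp_le_exp]
  exact (le_abs_self _).trans (abs_dot_le (fun i =>
    Finset.single_le_sum (f := fun i => |u i|) (fun i _ => abs_nonneg _) (Finset.mem_univ i))
    (by positivity))

end ExpGrowth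

/-! ### Moments of normalised hyperbolic functions of a Gaussian vector -/

section Hyperbolic

variable {κ : Type*} [Fintype κ]

/-- Signed average of the normalised exponentials of `± u ⬝ᵥ ω`. -/
def sgnExp (w : Bool → ℝ) (u ω : κ → ℝ) : ℝ :=
  1 / 2 * ∑ b, w b * exp ((spin b • u) ⬝ᵥ ω - u ⬝ᵥ u / 2)

/-- Normalised hyperbolic cosine. -/
def Ch (u ω : κ → ℝ) : ℝ := sgnExp (fun _ => 1) u ω

/-- Normalised hyperbolic sine. -/
def Sh (u ω : κ → ℝ) : ℝ := sgnExp spin u ω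

lemma Ch_eq (u ω : κ → ℝ) : Ch u ω = exp (-(u ⬝ᵥ u / 2)) * cosh (u ⬝ᵥ ω) := by
  simp only [Ch, sgnExp, Fintype.sum_bool, spin, if_true, Bool.false_eq_true, if_false, one_smul,
    neg_smul, neg_dotProduct, cosh_eq, sub_eq_add_neg, exp_add]
  ring

lemma Sh_eq (u ω : κ → ℝ) : Sh u ω = exp (-(u ⬝ᵥ u / 2)) * sinh (u ⬝ᵥ ω) := by
  simp only [Sh, sgnExp, Fintype.sum_bool, spin, if_true, Bool.false_eq_true, if_false, one_smul,
    neg_smul, neg_dotProduct, sinh_eq, sub_eq_add_neg, exp_add]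
  ring

lemma Ch_zero (ω : κ → ℝ) : Ch 0 ω = 1 := by rw [Ch_eq]; simp

lemma Ch_pos (u ω : κ → ℝ) : 0 < Ch u ω := by
  rw [Ch_eq]; have := cosh_pos (u ⬝ᵥ ω); positivity

lemma half_le_Ch {u : κ → ℝ} (hu : u ⬝ᵥ u ≤ 1) (ω : κ → ℝ) : 1 / 2 ≤ Ch u ω := by
  rw [Ch_eq]
  have h1 := one_le_cosh (u ⬝ᵥ ω)
  have h2 := add_one_le_exp (-(u ⬝ᵥ u / 2))
  nlinarith

lemma expGr_sgnExp (w : Bool → ℝ) (u : κ → ℝ) : ExpGr (sgnExp w u) := by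
  unfold sgnExp
  refine (ExpGr.const _).mul (ExpGr.sum _ fun b => (ExpGr.const _).mul ?_)
  simp_rw [sub_eq_add_neg, exp_add]
  exact (ExpGr.exp_dot _).mul (ExpGr.const _)

lemma expGr_Ch (u : κ → ℝ) : ExpGr (Ch u) := expGr_sgnExp _ u
lemma expGr_Sh (u : κ → ℝ) : ExpGr (Sh u) := expGr_sgnExp _ u

/-- Signed average of `φ` at the energies of four Ising spins with given couplings. -/
def quadAvg (φ : ℝ → ℝ) (w₁ w₂ w₃ w₄ : Bool → ℝ) (k₁₂ k₁₃ k₁₄ k₂₃ k₂₄ k₃₄ : ℝ) : ℝ :=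
  1 / 16 * ∑ a, ∑ b, ∑ c, ∑ d, w₁ a * w₂ b * w₃ c * w₄ d *
    φ (spin a * spin b * k₁₂ + spin a * spin c * k₁₃ + spin a * spin d * k₁₄ +
      spin b * spin c * k₂₃ + spin b * spin d * k₂₄ + spin c * spin d * k₃₄)

lemma integral_sgnExp_mul₄ (w₁ w₂ w₃ w₄ : Bool → ℝ) (u₁ u₂ u₃ u₄ : κ → ℝ) :
    ∫ ω, sgnExp w₁ u₁ ω * sgnExp w₂ u₂ ω * sgnExp w₃ u₃ ω * sgnExp w₄ u₄ ω ∂stdG κ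
      = quadAvg exp w₁ w₂ w₃ w₄ (u₁ ⬝ᵥ u₂) (u₁ ⬝ᵥ u₃) (u₁ ⬝ᵥ u₄) (u₂ ⬝ᵥ u₃) (u₂ ⬝ᵥ u₄)
        (u₃ ⬝ᵥ u₄) := by
  have h1 : ∀ ω, sgnExp w₁ u₁ ω * sgnExp w₂ u₂ ω * sgnExp w₃ u₃ ω * sgnExp w₄ u₄ ω
      = 1 / 16 * ∑ a, ∑ b, ∑ c, ∑ d, w₁ a * w₂ b * w₃ c * w₄ d *
        (exp (-(u₁ ⬝ᵥ u₁ + u₂ ⬝ᵥ u₂ + u₃ ⬝ᵥ u₃ + u₄ ⬝ᵥ u₄) / 2) *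
          exp ((spin a • u₁ + spin b • u₂ + spin c • u₃ + spin d • u₄) ⬝ᵥ ω)) := by
    intro ω
    have h2 : ∀ a b c d, exp (-(u₁ ⬝ᵥ u₁ + u₂ ⬝ᵥ u₂ + u₃ ⬝ᵥ u₃ + u₄ ⬝ᵥ u₄) / 2) *
          exp ((spin a • u₁ + spin b • u₂ + spin c • u₃ + spin d • u₄) ⬝ᵥ ω)
        = exp ((spin a • u₁) ⬝ᵥ ω - u₁ ⬝ᵥ u₁ / 2) * exp ((spin b • u₂) ⬝ᵥ ω - u₂ ⬝ᵥ u₂ / 2) *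
          exp ((spin c • u₃) ⬝ᵥ ω - u₃ ⬝ᵥ u₃ / 2) * exp ((spin d • u₄) ⬝ᵥ ω - u₄ ⬝ᵥ u₄ / 2) := by
      intro a b c d
      simp only [← exp_add, add_dotProduct]
      congr 1; ring
    simp_rw [h2]
    unfold sgnExp
    simp only [Fintype.sum_bool]
    ring
  simp_rw [h1]
  have hi : ∀ a b c d, Integrable (fun ω => w₁ a * w₂ b * w₃ c * w₄ d *
        (exp (-(u₁ ⬝ᵥ u₁ + u₂ ⬝ᵥ u₂ + u₃ ⬝ᵥ u₃ + u₄ ⬝ᵥ u₄) / 2) *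
          exp ((spin a • u₁ + spin b • u₂ + spin c • u₃ + spin d • u₄) ⬝ᵥ ω))) (stdG κ) :=
    fun a b c d => ((integrable_exp_dot _).const_mul _).const_mul _
  rw [integral_const_mul, quadAvg]
  congr 1
  rw [integral_finsetSum _ fun a _ => integrable_finsetSum _ fun b _ =>
    integrable_finsetSum _ fun c _ => integrable_finsetSum _ fun d _ => hi a b c d]
  refine Finset.sum_congr rfl fun a _ => ?_
  rw [integral_finsetSum _ fun b _ =>
    integrable_finsetSum _ fun c _ => integrable_finsetSum _ fun d _ => hi a b c d]
  refine Finset.sum_congr rfl fun b _ => ?_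
  rw [integral_finsetSum _ fun c _ => integrable_finsetSum _ fun d _ => hi a b c d]
  refine Finset.sum_congr rfl fun c _ => ?_
  rw [integral_finsetSum _ fun d _ => hi a b c d]
  refine Finset.sum_congr rfl fun d _ => ?_
  rw [integral_const_mul, integral_const_mul, integral_exp_dot, ← exp_add]
  congr 2
  simp only [add_dotProduct, dotProduct_add, smul_dotProduct, dotProduct_smul, smul_eq_mul,
    dotProduct_comm u₂ u₁, dotProduct_comm u₃ u₁, dotProduct_comm u₄ u₁, dotProduct_comm u₃ u₂,
    dotProduct_comm u₄ u₂, dotProduct_comm u₄ u₃]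
  have ha := spin_mul_self a
  have hb := spin_mul_self b
  have hc := spin_mul_self c
  have hd := spin_mul_self d
  linear_combination (u₁ ⬝ᵥ u₁ / 2) * ha + (u₂ ⬝ᵥ u₂ / 2) * hb + (u₃ ⬝ᵥ u₃ / 2) * hc +
    (u₄ ⬝ᵥ u₄ / 2) * hd

lemma abs_exp_sub_sum_le (x : ℝ) (n : ℕ) :
    |exp x - ∑ m ∈ range n, x ^ m / m.factorial| ≤ |x| ^ n * exp |x| := by
  have h := Complex.norm_exp_sub_sum_le_norm_mul_exp (x : ℂ) n
  have e : Complex.exp (x : ℂ) - ∑ m ∈ range n, (x : ℂ) ^ m / m.factorial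
      = ((exp x - ∑ m ∈ range n, x ^ m / m.factorial : ℝ) : ℂ) := by push_cast; rfl
  rw [e, Complex.norm_real, Complex.norm_real] at h
  simpa using h

lemma pow_sum_six_le {a b c d e f : ℝ} (ha : 0 ≤ a) (hb : 0 ≤ b) (hc : 0 ≤ c) (hd : 0 ≤ d)
    (he : 0 ≤ e) (hf : 0 ≤ f) (n : ℕ) :
    (a + b + c + d + e + f) ^ n ≤ 6 ^ n * (a ^ n + b ^ n + c ^ n + d ^ n + e ^ n + f ^ n) := by
  set m := max (max (max a b) (max c d)) (max e f) with hm
  have h1 : a ≤ m := by simp [hm]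
  have h2 : b ≤ m := by simp [hm]
  have h3 : c ≤ m := by simp [hm]
  have h4 : d ≤ m := by simp [hm]
  have h5 : e ≤ m := by simp [hm]
  have h6 : f ≤ m := by simp [hm]
  have h7 : m ^ n ≤ a ^ n + b ^ n + c ^ n + d ^ n + e ^ n + f ^ n := by
    have pa := pow_nonneg ha n
    have pb := pow_nonneg hb n
    have pc := pow_nonneg hc n
    have pd := pow_nonneg hd n
    have pe := pow_nonneg he n
    have pf := pow_nonneg hf n
    have : m = a ∨ m = b ∨ m = c ∨ m = d ∨ m = e ∨ m = f := by
      rw [hm]; grind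
    rcases this with h | h | h | h | h | h <;> rw [h] <;> linarith
  calc _ ≤ (6 * m) ^ n := by gcongr; linarith
    _ = 6 ^ n * m ^ n := mul_pow _ _ _
    _ ≤ _ := by gcongr

/-- Taylor approximation of the exponential inside a signed average. -/
lemma quadAvg_exp_sub_le {w₁ w₂ w₃ w₄ : Bool → ℝ} (h₁ : ∀ b, |w₁ b| ≤ 1) (h₂ : ∀ b, |w₂ b| ≤ 1)
    (h₃ : ∀ b, |w₃ b| ≤ 1) (h₄ : ∀ b, |w₄ b| ≤ 1) {k₁₂ k₁₃ k₁₄ k₂₃ k₂₄ k₃₄ : ℝ}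
    (hk₁₂ : |k₁₂| ≤ 1) (hk₁₃ : |k₁₃| ≤ 1) (hk₁₄ : |k₁₄| ≤ 1) (hk₂₃ : |k₂₃| ≤ 1)
    (hk₂₄ : |k₂₄| ≤ 1) (hk₃₄ : |k₃₄| ≤ 1) (n : ℕ) :
    |quadAvg exp w₁ w₂ w₃ w₄ k₁₂ k₁₃ k₁₄ k₂₃ k₂₄ k₃₄ -
      quadAvg (fun x => ∑ m ∈ range n, x ^ m / m.factorial) w₁ w₂ w₃ w₄ k₁₂ k₁₃ k₁₄ k₂₃ k₂₄ k₃₄|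
      ≤ 6 ^ n * exp 6 *
        (|k₁₂| ^ n + |k₁₃| ^ n + |k₁₄| ^ n + |k₂₃| ^ n + |k₂₄| ^ n + |k₃₄| ^ n) := by
  set B := 6 ^ n * exp 6 *
        (|k₁₂| ^ n + |k₁₃| ^ n + |k₁₄| ^ n + |k₂₃| ^ n + |k₂₄| ^ n + |k₃₄| ^ n) with hB
  have hB0 : 0 ≤ B := by positivity
  have term : ∀ a b c d, |w₁ a * w₂ b * w₃ c * w₄ d *
      exp (spin a * spin b * k₁₂ + spin a * spin c * k₁₃ + spin a * spin d * k₁₄ +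
        spin b * spin c * k₂₃ + spin b * spin d * k₂₄ + spin c * spin d * k₃₄) -
      w₁ a * w₂ b * w₃ c * w₄ d * ∑ m ∈ range n,
        (spin a * spin b * k₁₂ + spin a * spin c * k₁₃ + spin a * spin d * k₁₄ +
        spin b * spin c * k₂₃ + spin b * spin d * k₂₄ + spin c * spin d * k₃₄) ^ m / m.factorial|
      ≤ B := by
    intro a b c d
    set x := spin a * spin b * k₁₂ + spin a * spin c * k₁₃ + spin a * spin d * k₁₄ +
        spin b * spin c * k₂₃ + spin b * spin d * k₂₄ + spin c * spin d * k₃₄ with hx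
    have hx1 : |x| ≤ |k₁₂| + |k₁₃| + |k₁₄| + |k₂₃| + |k₂₄| + |k₃₄| := by
      have e : ∀ (a b : Bool) (k : ℝ), |spin a * spin b * k| = |k| := fun a b k => by
        rw [abs_mul, abs_mul, abs_spin, abs_spin, one_mul, one_mul]
      rw [hx]
      refine (abs_add_le _ _).trans (add_le_add ?_ (e c d _).le)
      refine (abs_add_le _ _).trans (add_le_add ?_ (e b d _).le)
      refine (abs_add_le _ _).trans (add_le_add ?_ (e b c _).le)
      refine (abs_add_le _ _).trans (add_le_add ?_ (e a d _).le)
      refine (abs_add_le _ _).trans (add_le_add ?_ (e a c _).le)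
      exact (e a b _).le
    have hw : |w₁ a * w₂ b * w₃ c * w₄ d| ≤ 1 := by
      rw [abs_mul, abs_mul, abs_mul]
      exact mul_le_one₀ (mul_le_one₀ (mul_le_one₀ (h₁ a) (abs_nonneg _) (h₂ b)) (abs_nonneg _)
        (h₃ c)) (abs_nonneg _) (h₄ d)
    rw [← mul_sub, abs_mul]
    calc _ ≤ 1 * (|x| ^ n * exp |x|) :=
          mul_le_mul hw (abs_exp_sub_sum_le x n) (abs_nonneg _) zero_le_one
      _ ≤ 1 * ((|k₁₂| + |k₁₃| + |k₁₄| + |k₂₃| + |k₂₄| + |k₃₄|) ^ n * exp 6) := by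
          gcongr; linarith
      _ ≤ 1 * ((6 ^ n * (|k₁₂| ^ n + |k₁₃| ^ n + |k₁₄| ^ n + |k₂₃| ^ n + |k₂₄| ^ n + |k₃₄| ^ n)) *
            exp 6) := by
          gcongr
          exact pow_sum_six_le (abs_nonneg _) (abs_nonneg _) (abs_nonneg _) (abs_nonneg _)
            (abs_nonneg _) (abs_nonneg _) n
      _ = B := by rw [hB]; ring
  rw [quadAvg, quadAvg, ← mul_sub, abs_mul, abs_of_pos (by norm_num : (0:ℝ) < 1 / 16)]
  have hs : ∀ (F G : Bool → ℝ) (c : ℝ), (∀ b, |F b - G b| ≤ c) →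
      |∑ b, F b - ∑ b, G b| ≤ 2 * c := by
    intro F G c h
    rw [← Finset.sum_sub_distrib]
    calc _ ≤ ∑ b, |F b - G b| := Finset.abs_sum_le_sum_abs _ _
      _ ≤ ∑ _b : Bool, c := Finset.sum_le_sum fun b _ => h b
      _ = 2 * c := by simp
  have h := hs _ _ _ fun a => hs _ _ _ fun b => hs _ _ _ fun c => hs _ _ _ fun d => term a b c d
  linarith

end Hyperbolic

/-! ### Moment bounds in terms of the largest coupling -/

section MomentBounds

variable {κ : Type*} [Fintype κ]

/-- A numerical constant dominating all Taylor remainders below. -/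
def tayC : ℝ := 6 ^ 5 * exp 6

lemma tayC_pos : 0 < tayC := by unfold tayC; positivity

lemma abs_integral_sgnExp_sub_le {w₁ w₂ w₃ w₄ : Bool → ℝ} (h₁ : ∀ b, |w₁ b| ≤ 1)
    (h₂ : ∀ b, |w₂ b| ≤ 1) (h₃ : ∀ b, |w₃ b| ≤ 1) (h₄ : ∀ b, |w₄ b| ≤ 1)
    {u₁ u₂ u₃ u₄ : κ → ℝ} {M : ℝ} (hM : M ≤ 1) (h₁₂ : |u₁ ⬝ᵥ u₂| ≤ M) (h₁₃ : |u₁ ⬝ᵥ u₃| ≤ M)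
    (h₁₄ : |u₁ ⬝ᵥ u₄| ≤ M) (h₂₃ : |u₂ ⬝ᵥ u₃| ≤ M) (h₂₄ : |u₂ ⬝ᵥ u₄| ≤ M)
    (h₃₄ : |u₃ ⬝ᵥ u₄| ≤ M) {n : ℕ} (hn : n ≤ 4) :
    |∫ ω, sgnExp w₁ u₁ ω * sgnExp w₂ u₂ ω * sgnExp w₃ u₃ ω * sgnExp w₄ u₄ ω ∂stdG κ -
      quadAvg (fun x => ∑ m ∈ range n, x ^ m / m.factorial) w₁ w₂ w₃ w₄ (u₁ ⬝ᵥ u₂) (u₁ ⬝ᵥ u₃)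
        (u₁ ⬝ᵥ u₄) (u₂ ⬝ᵥ u₃) (u₂ ⬝ᵥ u₄) (u₃ ⬝ᵥ u₄)| ≤ tayC * M ^ n := by
  rw [integral_sgnExp_mul₄]
  refine (quadAvg_exp_sub_le h₁ h₂ h₃ h₄ (h₁₂.trans hM) (h₁₃.trans hM) (h₁₄.trans hM)
    (h₂₃.trans hM) (h₂₄.trans hM) (h₃₄.trans hM) n).trans ?_
  have hM0 : 0 ≤ M := (abs_nonneg _).trans h₁₂
  have e6 : (6:ℝ) ^ n ≤ 6 ^ 4 := pow_le_pow_right₀ (by norm_num) hn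
  calc _ ≤ 6 ^ 4 * exp 6 * (M ^ n + M ^ n + M ^ n + M ^ n + M ^ n + M ^ n) := by
        gcongr
    _ = _ := by rw [tayC]; ring

lemma abs_one_le (b : Bool) : |(fun _ : Bool => (1:ℝ)) b| ≤ 1 := by simp

lemma abs_spin_le (b : Bool) : |spin b| ≤ 1 := (abs_spin b).le

lemma abs_integral_Ch_mul₄_sub_one_le {u₁ u₂ u₃ u₄ : κ → ℝ} {M : ℝ} (hM : M ≤ 1)
    (h₁₂ : |u₁ ⬝ᵥ u₂| ≤ M) (h₁₃ : |u₁ ⬝ᵥ u₃| ≤ M)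
    (h₁₄ : |u₁ ⬝ᵥ u₄| ≤ M) (h₂₃ : |u₂ ⬝ᵥ u₃| ≤ M) (h₂₄ : |u₂ ⬝ᵥ u₄| ≤ M)
    (h₃₄ : |u₃ ⬝ᵥ u₄| ≤ M) :
    |∫ ω, Ch u₁ ω * Ch u₂ ω * Ch u₃ ω * Ch u₄ ω ∂stdG κ - 1| ≤ tayC * M ^ 2 := by
  have h := abs_integral_sgnExp_sub_le abs_one_le abs_one_le abs_one_le abs_one_le hM h₁₂ h₁₃ h₁₄
    h₂₃ h₂₄ h₃₄ (n := 2) (by norm_num)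
  refine le_of_eq_of_le (congrArg _ (congrArg _ ?_)) h
  simp only [quadAvg, Fintype.sum_bool, spin, Finset.sum_range_succ, Finset.sum_range_zero,
    if_true, Bool.false_eq_true, if_false, Nat.factorial]
  push_cast
  ring

lemma abs_integral_Ch_mul₄_fourth_le {u₁ u₂ u₃ u₄ : κ → ℝ} {M : ℝ} (hM : M ≤ 1)
    (h₁₂ : |u₁ ⬝ᵥ u₂| ≤ M) (h₁₃ : |u₁ ⬝ᵥ u₃| ≤ M)
    (h₁₄ : |u₁ ⬝ᵥ u₄| ≤ M) (h₂₃ : |u₂ ⬝ᵥ u₃| ≤ M) (h₂₄ : |u₂ ⬝ᵥ u₄| ≤ M)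
    (h₃₄ : |u₃ ⬝ᵥ u₄| ≤ M) :
    |∫ ω, Ch u₁ ω * Ch u₂ ω * Ch u₃ ω * Ch u₄ ω ∂stdG κ -
      (1 + 1 / 2 * ((u₁ ⬝ᵥ u₂) ^ 2 + (u₁ ⬝ᵥ u₃) ^ 2 + (u₁ ⬝ᵥ u₄) ^ 2 + (u₂ ⬝ᵥ u₃) ^ 2 +
        (u₂ ⬝ᵥ u₄) ^ 2 + (u₃ ⬝ᵥ u₄) ^ 2) +
        ((u₁ ⬝ᵥ u₂) * (u₁ ⬝ᵥ u₃) * (u₂ ⬝ᵥ u₃) + (u₁ ⬝ᵥ u₂) * (u₁ ⬝ᵥ u₄) * (u₂ ⬝ᵥ u₄) +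
          (u₁ ⬝ᵥ u₃) * (u₁ ⬝ᵥ u₄) * (u₃ ⬝ᵥ u₄) + (u₂ ⬝ᵥ u₃) * (u₂ ⬝ᵥ u₄) * (u₃ ⬝ᵥ u₄)))|
      ≤ tayC * M ^ 4 := by
  have h := abs_integral_sgnExp_sub_le abs_one_le abs_one_le abs_one_le abs_one_le hM h₁₂ h₁₃ h₁₄
    h₂₃ h₂₄ h₃₄ (n := 4) (by norm_num)
  refine le_of_eq_of_le (congrArg _ (congrArg _ ?_)) h
  simp only [quadAvg, Fintype.sum_bool, spin, Finset.sum_range_succ, Finset.sum_range_zero,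
    if_true, Bool.false_eq_true, if_false, Nat.factorial]
  push_cast
  ring

lemma abs_integral_Sh_mul₄_le {u₁ u₂ u₃ u₄ : κ → ℝ} {M : ℝ} (hM : M ≤ 1)
    (h₁₂ : |u₁ ⬝ᵥ u₂| ≤ M) (h₁₃ : |u₁ ⬝ᵥ u₃| ≤ M)
    (h₁₄ : |u₁ ⬝ᵥ u₄| ≤ M) (h₂₃ : |u₂ ⬝ᵥ u₃| ≤ M) (h₂₄ : |u₂ ⬝ᵥ u₄| ≤ M)
    (h₃₄ : |u₃ ⬝ᵥ u₄| ≤ M) :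
    |∫ ω, Sh u₁ ω * Sh u₂ ω * Sh u₃ ω * Sh u₄ ω ∂stdG κ| ≤ tayC * M ^ 2 := by
  have h := abs_integral_sgnExp_sub_le abs_spin_le abs_spin_le abs_spin_le abs_spin_le hM h₁₂ h₁₃
    h₁₄ h₂₃ h₂₄ h₃₄ (n := 2) (by norm_num)
  rw [← sub_zero (∫ ω, Sh u₁ ω * Sh u₂ ω * Sh u₃ ω * Sh u₄ ω ∂stdG κ)]
  refine le_of_eq_of_le (congrArg _ (congrArg _ ?_)) h
  simp only [quadAvg, Fintype.sum_bool, spin, Finset.sum_range_succ, Finset.sum_range_zero,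
    if_true, Bool.false_eq_true, if_false, Nat.factorial]
  push_cast
  ring

lemma abs_integral_Sh_Sh_Ch_Ch_sub_le {u₁ u₂ u₃ u₄ : κ → ℝ} {M : ℝ} (hM : M ≤ 1)
    (h₁₂ : |u₁ ⬝ᵥ u₂| ≤ M) (h₁₃ : |u₁ ⬝ᵥ u₃| ≤ M)
    (h₁₄ : |u₁ ⬝ᵥ u₄| ≤ M) (h₂₃ : |u₂ ⬝ᵥ u₃| ≤ M) (h₂₄ : |u₂ ⬝ᵥ u₄| ≤ M)
    (h₃₄ : |u₃ ⬝ᵥ u₄| ≤ M) :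
    |∫ ω, Sh u₁ ω * Sh u₂ ω * Ch u₃ ω * Ch u₄ ω ∂stdG κ -
      (u₁ ⬝ᵥ u₂ + (u₁ ⬝ᵥ u₃) * (u₂ ⬝ᵥ u₃) + (u₁ ⬝ᵥ u₄) * (u₂ ⬝ᵥ u₄))| ≤ tayC * M ^ 3 := by
  have h := abs_integral_sgnExp_sub_le abs_spin_le abs_spin_le abs_one_le abs_one_le hM h₁₂ h₁₃
    h₁₄ h₂₃ h₂₄ h₃₄ (n := 3) (by norm_num)
  refine le_of_eq_of_le (congrArg _ (congrArg _ ?_)) h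
  simp only [quadAvg, Fintype.sum_bool, spin, Finset.sum_range_succ, Finset.sum_range_zero,
    if_true, Bool.false_eq_true, if_false, Nat.factorial]
  push_cast
  ring

/-- The pairwise scalar products of `u` are at most `M` in absolute value. -/
def Coupled (u : Fin 4 → κ → ℝ) (M : ℝ) : Prop := ∀ p q, p ≠ q → |u p ⬝ᵥ u q| ≤ M

variable {u : Fin 4 → κ → ℝ} {M : ℝ}

lemma Coupled.nonneg (h : Coupled u M) : 0 ≤ M :=
  (abs_nonneg _).trans (h 0 1 (by decide))

lemma integral_Sh_Sh (h : Coupled u M) (hM : M ≤ 1) :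
    |∫ ω, Sh (u 0) ω * Sh (u 1) ω ∂stdG κ - u 0 ⬝ᵥ u 1| ≤ tayC * M ^ 3 := by
  have h0 := h.nonneg
  have := abs_integral_Sh_Sh_Ch_Ch_sub_le (u₃ := 0) (u₄ := 0) hM (h 0 1 (by decide))
    (by simpa) (by simpa) (by simpa) (by simpa) (by simpa)
  simpa [Ch_zero] using this

lemma integral_Sh_Sh_Ch (h : Coupled u M) (hM : M ≤ 1) :
    |∫ ω, Sh (u 0) ω * Sh (u 1) ω * (Ch (u 2) ω - 1) ∂stdG κ - (u 0 ⬝ᵥ u 2) * (u 1 ⬝ᵥ u 2)|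
      ≤ 2 * tayC * M ^ 3 := by
  have h0 := h.nonneg
  have h1 := integral_Sh_Sh h hM
  have h2 := abs_integral_Sh_Sh_Ch_Ch_sub_le (u₄ := 0) hM (h 0 1 (by decide))
    (h 0 2 (by decide)) (by simpa) (h 1 2 (by decide)) (by simpa) (by simpa)
  simp only [Ch_zero, dotProduct_zero, mul_one, add_zero, mul_zero] at h2
  simp_rw [mul_sub, mul_one]
  rw [integral_sub (((expGr_Sh _).mul (expGr_Sh _)).mul (expGr_Ch _)).integrable
    ((expGr_Sh _).mul (expGr_Sh _)).integrable]
  rw [abs_le] at *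
  constructor <;> linarith [h1.1, h1.2, h2.1, h2.2]

lemma integral_Sh₄ (h : Coupled u M) (hM : M ≤ 1) :
    |∫ ω, Sh (u 0) ω * Sh (u 1) ω * Sh (u 2) ω * Sh (u 3) ω ∂stdG κ| ≤ tayC * M ^ 2 :=
  abs_integral_Sh_mul₄_le hM (h 0 1 (by decide)) (h 0 2 (by decide)) (h 0 3 (by decide))
    (h 1 2 (by decide)) (h 1 3 (by decide)) (h 2 3 (by decide))

lemma integral_Ch_Ch (h : Coupled u M) (hM : M ≤ 1) :
    |∫ ω, Ch (u 0) ω * Ch (u 1) ω ∂stdG κ - 1| ≤ tayC * M ^ 2 := by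
  have h0 := h.nonneg
  have := abs_integral_Ch_mul₄_sub_one_le (u₃ := 0) (u₄ := 0) hM (h 0 1 (by decide))
    (by simpa) (by simpa) (by simpa) (by simpa) (by simpa)
  simpa [Ch_zero] using this

lemma integral_Ch_Ch_Ch (h : Coupled u M) (hM : M ≤ 1) :
    |∫ ω, Ch (u 0) ω * Ch (u 1) ω * (Ch (u 2) ω - 1) ∂stdG κ| ≤ 2 * tayC * M ^ 2 := by
  have h0 := h.nonneg
  have h1 := integral_Ch_Ch h hM
  have h2 := abs_integral_Ch_mul₄_sub_one_le (u₄ := 0) hM (h 0 1 (by decide))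
    (h 0 2 (by decide)) (by simpa) (h 1 2 (by decide)) (by simpa) (by simpa)
  simp only [Ch_zero, mul_one] at h2
  simp_rw [mul_sub, mul_one]
  rw [integral_sub (((expGr_Ch _).mul (expGr_Ch _)).mul (expGr_Ch _)).integrable
    ((expGr_Ch _).mul (expGr_Ch _)).integrable]
  rw [abs_le] at *
  constructor <;> linarith [h1.1, h1.2, h2.1, h2.2]

lemma integral_Ch_Ch_Ch_Ch (h : Coupled u M) (hM : M ≤ 1) :
    |∫ ω, Ch (u 0) ω * Ch (u 1) ω * ((Ch (u 2) ω - 1) * (Ch (u 3) ω - 1)) ∂stdG κ|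
      ≤ 4 * tayC * M ^ 2 := by
  have h0 := h.nonneg
  have h1 := integral_Ch_Ch_Ch h hM
  have h2 := abs_integral_Ch_mul₄_sub_one_le hM (h 0 1 (by decide))
    (h 0 2 (by decide)) (h 0 3 (by decide)) (h 1 2 (by decide)) (h 1 3 (by decide))
    (h 2 3 (by decide))
  have h3 := abs_integral_Ch_mul₄_sub_one_le (u₃ := 0) hM (h 0 1 (by decide))
    (by simpa) (h 0 3 (by decide)) (by simpa) (h 1 3 (by decide)) (by simpa)
  simp only [Ch_zero, mul_one] at h3
  have e : ∀ ω, Ch (u 0) ω * Ch (u 1) ω * ((Ch (u 2) ω - 1) * (Ch (u 3) ω - 1))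
      = Ch (u 0) ω * Ch (u 1) ω * Ch (u 2) ω * Ch (u 3) ω - Ch (u 0) ω * Ch (u 1) ω * Ch (u 3) ω -
        Ch (u 0) ω * Ch (u 1) ω * (Ch (u 2) ω - 1) := fun ω => by ring
  simp_rw [e]
  have i2 : ExpGr fun ω => Ch (u 0) ω * Ch (u 1) ω := (expGr_Ch _).mul (expGr_Ch _)
  rw [integral_sub (((i2.mul (expGr_Ch _)).mul (expGr_Ch _)).sub (i2.mul (expGr_Ch _))).integrable
    (i2.mul ((expGr_Ch _).sub (ExpGr.const 1))).integrable,
    integral_sub ((i2.mul (expGr_Ch _)).mul (expGr_Ch _)).integrable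
      (i2.mul (expGr_Ch _)).integrable]
  rw [abs_le] at *
  constructor <;> linarith [h1.1, h1.2, h2.1, h2.2, h3.1, h3.2]

lemma integral_Ch_sub_one₄ (h : Coupled u M) (hM : M ≤ 1) :
    |∫ ω, (Ch (u 0) ω - 1) * (Ch (u 1) ω - 1) * ((Ch (u 2) ω - 1) * (Ch (u 3) ω - 1)) ∂stdG κ|
      ≤ 11 * tayC * M ^ 4 := by
  have h0 := h.nonneg
  have k01 := h 0 1 (by decide)
  have k02 := h 0 2 (by decide)
  have k03 := h 0 3 (by decide)
  have k12 := h 1 2 (by decide)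
  have k13 := h 1 3 (by decide)
  have k23 := h 2 3 (by decide)
  have c1 : ∀ v : κ → ℝ, ∫ ω, Ch v ω ∂stdG κ = 1 := by
    intro v
    have := abs_integral_Ch_mul₄_sub_one_le (u₁ := v) (u₂ := 0) (u₃ := 0) (u₄ := 0) (M := 0)
      zero_le_one (by simp) (by simp) (by simp) (by simp) (by simp) (by simp)
    simp only [Ch_zero, mul_one] at this
    norm_num at this
    linarith
  have c2 : ∀ v w : κ → ℝ, |v ⬝ᵥ w| ≤ M →
      |∫ ω, Ch v ω * Ch w ω ∂stdG κ - (1 + 1 / 2 * (v ⬝ᵥ w) ^ 2)| ≤ tayC * M ^ 4 := by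
    intro v w hvw
    have := abs_integral_Ch_mul₄_fourth_le (u₁ := v) (u₂ := w) (u₃ := 0) (u₄ := 0) hM
      hvw (by simpa) (by simpa) (by simpa) (by simpa) (by simpa)
    simpa [Ch_zero] using this
  have c3 : ∀ v w x : κ → ℝ, |v ⬝ᵥ w| ≤ M → |v ⬝ᵥ x| ≤ M → |w ⬝ᵥ x| ≤ M →
      |∫ ω, Ch v ω * Ch w ω * Ch x ω ∂stdG κ - (1 + 1 / 2 * ((v ⬝ᵥ w) ^ 2 + (v ⬝ᵥ x) ^ 2 +
        (w ⬝ᵥ x) ^ 2) + (v ⬝ᵥ w) * (v ⬝ᵥ x) * (w ⬝ᵥ x))| ≤ tayC * M ^ 4 := by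
    intro v w x h1 h2 h3
    have := abs_integral_Ch_mul₄_fourth_le (u₁ := v) (u₂ := w) (u₃ := x) (u₄ := 0) hM
      h1 h2 (by simpa) h3 (by simpa) (by simpa)
    simpa [Ch_zero] using this
  have e : ∀ ω, (Ch (u 0) ω - 1) * (Ch (u 1) ω - 1) * ((Ch (u 2) ω - 1) * (Ch (u 3) ω - 1))
      = Ch (u 0) ω * Ch (u 1) ω * Ch (u 2) ω * Ch (u 3) ω
        - Ch (u 0) ω * Ch (u 1) ω * Ch (u 2) ω - Ch (u 0) ω * Ch (u 1) ω * Ch (u 3) ω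
        - Ch (u 0) ω * Ch (u 2) ω * Ch (u 3) ω - Ch (u 1) ω * Ch (u 2) ω * Ch (u 3) ω
        + Ch (u 0) ω * Ch (u 1) ω + Ch (u 0) ω * Ch (u 2) ω + Ch (u 0) ω * Ch (u 3) ω
        + Ch (u 1) ω * Ch (u 2) ω + Ch (u 1) ω * Ch (u 3) ω + Ch (u 2) ω * Ch (u 3) ω
        - Ch (u 0) ω - Ch (u 1) ω - Ch (u 2) ω - Ch (u 3) ω + 1 := fun ω => by ring
  have g1 : ∀ a, ExpGr (Ch (u a)) := fun a => expGr_Ch _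
  have g2 : ∀ a b, ExpGr fun ω => Ch (u a) ω * Ch (u b) ω := fun a b => (g1 a).mul (g1 b)
  have g3 : ∀ a b c, ExpGr fun ω => Ch (u a) ω * Ch (u b) ω * Ch (u c) ω :=
    fun a b c => (g2 a b).mul (g1 c)
  have g4 : ExpGr fun ω => Ch (u 0) ω * Ch (u 1) ω * Ch (u 2) ω * Ch (u 3) ω :=
    (g3 0 1 2).mul (g1 3)
  have s1 := g4.sub (g3 0 1 2)
  have s2 := s1.sub (g3 0 1 3)
  have s3 := s2.sub (g3 0 2 3)
  have s4 := s3.sub (g3 1 2 3)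
  have s5 := s4.add (g2 0 1)
  have s6 := s5.add (g2 0 2)
  have s7 := s6.add (g2 0 3)
  have s8 := s7.add (g2 1 2)
  have s9 := s8.add (g2 1 3)
  have s10 := s9.add (g2 2 3)
  have s11 := s10.sub (g1 0)
  have s12 := s11.sub (g1 1)
  have s13 := s12.sub (g1 2)
  have s14 := s13.sub (g1 3)
  simp_rw [e]
  rw [integral_add s14.integrable (integrable_const 1), integral_sub s13.integrable (g1 3).integrable,
    integral_sub s12.integrable (g1 2).integrable, integral_sub s11.integrable (g1 1).integrable,
    integral_sub s10.integrable (g1 0).integrable, integral_add s9.integrable (g2 2 3).integrable,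
    integral_add s8.integrable (g2 1 3).integrable, integral_add s7.integrable (g2 1 2).integrable,
    integral_add s6.integrable (g2 0 3).integrable, integral_add s5.integrable (g2 0 2).integrable,
    integral_add s4.integrable (g2 0 1).integrable, integral_sub s3.integrable (g3 1 2 3).integrable,
    integral_sub s2.integrable (g3 0 2 3).integrable,
    integral_sub s1.integrable (g3 0 1 3).integrable,
    integral_sub g4.integrable (g3 0 1 2).integrable, c1, c1, c1, c1]
  have q0 := abs_le.1 (abs_integral_Ch_mul₄_fourth_le hM k01 k02 k03 k12 k13 k23)
  have q1 := abs_le.1 (c3 _ _ _ k01 k02 k12)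
  have q2 := abs_le.1 (c3 _ _ _ k01 k03 k13)
  have q3 := abs_le.1 (c3 _ _ _ k02 k03 k23)
  have q4 := abs_le.1 (c3 _ _ _ k12 k13 k23)
  have q5 := abs_le.1 (c2 _ _ k01)
  have q6 := abs_le.1 (c2 _ _ k02)
  have q7 := abs_le.1 (c2 _ _ k03)
  have q8 := abs_le.1 (c2 _ _ k12)
  have q9 := abs_le.1 (c2 _ _ k13)
  have q10 := abs_le.1 (c2 _ _ k23)
  simp only [integral_const, probReal_univ, one_smul]
  rw [abs_le]
  constructor <;> linarith [q0.1, q0.2, q1.1, q1.2, q2.1, q2.2, q3.1, q3.2, q4.1, q4.2, q5.1, q5.2,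
    q6.1, q6.2, q7.1, q7.2, q8.1, q8.2, q9.1, q9.2, q10.1, q10.2]

end MomentBounds

/-! ### The cavity expansion for two coupled systems -/

/-- Two systems (labelled by `Bool`) on a finite state space `S`, each with a probability vector
`μ i` and Gaussian fields `u i a`, whose scalar products are controlled by `ρ`. -/
structure CavSys (S κ : Type*) [Fintype S] [Fintype κ] where
  /-- the probability vectors -/
  μ : Bool → S → ℝ
  /-- the covariance vectors of the fields -/
  u : Bool → S → κ → ℝ
  /-- the control on scalar products -/
  ρ : S → S → ℝ
  μ_nonneg : ∀ i a, 0 ≤ μ i a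
  sum_μ : ∀ i, ∑ a, μ i a = 1
  u_self : ∀ i a, u i a ⬝ᵥ u i a ≤ 1
  dot_le : ∀ i j a b, |u i a ⬝ᵥ u j b| ≤ ρ a b
  ρ_le : ∀ a b, ρ a b ≤ 1
  ρ_comm : ∀ a b, ρ a b = ρ b a

namespace CavSys

variable {S κ : Type*} [Fintype S] [Fintype κ] (s : CavSys S κ)

/-- Average with respect to `μ i`. -/
def av (i : Bool) (f : S → ℝ) : ℝ := ∑ a, s.μ i a * f a

@[simp] lemma av_const (i : Bool) (c : ℝ) : s.av i (fun _ => c) = c := by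
  rw [av, ← Finset.sum_mul, s.sum_μ, one_mul]

lemma av_mono {i : Bool} {f g : S → ℝ} (h : ∀ a, f a ≤ g a) : s.av i f ≤ s.av i g :=
  Finset.sum_le_sum fun a _ => mul_le_mul_of_nonneg_left (h a) (s.μ_nonneg i a)

lemma av_nonneg {i : Bool} {f : S → ℝ} (h : ∀ a, 0 ≤ f a) : 0 ≤ s.av i f :=
  Finset.sum_nonneg fun a _ => mul_nonneg (s.μ_nonneg i a) (h a)

lemma av_add (i : Bool) (f g : S → ℝ) : s.av i (fun a => f a + g a) = s.av i f + s.av i g := by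
  simp [av, mul_add, Finset.sum_add_distrib]

lemma av_sub (i : Bool) (f g : S → ℝ) : s.av i (fun a => f a - g a) = s.av i f - s.av i g := by
  simp [av, mul_sub, Finset.sum_sub_distrib]

lemma av_mul_left (i : Bool) (c : ℝ) (f : S → ℝ) : s.av i (fun a => c * f a) = c * s.av i f := by
  simp only [av, Finset.mul_sum]
  exact Finset.sum_congr rfl fun a _ => by ring

lemma av_mul_right (i : Bool) (c : ℝ) (f : S → ℝ) : s.av i (fun a => f a * c) = s.av i f * c := by
  simp only [av, Finset.sum_mul]
  exact Finset.sum_congr rfl fun a _ => by ring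

lemma abs_av_le (i : Bool) (f : S → ℝ) : |s.av i f| ≤ s.av i (fun a => |f a|) := by
  refine (Finset.abs_sum_le_sum_abs _ _).trans_eq (Finset.sum_congr rfl fun a _ => ?_)
  rw [abs_mul, abs_of_nonneg (s.μ_nonneg i a)]

lemma expGr_av (i : Bool) {F : S → (κ → ℝ) → ℝ} (h : ∀ a, ExpGr (F a)) :
    ExpGr fun ω => s.av i fun a => F a ω :=
  ExpGr.sum _ fun a => (ExpGr.const _).mul (h a)

lemma integral_av (i : Bool) {F : S → (κ → ℝ) → ℝ} (h : ∀ a, ExpGr (F a)) :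
    ∫ ω, s.av i (fun a => F a ω) ∂stdG κ = s.av i fun a => ∫ ω, F a ω ∂stdG κ := by
  unfold av
  rw [integral_finsetSum _ fun a _ => ((h a).integrable).const_mul _]
  exact Finset.sum_congr rfl fun a _ => integral_const_mul _ _

/-- Average over two replicas. -/
def av₂ (i j : Bool) (F : S → S → ℝ) : ℝ := s.av i fun a => s.av j fun b => F a b

/-- Average over four replicas. -/
def av₄ (i j k l : Bool) (F : S → S → S → S → ℝ) : ℝ :=
  s.av₂ i j fun a b => s.av₂ k l fun c d => F a b c d

lemma av₂_mono {i j : Bool} {F G : S → S → ℝ} (h : ∀ a b, F a b ≤ G a b) :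
    s.av₂ i j F ≤ s.av₂ i j G := s.av_mono fun a => s.av_mono (h a)

lemma av₂_nonneg {i j : Bool} {F : S → S → ℝ} (h : ∀ a b, 0 ≤ F a b) : 0 ≤ s.av₂ i j F :=
  s.av_nonneg fun a => s.av_nonneg (h a)

lemma av₂_sub (i j : Bool) (F G : S → S → ℝ) :
    s.av₂ i j (fun a b => F a b - G a b) = s.av₂ i j F - s.av₂ i j G := by
  simp only [av₂, av_sub]

lemma av₂_mul_left (i j : Bool) (c : ℝ) (F : S → S → ℝ) :
    s.av₂ i j (fun a b => c * F a b) = c * s.av₂ i j F := by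
  simp only [av₂, av_mul_left]

lemma av₂_mul_right (i j : Bool) (c : ℝ) (F : S → S → ℝ) :
    s.av₂ i j (fun a b => F a b * c) = s.av₂ i j F * c := by
  simp only [av₂, av_mul_right]

@[simp] lemma av₂_const (i j : Bool) (c : ℝ) : s.av₂ i j (fun _ _ => c) = c := by
  simp [av₂]

lemma abs_av₂_le (i j : Bool) (F : S → S → ℝ) :
    |s.av₂ i j F| ≤ s.av₂ i j (fun a b => |F a b|) :=
  (s.abs_av_le i _).trans (s.av_mono fun _ => s.abs_av_le j _)

lemma expGr_av₂ (i j : Bool) {F : S → S → (κ → ℝ) → ℝ} (h : ∀ a b, ExpGr (F a b)) :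
    ExpGr fun ω => s.av₂ i j fun a b => F a b ω :=
  s.expGr_av i fun a => s.expGr_av j fun b => h a b

lemma integral_av₂ (i j : Bool) {F : S → S → (κ → ℝ) → ℝ} (h : ∀ a b, ExpGr (F a b)) :
    ∫ ω, s.av₂ i j (fun a b => F a b ω) ∂stdG κ = s.av₂ i j fun a b => ∫ ω, F a b ω ∂stdG κ := by
  unfold av₂
  rw [s.integral_av i fun a => s.expGr_av j (h a)]
  congr 1; ext a
  rw [s.integral_av j (h a)]

lemma integral_av₄ (i j k l : Bool) {F : S → S → S → S → (κ → ℝ) → ℝ}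
    (h : ∀ a b c d, ExpGr (F a b c d)) :
    ∫ ω, s.av₄ i j k l (fun a b c d => F a b c d ω) ∂stdG κ
      = s.av₄ i j k l fun a b c d => ∫ ω, F a b c d ω ∂stdG κ := by
  unfold av₄
  rw [s.integral_av₂ i j fun a b => s.expGr_av₂ k l (h a b)]
  congr 1; ext a b
  rw [s.integral_av₂ k l (h a b)]

lemma av₂_mul_av₂ (i j k l : Bool) (F G : S → S → ℝ) :
    s.av₂ i j F * s.av₂ k l G = s.av₄ i j k l fun a b c d => F a b * G c d := by
  simp only [av₄, av₂_mul_left, av₂_mul_right]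

/-- Total `m`-th moment of `ρ`. -/
def mom (m : ℕ) : ℝ := ∑ i, ∑ j, s.av₂ i j fun a b => s.ρ a b ^ m

lemma ρ_nonneg (a b : S) : 0 ≤ s.ρ a b := (abs_nonneg _).trans (s.dot_le true true a b)

lemma av₂_ρ_le (i j : Bool) (m : ℕ) : s.av₂ i j (fun a b => s.ρ a b ^ m) ≤ s.mom m := by
  have h : ∀ i j, 0 ≤ s.av₂ i j fun a b => s.ρ a b ^ m := fun i j =>
    s.av₂_nonneg fun a b => pow_nonneg (s.ρ_nonneg a b) m
  exact (Finset.single_le_sum (f := fun j => s.av₂ i j fun a b => s.ρ a b ^ m)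
    (fun j _ => h i j) (Finset.mem_univ j)).trans
    (Finset.single_le_sum (f := fun i => ∑ j, s.av₂ i j fun a b => s.ρ a b ^ m)
    (fun i _ => Finset.sum_nonneg fun j _ => h i j) (Finset.mem_univ i))

lemma mom_nonneg (m : ℕ) : 0 ≤ s.mom m :=
  (s.av₂_nonneg fun a b => pow_nonneg (s.ρ_nonneg a b) m).trans (s.av₂_ρ_le true true m)

/-- Largest value of `ρ` on pairs from four replicas. -/
def top (a b c d : S) : ℝ :=
  max (max (max (s.ρ a b) (s.ρ a c)) (max (s.ρ a d) (s.ρ b c))) (max (s.ρ b d) (s.ρ c d))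

lemma top_le (a b c d : S) : s.top a b c d ≤ 1 := by
  simp [top, s.ρ_le]

lemma le_top₁₂ (a b c d : S) : s.ρ a b ≤ s.top a b c d := by simp [top]
lemma le_top₃₄ (a b c d : S) : s.ρ c d ≤ s.top a b c d := by simp [top]

lemma top_nonneg (a b c d : S) : 0 ≤ s.top a b c d := (s.ρ_nonneg a b).trans (s.le_top₁₂ a b c d)

lemma coupled (i j k l : Bool) (a b c d : S) :
    Coupled ![s.u i a, s.u j b, s.u k c, s.u l d] (s.top a b c d) := by
  have h := s.dot_le
  have h' : ∀ i j a b, |s.u i a ⬝ᵥ s.u j b| ≤ s.ρ b a := fun i j a b => by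
    rw [s.ρ_comm]; exact h i j a b
  have m1 : s.ρ a b ≤ s.top a b c d := by simp [top]
  have m2 : s.ρ a c ≤ s.top a b c d := by simp [top]
  have m3 : s.ρ a d ≤ s.top a b c d := by simp [top]
  have m4 : s.ρ b c ≤ s.top a b c d := by simp [top]
  have m5 : s.ρ b d ≤ s.top a b c d := by simp [top]
  have m6 : s.ρ c d ≤ s.top a b c d := by simp [top]
  intro p q hpq
  fin_cases p <;> fin_cases q
  · exact absurd rfl hpq
  · exact (h _ _ _ _).trans m1
  · exact (h _ _ _ _).trans m2
  · exact (h _ _ _ _).trans m3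
  · exact (h' _ _ _ _).trans m1
  · exact absurd rfl hpq
  · exact (h _ _ _ _).trans m4
  · exact (h _ _ _ _).trans m5
  · exact (h' _ _ _ _).trans m2
  · exact (h' _ _ _ _).trans m4
  · exact absurd rfl hpq
  · exact (h _ _ _ _).trans m6
  · exact (h' _ _ _ _).trans m3
  · exact (h' _ _ _ _).trans m5
  · exact (h' _ _ _ _).trans m6
  · exact absurd rfl hpq

lemma top_pow_le (a b c d : S) (m : ℕ) :
    s.top a b c d ^ m ≤ s.ρ a b ^ m + s.ρ a c ^ m + s.ρ a d ^ m + s.ρ b c ^ m + s.ρ b d ^ m +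
      s.ρ c d ^ m := by
  have p : ∀ x y, 0 ≤ s.ρ x y ^ m := fun x y => pow_nonneg (s.ρ_nonneg x y) m
  have : s.top a b c d = s.ρ a b ∨ s.top a b c d = s.ρ a c ∨ s.top a b c d = s.ρ a d ∨
      s.top a b c d = s.ρ b c ∨ s.top a b c d = s.ρ b d ∨ s.top a b c d = s.ρ c d := by
    unfold top; grind
  have p1 := p a b
  have p2 := p a c
  have p3 := p a d
  have p4 := p b c
  have p5 := p b d
  have p6 := p c d
  rcases this with h | h | h | h | h | h <;> rw [h] <;> linarith

lemma av₄_top_le (i j k l : Bool) (m : ℕ) :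
    s.av₄ i j k l (fun a b c d => s.top a b c d ^ m) ≤ 6 * s.mom m := by
  have h : s.av₄ i j k l (fun a b c d => s.top a b c d ^ m) ≤
      s.av₂ i j (fun a b => s.ρ a b ^ m) + s.av₂ i k (fun a b => s.ρ a b ^ m) +
      s.av₂ i l (fun a b => s.ρ a b ^ m) + s.av₂ j k (fun a b => s.ρ a b ^ m) +
      s.av₂ j l (fun a b => s.ρ a b ^ m) + s.av₂ k l (fun a b => s.ρ a b ^ m) := by
    refine (s.av₂_mono fun a b => s.av₂_mono fun c d => s.top_pow_le a b c d m).trans_eq ?_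
    simp only [av₂, av_add, av_const]
  linarith [s.av₂_ρ_le i j m, s.av₂_ρ_le i k m, s.av₂_ρ_le i l m, s.av₂_ρ_le j k m,
    s.av₂_ρ_le j l m, s.av₂_ρ_le k l m]

lemma abs_av₄_le {i j k l : Bool} {F : S → S → S → S → ℝ} {C : ℝ} {m : ℕ} (hC : 0 ≤ C)
    (h : ∀ a b c d, |F a b c d| ≤ C * s.top a b c d ^ m) :
    |s.av₄ i j k l F| ≤ 6 * C * s.mom m := by
  have h1 : |s.av₄ i j k l F| ≤ s.av₄ i j k l (fun a b c d => C * s.top a b c d ^ m) :=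
    (s.abs_av₂_le i j _).trans (s.av₂_mono fun a b => (s.abs_av₂_le k l _).trans
      (s.av₂_mono fun c d => h a b c d))
  have h2 : s.av₄ i j k l (fun a b c d => C * s.top a b c d ^ m)
      = C * s.av₄ i j k l (fun a b c d => s.top a b c d ^ m) := by
    simp only [av₄, av₂_mul_left]
  nlinarith [s.av₄_top_le i j k l m]

lemma abs_av₄_sub_le {i j k l : Bool} {F G : S → S → S → S → ℝ} {C : ℝ} {m : ℕ} (hC : 0 ≤ C)
    (h : ∀ a b c d, |F a b c d - G a b c d| ≤ C * s.top a b c d ^ m) :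
    |s.av₄ i j k l F - s.av₄ i j k l G| ≤ 6 * C * s.mom m := by
  have e : s.av₄ i j k l F - s.av₄ i j k l G
      = s.av₄ i j k l fun a b c d => F a b c d - G a b c d := by
    simp only [av₄, av₂_sub]
  rw [e]; exact s.abs_av₄_le hC h

/-- Partition function of the cavity field. -/
def Z (i : Bool) (ω : κ → ℝ) : ℝ := s.av i fun a => Ch (s.u i a) ω

lemma half_le_Z (i : Bool) (ω : κ → ℝ) : 1 / 2 ≤ s.Z i ω := by
  rw [← s.av_const i (1 / 2)]
  exact s.av_mono fun a => half_le_Ch (s.u_self i a) ω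

lemma Z_pos (i : Bool) (ω : κ → ℝ) : 0 < s.Z i ω := by linarith [s.half_le_Z i ω]

lemma expGr_Z (i : Bool) : ExpGr (s.Z i) := s.expGr_av i fun _ => expGr_Ch _

lemma expGr_inv_Z_mul : ExpGr fun ω => (s.Z false ω * s.Z true ω)⁻¹ :=
  ((s.expGr_Z false).mul (s.expGr_Z true)).inv (c := 1 / 4) (by norm_num) fun ω => by
    nlinarith [s.half_le_Z false ω, s.half_le_Z true ω]

/-- Second-order remainder of the inverse of the product of partition functions. -/
def rem (ω : κ → ℝ) : ℝ :=
  (s.Z false ω * s.Z true ω)⁻¹ - (1 - (s.Z false ω - 1) - (s.Z true ω - 1))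

lemma abs_rem_le (ω : κ → ℝ) :
    |s.rem ω| ≤ 4 * ((s.Z false ω - 1) ^ 2 + (s.Z true ω - 1) ^ 2) := by
  have hX := s.half_le_Z false ω
  have hY := s.half_le_Z true ω
  unfold rem
  set X := s.Z false ω
  set Y := s.Z true ω
  have hX0 : 0 < X := by linarith
  have hY0 : 0 < Y := by linarith
  have e : (X * Y)⁻¹ - (1 - (X - 1) - (Y - 1))
      = ((X - 1) ^ 2 * Y + (Y - 1) ^ 2 * X + (X - 1) * (Y - 1)) / (X * Y) := by
    field_simp; ring
  rw [e, abs_div, abs_of_pos (mul_pos hX0 hY0), div_le_iff₀ (mul_pos hX0 hY0), abs_le]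
  have hXY : 1 / 4 ≤ X * Y := by nlinarith
  have hx : 0 ≤ (X - 1) ^ 2 := sq_nonneg _
  have hy : 0 ≤ (Y - 1) ^ 2 := sq_nonneg _
  have a1 : (X - 1) ^ 2 * Y ≤ 2 * (X - 1) ^ 2 * (X * Y) := by
    nlinarith [mul_nonneg (mul_nonneg hx hY0.le) (by linarith : (0:ℝ) ≤ 2 * X - 1)]
  have a2 : (Y - 1) ^ 2 * X ≤ 2 * (Y - 1) ^ 2 * (X * Y) := by
    nlinarith [mul_nonneg (mul_nonneg hy hX0.le) (by linarith : (0:ℝ) ≤ 2 * Y - 1)]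
  have a3 : ((X - 1) ^ 2 + (Y - 1) ^ 2) * (1 / 4) ≤ ((X - 1) ^ 2 + (Y - 1) ^ 2) * (X * Y) := by
    gcongr
  have a4 : 0 ≤ (X - 1) ^ 2 * Y := by positivity
  have a5 : 0 ≤ (Y - 1) ^ 2 * X := by positivity
  constructor
  · nlinarith [sq_nonneg (X - 1 + (Y - 1))]
  · nlinarith [sq_nonneg (X - 1 - (Y - 1))]

lemma expGr_rem : ExpGr s.rem :=
  s.expGr_inv_Z_mul.sub (((ExpGr.const 1).sub ((s.expGr_Z false).sub (ExpGr.const 1))).sub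
    ((s.expGr_Z true).sub (ExpGr.const 1)))

lemma Z_sub_one_eq (i l : Bool) (ω : κ → ℝ) :
    s.Z i ω - 1 = s.av₂ i l fun c _ => Ch (s.u i c) ω - 1 := by
  simp [av₂, av_sub, Z]

lemma Z_sub_one_sq (i : Bool) (ω : κ → ℝ) :
    (s.Z i ω - 1) ^ 2 = s.av₂ i i fun c d => (Ch (s.u i c) ω - 1) * (Ch (s.u i d) ω - 1) := by
  simp [av₂, av_sub, Z, av_mul_left, av_mul_right, sq]

lemma integral_Z_sub_one_fourth_le (i : Bool) :
    ∫ ω, (s.Z i ω - 1) ^ 4 ∂stdG κ ≤ 66 * tayC * s.mom 4 := by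
  have e : ∀ ω, (s.Z i ω - 1) ^ 4 = s.av₄ i i i i fun a b c d =>
      (Ch (s.u i a) ω - 1) * (Ch (s.u i b) ω - 1) *
        ((Ch (s.u i c) ω - 1) * (Ch (s.u i d) ω - 1)) := by
    intro ω
    rw [← av₂_mul_av₂, ← Z_sub_one_sq]; ring
  simp_rw [e]
  have g : ∀ a, ExpGr fun ω => Ch (s.u i a) ω - 1 := fun a => (expGr_Ch _).sub (ExpGr.const 1)
  rw [s.integral_av₄ i i i i fun a b c d => ((g a).mul (g b)).mul ((g c).mul (g d))]
  refine (le_abs_self _).trans ((s.abs_av₄_le (C := 11 * tayC) (m := 4) (by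
    linarith [tayC_pos]) fun a b c d => ?_).trans_eq (by ring))
  have h := integral_Ch_sub_one₄ (s.coupled i i i i a b c d) (s.top_le a b c d)
  simp only [Matrix.cons_val] at h
  exact h

end CavSys

namespace CavSys

variable {S κ : Type*} [Fintype S] [Fintype κ] (s : CavSys S κ)

/-- Expectation of the tilted average of `f` weighted by `ψ (u a) * ψ (u b)`. -/
def tilt (ψ : (κ → ℝ) → (κ → ℝ) → ℝ) (f : S → S → ℝ) : ℝ :=
  ∫ ω, s.av₂ false true (fun a b => f a b * (ψ (s.u false a) ω * ψ (s.u true b) ω)) *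
    (s.Z false ω * s.Z true ω)⁻¹ ∂stdG κ

lemma tilt_eq {ψ : (κ → ℝ) → (κ → ℝ) → ℝ} (hψ : ∀ u, ExpGr (ψ u)) (f : S → S → ℝ) :
    s.tilt ψ f =
      s.av₂ false true (fun a b => f a b * ∫ ω, ψ (s.u false a) ω * ψ (s.u true b) ω ∂stdG κ)
      - s.av₄ false true false false (fun a b c _ => f a b *
          ∫ ω, ψ (s.u false a) ω * ψ (s.u true b) ω * (Ch (s.u false c) ω - 1) ∂stdG κ)
      - s.av₄ false true true true (fun a b c _ => f a b *
          ∫ ω, ψ (s.u false a) ω * ψ (s.u true b) ω * (Ch (s.u true c) ω - 1) ∂stdG κ)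
      + ∫ ω, s.av₂ false true (fun a b => f a b * (ψ (s.u false a) ω * ψ (s.u true b) ω)) *
          s.rem ω ∂stdG κ := by
  have g2 : ∀ a b, ExpGr fun ω => ψ (s.u false a) ω * ψ (s.u true b) ω :=
    fun a b => (hψ _).mul (hψ _)
  have g2f : ∀ a b, ExpGr fun ω => f a b * (ψ (s.u false a) ω * ψ (s.u true b) ω) :=
    fun a b => (ExpGr.const _).mul (g2 a b)
  have gC : ∀ i c, ExpGr fun ω => Ch (s.u i c) ω - 1 := fun i c =>
    (expGr_Ch _).sub (ExpGr.const 1)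
  have g3 : ∀ i a b c, ExpGr fun ω => f a b * (ψ (s.u false a) ω * ψ (s.u true b) ω) *
      (Ch (s.u i c) ω - 1) := fun i a b c => (g2f a b).mul (gC i c)
  have e : ∀ ω, s.av₂ false true (fun a b => f a b * (ψ (s.u false a) ω * ψ (s.u true b) ω)) *
      (s.Z false ω * s.Z true ω)⁻¹
      = s.av₂ false true (fun a b => f a b * (ψ (s.u false a) ω * ψ (s.u true b) ω))
        - s.av₄ false true false false (fun a b c _ => f a b *
          (ψ (s.u false a) ω * ψ (s.u true b) ω) * (Ch (s.u false c) ω - 1))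
        - s.av₄ false true true true (fun a b c _ => f a b *
          (ψ (s.u false a) ω * ψ (s.u true b) ω) * (Ch (s.u true c) ω - 1))
        + s.av₂ false true (fun a b => f a b * (ψ (s.u false a) ω * ψ (s.u true b) ω)) *
          s.rem ω := by
    intro ω
    rw [← av₂_mul_av₂ s false true false false
        (fun a b => f a b * (ψ (s.u false a) ω * ψ (s.u true b) ω)) (fun c _ => Ch (s.u false c) ω - 1),
      ← av₂_mul_av₂ s false true true true
        (fun a b => f a b * (ψ (s.u false a) ω * ψ (s.u true b) ω)) (fun c _ => Ch (s.u true c) ω - 1),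
      ← Z_sub_one_eq, ← Z_sub_one_eq, rem]
    ring
  have i1 : ExpGr fun ω => s.av₂ false true
      (fun a b => f a b * (ψ (s.u false a) ω * ψ (s.u true b) ω)) := s.expGr_av₂ _ _ g2f
  have i2 : ∀ i, ExpGr fun ω => s.av₄ false true i i (fun a b c _ => f a b *
          (ψ (s.u false a) ω * ψ (s.u true b) ω) * (Ch (s.u i c) ω - 1)) := fun i =>
    s.expGr_av₂ _ _ fun a b => s.expGr_av₂ _ _ fun c _ => g3 i a b c
  have i3 := i1.mul s.expGr_rem
  rw [tilt]
  simp_rw [e]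
  rw [integral_add ((i1.sub (i2 false)).sub (i2 true)).integrable i3.integrable,
    integral_sub (i1.sub (i2 false)).integrable (i2 true).integrable,
    integral_sub i1.integrable (i2 false).integrable, s.integral_av₂ _ _ g2f,
    s.integral_av₄ _ _ _ _ fun a b c _ => g3 false a b c,
    s.integral_av₄ _ _ _ _ fun a b c _ => g3 true a b c]
  simp_rw [mul_assoc, integral_const_mul]

/-- First-order expansion of the odd cavity correlation. -/
lemma tilt_Sh {f : S → S → ℝ} {n : ℕ} (hf : ∀ a b, |f a b| ≤ s.ρ a b ^ n) {t : ℝ} (ht : 0 < t) :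
    |s.tilt Sh f - (s.av₂ false true (fun a b => f a b * (s.u false a ⬝ᵥ s.u true b))
      - s.av₄ false true false false (fun a b c _ => f a b *
          ((s.u false a ⬝ᵥ s.u false c) * (s.u true b ⬝ᵥ s.u false c)))
      - s.av₄ false true true true (fun a b c _ => f a b *
          ((s.u false a ⬝ᵥ s.u true c) * (s.u true b ⬝ᵥ s.u true c))))|
      ≤ 528 * tayC * (s.mom (n + 3) + t⁻¹ * s.mom (2 * n + 2) + t * s.mom 4) := by
  have hT := tayC_pos
  have hfM : ∀ a b c d, |f a b| ≤ s.top a b c d ^ n := fun a b c d =>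
    (hf a b).trans (pow_le_pow_left₀ (s.ρ_nonneg a b) (s.le_top₁₂ a b c d) n)
  have hfM' : ∀ a b c d, |f c d| ≤ s.top a b c d ^ n := fun a b c d =>
    (hf c d).trans (pow_le_pow_left₀ (s.ρ_nonneg c d) (s.le_top₃₄ a b c d) n)
  rw [s.tilt_eq expGr_Sh]
  have t1 : |s.av₂ false true (fun a b => f a b * ∫ ω, Sh (s.u false a) ω * Sh (s.u true b) ω ∂stdG κ)
      - s.av₂ false true (fun a b => f a b * (s.u false a ⬝ᵥ s.u true b))|
      ≤ 6 * tayC * s.mom (n + 3) := by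
    have h := s.abs_av₄_sub_le (i := false) (j := true) (k := true) (l := true)
      (F := fun a b _ _ => f a b * ∫ ω, Sh (s.u false a) ω * Sh (s.u true b) ω ∂stdG κ)
      (G := fun a b _ _ => f a b * (s.u false a ⬝ᵥ s.u true b)) (m := n + 3) hT.le
      (fun a b c d => by
        have h := integral_Sh_Sh (s.coupled false true true true a b c d) (s.top_le a b c d)
        simp only [Matrix.cons_val] at h
        rw [← mul_sub, abs_mul, pow_add]
        calc _ ≤ s.top a b c d ^ n * (tayC * s.top a b c d ^ 3) :=
              mul_le_mul (hfM a b c d) h (abs_nonneg _) (pow_nonneg (s.top_nonneg a b c d) n)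
          _ = _ := by ring)
    simpa only [av₄, av₂_const] using h
  have t2 : ∀ i, |s.av₄ false true i i (fun a b c _ => f a b *
          ∫ ω, Sh (s.u false a) ω * Sh (s.u true b) ω * (Ch (s.u i c) ω - 1) ∂stdG κ)
      - s.av₄ false true i i (fun a b c _ => f a b *
          ((s.u false a ⬝ᵥ s.u i c) * (s.u true b ⬝ᵥ s.u i c)))|
      ≤ 6 * (2 * tayC) * s.mom (n + 3) := by
    intro i
    refine s.abs_av₄_sub_le (by linarith) fun a b c d => ?_
    have h := integral_Sh_Sh_Ch (s.coupled false true i i a b c d) (s.top_le a b c d)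
    simp only [Matrix.cons_val] at h
    rw [← mul_sub, abs_mul, pow_add]
    calc _ ≤ s.top a b c d ^ n * (2 * tayC * s.top a b c d ^ 3) :=
          mul_le_mul (hfM a b c d) h (abs_nonneg _) (pow_nonneg (s.top_nonneg a b c d) n)
      _ = _ := by ring
  have gP : ExpGr fun ω =>
      s.av₂ false true (fun a b => f a b * (Sh (s.u false a) ω * Sh (s.u true b) ω)) :=
    s.expGr_av₂ _ _ fun a b => (ExpGr.const _).mul ((expGr_Sh _).mul (expGr_Sh _))
  have t3 : |∫ ω, s.av₂ false true (fun a b => f a b * (Sh (s.u false a) ω * Sh (s.u true b) ω)) ^ 2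
      ∂stdG κ| ≤ 6 * tayC * s.mom (2 * n + 2) := by
    have e : ∀ ω, s.av₂ false true (fun a b => f a b * (Sh (s.u false a) ω * Sh (s.u true b) ω)) ^ 2
        = s.av₄ false true false true fun a b c d => (f a b * f c d) * (Sh (s.u false a) ω *
          Sh (s.u true b) ω * Sh (s.u false c) ω * Sh (s.u true d) ω) := by
      intro ω
      rw [sq, av₂_mul_av₂]
      congr 1; ext a b c d; ring
    simp_rw [e]
    rw [s.integral_av₄ _ _ _ _ fun a b c d => (ExpGr.const _).mul
      ((((expGr_Sh _).mul (expGr_Sh _)).mul (expGr_Sh _)).mul (expGr_Sh _))]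
    refine s.abs_av₄_le hT.le fun a b c d => ?_
    have h := integral_Sh₄ (s.coupled false true false true a b c d) (s.top_le a b c d)
    simp only [Matrix.cons_val] at h
    rw [integral_const_mul, abs_mul, abs_mul]
    have h0 := pow_nonneg (s.top_nonneg a b c d) n
    calc _ ≤ s.top a b c d ^ n * s.top a b c d ^ n * (tayC * s.top a b c d ^ 2) :=
          mul_le_mul (mul_le_mul (hfM a b c d) (hfM' a b c d) (abs_nonneg _) h0) h (abs_nonneg _)
            (mul_nonneg h0 h0)
      _ = _ := by ring
  have t4 : |∫ ω, s.av₂ false true (fun a b => f a b * (Sh (s.u false a) ω * Sh (s.u true b) ω)) *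
          s.rem ω ∂stdG κ| ≤ 2 * t⁻¹ * (6 * tayC * s.mom (2 * n + 2)) +
            4 * t * (66 * tayC * s.mom 4) + 4 * t * (66 * tayC * s.mom 4) := by
    have gZ : ∀ i, ExpGr fun ω => (s.Z i ω - 1) ^ 4 := fun i =>
      ((s.expGr_Z i).sub (ExpGr.const 1)).pow 4
    have pw : ∀ ω, |s.av₂ false true (fun a b => f a b * (Sh (s.u false a) ω * Sh (s.u true b) ω)) *
          s.rem ω| ≤ 2 * t⁻¹ * s.av₂ false true
            (fun a b => f a b * (Sh (s.u false a) ω * Sh (s.u true b) ω)) ^ 2 +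
          4 * t * (s.Z false ω - 1) ^ 4 + 4 * t * (s.Z true ω - 1) ^ 4 := by
      intro ω
      have hr := s.abs_rem_le ω
      set P := s.av₂ false true (fun a b => f a b * (Sh (s.u false a) ω * Sh (s.u true b) ω))
      set x := s.Z false ω - 1
      set y := s.Z true ω - 1
      rw [abs_mul]
      have h1 : |P| * |s.rem ω| ≤ |P| * (4 * (x ^ 2 + y ^ 2)) := by gcongr
      have h2 : 4 * (|P| * (x ^ 2 + y ^ 2)) ≤ 2 * t⁻¹ * P ^ 2 + 2 * t * (x ^ 2 + y ^ 2) ^ 2 := by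
        have h3 := sq_nonneg (|P| - t * (x ^ 2 + y ^ 2))
        have h4 : 0 ≤ 2 * t⁻¹ * (|P| - t * (x ^ 2 + y ^ 2)) ^ 2 := by positivity
        have h5 : 2 * t⁻¹ * (|P| - t * (x ^ 2 + y ^ 2)) ^ 2 =
            2 * t⁻¹ * |P| ^ 2 - 4 * (|P| * (x ^ 2 + y ^ 2)) + 2 * t * (x ^ 2 + y ^ 2) ^ 2 := by
          field_simp
          ring
        rw [h5, sq_abs] at h4
        linarith
      have h6 : (x ^ 2 + y ^ 2) ^ 2 ≤ 2 * x ^ 4 + 2 * y ^ 4 := by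
        nlinarith [sq_nonneg (x ^ 2 - y ^ 2)]
      have h7 : 2 * t * (x ^ 2 + y ^ 2) ^ 2 ≤ 2 * t * (2 * x ^ 4 + 2 * y ^ 4) := by gcongr
      linarith
    have m1 := (ExpGr.const (κ := κ) (2 * t⁻¹)).mul (gP.pow 2)
    have m2 := (ExpGr.const (4 * t)).mul (gZ false)
    have m3 := (ExpGr.const (4 * t)).mul (gZ true)
    refine (abs_integral_le_integral_abs).trans ((integral_mono (gP.mul s.expGr_rem).abs.integrable
      ((m1.add m2).add m3).integrable pw).trans ?_)
    rw [integral_add (m1.add m2).integrable m3.integrable,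
      integral_add m1.integrable m2.integrable, integral_const_mul, integral_const_mul,
      integral_const_mul]
    have z := s.integral_Z_sub_one_fourth_le
    gcongr
    · exact (le_abs_self _).trans t3
    · exact z false
    · exact z true
  have t2f := abs_le.1 (t2 false)
  have t2t := abs_le.1 (t2 true)
  rw [abs_le] at t1 t4
  have d1 := s.mom_nonneg (n + 3)
  have d2 : 0 ≤ t⁻¹ * s.mom (2 * n + 2) := mul_nonneg (inv_pos.2 ht).le (s.mom_nonneg _)
  have d3 : 0 ≤ t * s.mom 4 := mul_nonneg ht.le (s.mom_nonneg _)
  have q1 := mul_nonneg hT.le d1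
  have q2 := mul_nonneg hT.le d2
  have q3 := mul_nonneg hT.le d3
  rw [abs_le]
  constructor <;> nlinarith [t1.1, t1.2, t2f.1, t2f.2, t2t.1, t2t.2, t4.1, t4.2]

/-- Expansion of the even cavity correlation. -/
lemma tilt_Ch {f : S → S → ℝ} {m : ℕ} (h0 : ∀ a b, 0 ≤ f a b) (hf : ∀ a b, f a b ≤ s.ρ a b ^ m) :
    |s.tilt Ch f - s.av₂ false true f| ≤ 222 * tayC * s.mom (m + 2) := by
  have hT := tayC_pos
  have hfM : ∀ a b c d, |f a b| ≤ s.top a b c d ^ m := fun a b c d => by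
    rw [abs_of_nonneg (h0 a b)]
    exact (hf a b).trans (pow_le_pow_left₀ (s.ρ_nonneg a b) (s.le_top₁₂ a b c d) m)
  rw [s.tilt_eq expGr_Ch]
  have key : ∀ {a b c d : S} {x C : ℝ}, |x| ≤ C * s.top a b c d ^ 2 →
      |f a b * x| ≤ C * s.top a b c d ^ (m + 2) := by
    intro a b c d x C hx
    rw [abs_mul, pow_add]
    calc _ ≤ s.top a b c d ^ m * (C * s.top a b c d ^ 2) :=
          mul_le_mul (hfM a b c d) hx (abs_nonneg _) (pow_nonneg (s.top_nonneg a b c d) m)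
      _ = _ := by ring
  have t1 : |s.av₂ false true (fun a b => f a b * ∫ ω, Ch (s.u false a) ω * Ch (s.u true b) ω ∂stdG κ)
      - s.av₂ false true f| ≤ 6 * tayC * s.mom (m + 2) := by
    have h := s.abs_av₄_sub_le (i := false) (j := true) (k := true) (l := true)
      (F := fun a b _ _ => f a b * ∫ ω, Ch (s.u false a) ω * Ch (s.u true b) ω ∂stdG κ)
      (G := fun a b _ _ => f a b) (m := m + 2) hT.le
      (fun a b c d => by
        have h := integral_Ch_Ch (s.coupled false true true true a b c d) (s.top_le a b c d)
        simp only [Matrix.cons_val] at h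
        have := key h
        rwa [mul_sub, mul_one] at this)
    simpa only [av₄, av₂_const] using h
  have t2 : ∀ i, |s.av₄ false true i i (fun a b c _ => f a b *
          ∫ ω, Ch (s.u false a) ω * Ch (s.u true b) ω * (Ch (s.u i c) ω - 1) ∂stdG κ)|
      ≤ 6 * (2 * tayC) * s.mom (m + 2) := by
    intro i
    refine s.abs_av₄_le (by linarith) fun a b c d => key ?_
    have h := integral_Ch_Ch_Ch (s.coupled false true i i a b c d) (s.top_le a b c d)
    simp only [Matrix.cons_val] at h
    exact h
  have gP : ExpGr fun ω =>
      s.av₂ false true (fun a b => f a b * (Ch (s.u false a) ω * Ch (s.u true b) ω)) :=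
    s.expGr_av₂ _ _ fun a b => (ExpGr.const _).mul ((expGr_Ch _).mul (expGr_Ch _))
  have t3 : ∀ i, ∫ ω, s.av₂ false true (fun a b => f a b * (Ch (s.u false a) ω * Ch (s.u true b) ω))
      * (s.Z i ω - 1) ^ 2 ∂stdG κ ≤ 6 * (4 * tayC) * s.mom (m + 2) := by
    intro i
    have e : ∀ ω, s.av₂ false true (fun a b => f a b * (Ch (s.u false a) ω * Ch (s.u true b) ω))
      * (s.Z i ω - 1) ^ 2
        = s.av₄ false true i i fun a b c d => f a b * (Ch (s.u false a) ω *
          Ch (s.u true b) ω * ((Ch (s.u i c) ω - 1) * (Ch (s.u i d) ω - 1))) := by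
      intro ω
      rw [Z_sub_one_sq, av₂_mul_av₂]
      congr 1; ext a b c d; ring
    simp_rw [e]
    have gC : ∀ c, ExpGr fun ω => Ch (s.u i c) ω - 1 := fun c => (expGr_Ch _).sub (ExpGr.const 1)
    rw [s.integral_av₄ _ _ _ _ fun a b c d => (ExpGr.const _).mul
      (((expGr_Ch _).mul (expGr_Ch _)).mul ((gC c).mul (gC d)))]
    refine (le_abs_self _).trans (s.abs_av₄_le (by linarith) fun a b c d => ?_)
    have h := integral_Ch_Ch_Ch_Ch (s.coupled false true i i a b c d) (s.top_le a b c d)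
    simp only [Matrix.cons_val] at h
    rw [integral_const_mul]
    exact key h
  have t4 : |∫ ω, s.av₂ false true (fun a b => f a b * (Ch (s.u false a) ω * Ch (s.u true b) ω)) *
          s.rem ω ∂stdG κ| ≤ 4 * (6 * (4 * tayC) * s.mom (m + 2)) +
            4 * (6 * (4 * tayC) * s.mom (m + 2)) := by
    have gZ : ∀ i, ExpGr fun ω => s.av₂ false true
        (fun a b => f a b * (Ch (s.u false a) ω * Ch (s.u true b) ω)) * (s.Z i ω - 1) ^ 2 :=
      fun i => gP.mul (((s.expGr_Z i).sub (ExpGr.const 1)).pow 2)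
    have pw : ∀ ω, |s.av₂ false true (fun a b => f a b * (Ch (s.u false a) ω * Ch (s.u true b) ω)) *
          s.rem ω| ≤ 4 * (s.av₂ false true
            (fun a b => f a b * (Ch (s.u false a) ω * Ch (s.u true b) ω)) * (s.Z false ω - 1) ^ 2) +
          4 * (s.av₂ false true
            (fun a b => f a b * (Ch (s.u false a) ω * Ch (s.u true b) ω)) *
              (s.Z true ω - 1) ^ 2) := by
      intro ω
      have hP : 0 ≤ s.av₂ false true (fun a b => f a b * (Ch (s.u false a) ω * Ch (s.u true b) ω)) :=
        s.av₂_nonneg fun a b => mul_nonneg (h0 a b) (mul_pos (Ch_pos _ _) (Ch_pos _ _)).le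
      rw [abs_mul, abs_of_nonneg hP]
      nlinarith [mul_le_mul_of_nonneg_left (s.abs_rem_le ω) hP]
    have m2 := (ExpGr.const 4).mul (gZ false)
    have m3 := (ExpGr.const 4).mul (gZ true)
    refine (abs_integral_le_integral_abs).trans ((integral_mono (gP.mul s.expGr_rem).abs.integrable
      (m2.add m3).integrable pw).trans ?_)
    rw [integral_add m2.integrable m3.integrable, integral_const_mul, integral_const_mul]
    linarith [t3 false, t3 true]
  have t2f := abs_le.1 (t2 false)
  have t2t := abs_le.1 (t2 true)
  rw [abs_le] at t1 t4
  rw [abs_le]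
  constructor <;> linarith [t1.1, t1.2, t2f.1, t2f.2, t2t.1, t2t.2, t4.1, t4.2]

/-- The cavity field costs at most a constant factor on nonnegative observables. -/
lemma av₂_le_tilt_Ch {f : S → S → ℝ} (h0 : ∀ a b, 0 ≤ f a b) :
    s.av₂ false true f ≤ 4 * (1 + tayC) * s.tilt Ch f := by
  have hT := tayC_pos
  have hK : (0:ℝ) < 1 + tayC := by linarith
  have hA : 0 ≤ s.av₂ false true f := s.av₂_nonneg h0
  have gZZ : ExpGr fun ω => s.Z false ω * s.Z true ω := (s.expGr_Z false).mul (s.expGr_Z true)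
  have hZZ : ∫ ω, s.Z false ω * s.Z true ω ∂stdG κ ≤ 1 + tayC := by
    have e : ∀ ω, s.Z false ω * s.Z true ω =
        s.av₂ false true fun a b => Ch (s.u false a) ω * Ch (s.u true b) ω := fun ω => by
      simp only [av₂, av_mul_left, av_mul_right, Z]
    simp_rw [e]
    rw [s.integral_av₂ _ _ fun a b => (expGr_Ch _).mul (expGr_Ch _)]
    refine (s.av₂_mono (G := fun _ _ => 1 + tayC) fun a b => ?_).trans_eq (s.av₂_const _ _ _)
    have h := integral_Ch_Ch (s.coupled false true true true a b b b) (s.top_le a b b b)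
    simp only [Matrix.cons_val] at h
    have h1 := (abs_le.1 h).2
    have h2 : s.top a b b b ^ 2 ≤ 1 := pow_le_one₀ (s.top_nonneg a b b b) (s.top_le a b b b)
    nlinarith
  have pw : ∀ ω, s.av₂ false true f / 4 * (2 * (1 + tayC)⁻¹ - (1 + tayC)⁻¹ ^ 2 *
      (s.Z false ω * s.Z true ω)) ≤
      s.av₂ false true (fun a b => f a b * (Ch (s.u false a) ω * Ch (s.u true b) ω)) *
        (s.Z false ω * s.Z true ω)⁻¹ := by
    intro ω
    have hz : 0 < s.Z false ω * s.Z true ω := mul_pos (s.Z_pos _ _) (s.Z_pos _ _)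
    have h1 : s.av₂ false true f / 4 ≤
        s.av₂ false true (fun a b => f a b * (Ch (s.u false a) ω * Ch (s.u true b) ω)) := by
      rw [div_eq_mul_inv, ← s.av₂_mul_right]
      refine s.av₂_mono fun a b => mul_le_mul_of_nonneg_left ?_ (h0 a b)
      nlinarith [half_le_Ch (s.u_self false a) ω, half_le_Ch (s.u_self true b) ω]
    set z := s.Z false ω * s.Z true ω
    have h2 : 2 * (1 + tayC)⁻¹ - (1 + tayC)⁻¹ ^ 2 * z ≤ z⁻¹ := by
      have : 0 ≤ z⁻¹ * (1 - (1 + tayC)⁻¹ * z) ^ 2 := by positivity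
      have e : z⁻¹ * (1 - (1 + tayC)⁻¹ * z) ^ 2 =
          z⁻¹ - (2 * (1 + tayC)⁻¹ - (1 + tayC)⁻¹ ^ 2 * z) := by
        field_simp; ring
      linarith
    calc _ ≤ s.av₂ false true f / 4 * z⁻¹ := by gcongr
      _ ≤ _ := by gcongr
  have gP : ExpGr fun ω =>
      s.av₂ false true (fun a b => f a b * (Ch (s.u false a) ω * Ch (s.u true b) ω)) *
        (s.Z false ω * s.Z true ω)⁻¹ :=
    (s.expGr_av₂ _ _ fun a b => (ExpGr.const _).mul ((expGr_Ch _).mul (expGr_Ch _))).mul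
      s.expGr_inv_Z_mul
  have gL : ExpGr fun ω => s.av₂ false true f / 4 * (2 * (1 + tayC)⁻¹ - (1 + tayC)⁻¹ ^ 2 *
      (s.Z false ω * s.Z true ω)) :=
    (ExpGr.const _).mul ((ExpGr.const _).sub ((ExpGr.const _).mul gZZ))
  have h := integral_mono gL.integrable gP.integrable pw
  rw [integral_const_mul, integral_sub (integrable_const _) (gZZ.integrable.const_mul _)] at h
  simp only [integral_const, probReal_univ, one_smul] at h
  rw [integral_const_mul] at h
  rw [tilt]
  have h5 : (1 + tayC)⁻¹ ≤ 2 * (1 + tayC)⁻¹ -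
      (1 + tayC)⁻¹ ^ 2 * ∫ ω, s.Z false ω * s.Z true ω ∂stdG κ := by
    have : (1 + tayC)⁻¹ ^ 2 * ∫ ω, s.Z false ω * s.Z true ω ∂stdG κ
        ≤ (1 + tayC)⁻¹ ^ 2 * (1 + tayC) := by gcongr
    have e : (1 + tayC)⁻¹ ^ 2 * (1 + tayC) = (1 + tayC)⁻¹ := by field_simp
    linarith
  have h6 : s.av₂ false true f / 4 * (1 + tayC)⁻¹ ≤ _ :=
    (mul_le_mul_of_nonneg_left h5 (by positivity)).trans h
  rw [← div_eq_mul_inv, div_div, div_le_iff₀ (by positivity)] at h6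
  linarith

end CavSys

/-! ### The cavity decomposition of the SK model -/

section SKCavity

/-- Entrywise powers of Gram matrices are positive semidefinite. -/
lemma sum_sum_gram_pow_nonneg {S J : Type*} [Fintype S] [Fintype J] (y : S → J → ℝ) (c : S → ℝ)
    (m : ℕ) : 0 ≤ ∑ s, ∑ t, c s * c t * (∑ j, y s j * y t j) ^ m := by
  induction m generalizing c with
  | zero =>
    have : ∑ s, ∑ t, c s * c t * (∑ j, y s j * y t j) ^ 0 = (∑ s, c s) ^ 2 := by
      simp [sq, Finset.sum_mul_sum]
    rw [this]; positivity
  | succ m ih =>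
    have : ∑ s, ∑ t, c s * c t * (∑ j, y s j * y t j) ^ (m + 1)
        = ∑ j, ∑ s, ∑ t, (c s * y s j) * (c t * y t j) * (∑ j, y s j * y t j) ^ m := by
      rw [Finset.sum_comm]
      simp_rw [Finset.sum_comm (s := (Finset.univ : Finset J))]
      rw [Finset.sum_comm]
      refine Finset.sum_congr rfl fun s _ => Finset.sum_congr rfl fun t _ => ?_
      rw [pow_succ, ← mul_assoc, Finset.mul_sum]
      exact Finset.sum_congr rfl fun j _ => by ring
    rw [this]
    exact Finset.sum_nonneg fun j _ => ih _

variable {N : ℕ} (β : ℝ) (i : Fin N)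

/-- Overlap without the site `i`. -/
def cavOvlp (σ τ : Config N) : ℝ :=
  (∑ j, if j = i then 0 else spin (σ j) * spin (τ j)) / N

/-- The pair contains the site `i`. -/
abbrev touch (p : Fin N × Fin N) : Prop := p.1 = i ∨ p.2 = i

/-- The pair underlying an index of the doubled disorder contains the site `i`. -/
abbrev touch₂ (q : (Fin N × Fin N) ⊕ (Fin N × Fin N)) : Prop := touch i (Sum.elim id id q)

/-- Part of the Hamiltonian away from the site `i`. -/
def offH (σ : Config N) : Fin N × Fin N → ℝ := fun p => if touch i p then 0 else hv N β σ p

/-- Part of the Hamiltonian at the site `i`. -/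
def attH (σ : Config N) : Fin N × Fin N → ℝ := fun p => if touch i p then hv N β σ p else 0

lemma pr₂_mix (a b : ℝ) (x y : (Fin N × Fin N) ⊕ (Fin N × Fin N) → ℝ) :
    pr₂ a b (mix (touch₂ i) (x, y)) = mix (touch i) (pr₂ a b x, pr₂ a b y) := by
  ext p
  by_cases h : touch i p
  · have h1 : touch₂ i (Sum.inl p) := h
    have h2 : touch₂ i (Sum.inr p) := h
    simp only [pr₂, mix, h, h1, h2, if_true]
  · have h1 : ¬ touch₂ i (Sum.inl p) := h
    have h2 : ¬ touch₂ i (Sum.inr p) := h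
    simp only [pr₂, mix, h, h1, h2, if_false]

lemma offH_flip (σ : Config N) : offH β i (flip i σ) = offH β i σ := by
  ext p
  unfold offH hv
  split_ifs with h1 h2
  · rfl
  · rw [not_or] at h1
    rw [spin_flip_of_ne h1.1, spin_flip_of_ne h1.2]
  · rfl

lemma attH_flip (σ : Config N) : attH β i (flip i σ) = -attH β i σ := by
  ext p
  simp only [attH, hv, Pi.neg_apply]
  split_ifs with h1 h2
  · rcases h1 with h | h
    · rw [h, spin_flip_self, spin_flip_of_ne (by rw [← h]; exact h2.ne')]; ring
    · rw [h, spin_flip_self, spin_flip_of_ne (by rw [← h]; exact h2.ne)]; ring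
  · simp
  · simp

lemma cavOvlp_flip_left (σ τ : Config N) : cavOvlp i (flip i σ) τ = cavOvlp i σ τ := by
  unfold cavOvlp
  congr 1
  refine Finset.sum_congr rfl fun j _ => ?_
  split_ifs with h
  · rfl
  · rw [spin_flip_of_ne h]

lemma cavOvlp_comm (σ τ : Config N) : cavOvlp i σ τ = cavOvlp i τ σ := by
  unfold cavOvlp
  simp_rw [mul_comm (spin (σ _))]

lemma cavOvlp_flip_right (σ τ : Config N) : cavOvlp i σ (flip i τ) = cavOvlp i σ τ := by
  rw [cavOvlp_comm, cavOvlp_flip_left, cavOvlp_comm]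

lemma cavOvlp_eq (σ τ : Config N) :
    cavOvlp i σ τ = ovlp N σ τ - spin (σ i) * spin (τ i) / N := by
  unfold cavOvlp ovlp
  rw [← sub_div]
  congr 1
  rw [← Finset.add_sum_erase _ _ (Finset.mem_univ i)]
  rw [← Finset.add_sum_erase _ (fun j => spin (σ j) * spin (τ j)) (Finset.mem_univ i)]
  simp only [if_true]
  rw [zero_add, add_sub_cancel_left]
  exact Finset.sum_congr rfl fun j hj => if_neg (Finset.ne_of_mem_erase hj)

lemma abs_cavOvlp_le_one (σ τ : Config N) : |cavOvlp i σ τ| ≤ 1 := by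
  have hN : (0:ℝ) < N := by exact_mod_cast i.pos
  unfold cavOvlp
  rw [abs_div, Nat.abs_cast, div_le_one hN]
  calc _ ≤ ∑ j, |if j = i then 0 else spin (σ j) * spin (τ j)| := Finset.abs_sum_le_sum_abs _ _
    _ ≤ ∑ _j : Fin N, 1 := by
        refine Finset.sum_le_sum fun j _ => ?_
        split_ifs
        · simp
        · rw [abs_mul, abs_spin, abs_spin, one_mul]
    _ = N := by simp

lemma cavOvlp_self (σ : Config N) : cavOvlp i σ σ = 1 - 1 / N := by
  rw [cavOvlp_eq, ovlp_self N i.pos, spin_mul_self]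

lemma attH_dot (σ τ : Config N) :
    attH β i σ ⬝ᵥ attH β i τ = β ^ 2 * (spin (σ i) * spin (τ i)) * cavOvlp i σ τ := by
  have hN : (0:ℝ) < N := by exact_mod_cast i.pos
  have hsq : (β / √N) * (β / √N) = β ^ 2 / N := by
    rw [div_mul_div_comm, Real.mul_self_sqrt hN.le, sq]
  set x : Fin N → ℝ := fun j => spin (σ j) * spin (τ j) with hx
  have e : ∀ p : Fin N × Fin N, attH β i σ p * attH β i τ p
      = β ^ 2 / N * ((if p.1 = i then (if i < p.2 then x i * x p.2 else 0) else 0) +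
        (if p.2 = i then (if p.1 < i then x i * x p.1 else 0) else 0)) := by
    rintro ⟨p, q⟩
    simp only [attH, hv, touch]
    by_cases hp : p = i <;> by_cases hq : q = i
    · simp [hp, hq]
    · subst hp
      by_cases h : p < q
      · simp only [true_or, h, if_true, hq, if_false, add_zero, ← hsq, hx]; ring
      · simp [h, hq]
    · subst hq
      by_cases h : p < q
      · simp only [or_true, h, if_true, hp, if_false, zero_add, ← hsq, hx]; ring
      · simp [h, hp]
    · simp [hp, hq]
  rw [dotProduct, Finset.sum_congr rfl fun p _ => e p, ← Finset.mul_sum, Finset.sum_add_distrib]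
  have e1 : ∑ p : Fin N × Fin N, (if p.1 = i then (if i < p.2 then x i * x p.2 else 0) else 0)
      = ∑ j, if i < j then x i * x j else 0 := by
    rw [Fintype.sum_prod_type, Finset.sum_comm]
    simp
  have e2 : ∑ p : Fin N × Fin N, (if p.2 = i then (if p.1 < i then x i * x p.1 else 0) else 0)
      = ∑ j, if j < i then x i * x j else 0 := by
    rw [Fintype.sum_prod_type]
    simp
  rw [e1, e2, ← Finset.sum_add_distrib]
  have e3 : ∀ j, (if i < j then x i * x j else 0) + (if j < i then x i * x j else 0)
      = x i * (if j = i then 0 else x j) := by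
    intro j
    rcases lt_trichotomy i j with h | h | h
    · simp [h, h.not_gt, h.ne']
    · simp [h]
    · simp [h, h.not_gt, h.ne]
  simp_rw [e3, ← Finset.mul_sum]
  unfold cavOvlp
  field_simp
  simp only [hx]
  ring

lemma wt_mix (x y : Fin N × Fin N → ℝ) (σ : Config N) :
    wt (hv N β) (mix (touch i) (x, y)) σ
      = wt (offH β i) x σ * exp (attH β i σ ⬝ᵥ y) /
        ∑ τ, wt (offH β i) x τ * exp (attH β i τ ⬝ᵥ y) := by
  have h : ∀ τ, exp (hv N β τ ⬝ᵥ mix (touch i) (x, y))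
      = Zf (offH β i) x * (wt (offH β i) x τ * exp (attH β i τ ⬝ᵥ y)) := by
    intro τ
    rw [dot_mix, exp_add, wt, ← mul_assoc, mul_div_cancel₀ _ (Zf_pos _ _).ne']
    rfl
  unfold wt at *
  rw [Zf]
  simp_rw [h]
  rw [← Finset.mul_sum, mul_div_mul_left _ _ (Zf_pos _ _).ne']

/-- First rotation coefficient of the system `l`. -/
def coefA (a : ℝ) (l : Bool) : ℝ := if l then a else 1

/-- Second rotation coefficient of the system `l`. -/
def coefB (b : ℝ) (l : Bool) : ℝ := if l then b else 0

/-- Covariance vector of the field at the site `i` in the system `l`. -/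
def cavW (a b : ℝ) (l : Bool) (σ : Config N) : (Fin N × Fin N) ⊕ (Fin N × Fin N) → ℝ :=
  Sum.elim (coefA a l • attH β i σ) (coefB b l • attH β i σ)

lemma cavW_dot (a b : ℝ) (l : Bool) (σ : Config N)
    (y : (Fin N × Fin N) ⊕ (Fin N × Fin N) → ℝ) :
    cavW β i a b l σ ⬝ᵥ y = attH β i σ ⬝ᵥ pr₂ (coefA a l) (coefB b l) y := by
  simp only [dotProduct, cavW, pr₂, Fintype.sum_sum_type, Sum.elim_inl, Sum.elim_inr,
    Pi.smul_apply, smul_eq_mul, ← Finset.sum_add_distrib]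
  exact Finset.sum_congr rfl fun p _ => by ring

lemma cavW_dot_cavW (a b : ℝ) (l m : Bool) (σ τ : Config N) :
    cavW β i a b l σ ⬝ᵥ cavW β i a b m τ = (coefA a l * coefA a m + coefB b l * coefB b m) *
      (β ^ 2 * (spin (σ i) * spin (τ i)) * cavOvlp i σ τ) := by
  rw [← attH_dot]
  simp only [dotProduct, cavW, Fintype.sum_sum_type, Sum.elim_inl, Sum.elim_inr,
    Pi.smul_apply, smul_eq_mul, ← Finset.sum_add_distrib, Finset.mul_sum]
  exact Finset.sum_congr rfl fun p _ => by ring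

lemma cavW_flip (a b : ℝ) (l : Bool) (σ : Config N) :
    cavW β i a b l (flip i σ) = -cavW β i a b l σ := by
  ext q
  rcases q with q | q <;> simp [cavW, attH_flip]

lemma gauge_dot (a b : ℝ) (l m : Bool) (σ τ : Config N) :
    (spin (σ i) • cavW β i a b l σ) ⬝ᵥ (spin (τ i) • cavW β i a b m τ)
      = (coefA a l * coefA a m + coefB b l * coefB b m) * (β ^ 2 * cavOvlp i σ τ) := by
  rw [smul_dotProduct, dotProduct_smul, cavW_dot_cavW]
  simp only [smul_eq_mul]
  linear_combination (coefA a l * coefA a m + coefB b l * coefB b m) * (β ^ 2 * cavOvlp i σ τ) *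
    (spin (τ i) * spin (τ i) * spin_mul_self (σ i) + spin_mul_self (τ i))

lemma coef_same {a b : ℝ} (hab : a ^ 2 + b ^ 2 = 1) (l : Bool) :
    coefA a l * coefA a l + coefB b l * coefB b l = 1 := by
  cases l
  · simp [coefA, coefB]
  · simp only [coefA, coefB, if_true]; linarith

lemma coef_abs_le {a b : ℝ} (hab : a ^ 2 + b ^ 2 = 1) (l m : Bool) :
    |coefA a l * coefA a m + coefB b l * coefB b m| ≤ 1 := by
  have h1 := coef_same hab l
  have h2 := coef_same hab m
  rw [abs_le]
  constructor <;> nlinarith [sq_nonneg (coefA a l + coefA a m), sq_nonneg (coefB b l + coefB b m),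
    sq_nonneg (coefA a l - coefA a m), sq_nonneg (coefB b l - coefB b m)]

/-- The pair of coupled systems without the site `i`. -/
def cavSys {a b : ℝ} (hab : a ^ 2 + b ^ 2 = 1) (hβ : β ^ 2 ≤ 1)
    (x : (Fin N × Fin N) ⊕ (Fin N × Fin N) → ℝ) :
    CavSys (Config N) ((Fin N × Fin N) ⊕ (Fin N × Fin N)) where
  μ l σ := wt (offH β i) (pr₂ (coefA a l) (coefB b l) x) σ
  u l σ := spin (σ i) • cavW β i a b l σ
  ρ σ τ := |cavOvlp i σ τ|
  μ_nonneg l σ := wt_nonneg _ _ _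
  sum_μ l := sum_wt _ _
  u_self l σ := by
    rw [gauge_dot, coef_same hab, cavOvlp_self, one_mul]
    have : (0:ℝ) ≤ 1 / N := by positivity
    nlinarith [sq_nonneg β]
  dot_le l m σ τ := by
    rw [gauge_dot, abs_mul, abs_mul, abs_of_nonneg (sq_nonneg β)]
    calc _ ≤ 1 * (1 * |cavOvlp i σ τ|) := by
          gcongr
          exact coef_abs_le hab l m
      _ = _ := by ring
  ρ_le σ τ := abs_cavOvlp_le_one i σ τ
  ρ_comm σ τ := by rw [cavOvlp_comm]

end SKCavity

section CavityIdentities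

variable {N : ℕ} (β : ℝ) (i : Fin N)

lemma sum_flip (h : Config N → ℝ) : ∑ σ, h σ = ∑ σ, 1 / 2 * (h σ + h (flip i σ)) := by
  have e : ∑ σ, h (flip i σ) = ∑ σ, h σ := (flipEquiv i).sum_comp h
  rw [← Finset.mul_sum, Finset.sum_add_distrib, e]; ring

variable {a b : ℝ} (hab : a ^ 2 + b ^ 2 = 1) (hβ : β ^ 2 ≤ 1)
  (x : (Fin N × Fin N) ⊕ (Fin N × Fin N) → ℝ)

lemma cavSys_μ_flip (l : Bool) (σ : Config N) :
    (cavSys β i hab hβ x).μ l (flip i σ) = (cavSys β i hab hβ x).μ l σ := by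
  simp only [cavSys, wt, offH_flip]

lemma cavSys_u_self (l : Bool) (σ : Config N) :
    (cavSys β i hab hβ x).u l σ ⬝ᵥ (cavSys β i hab hβ x).u l σ = β ^ 2 * (1 - 1 / N) := by
  simp only [cavSys]
  rw [gauge_dot, coef_same hab, cavOvlp_self, one_mul]

lemma cavSys_u_dot (l : Bool) (σ : Config N) (y : (Fin N × Fin N) ⊕ (Fin N × Fin N) → ℝ) :
    (cavSys β i hab hβ x).u l σ ⬝ᵥ y = spin (σ i) * (cavW β i a b l σ ⬝ᵥ y) := by
  simp only [cavSys, smul_dotProduct, smul_eq_mul]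

/-- The reciprocal of the normalisation of the hyperbolic functions of the cavity fields. -/
def cavNorm (N : ℕ) (β : ℝ) : ℝ := exp (β ^ 2 * (1 - 1 / N) / 2)

lemma sum_exp_Ch (l : Bool) (y : (Fin N × Fin N) ⊕ (Fin N × Fin N) → ℝ) {g : Config N → ℝ}
    (hg : ∀ σ, g (flip i σ) = g σ) :
    ∑ σ, (cavSys β i hab hβ x).μ l σ * exp (cavW β i a b l σ ⬝ᵥ y) * g σ
      = cavNorm N β * (cavSys β i hab hβ x).av l
        (fun σ => Ch ((cavSys β i hab hβ x).u l σ) y * g σ) := by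
  rw [sum_flip i, CavSys.av, Finset.mul_sum]
  refine Finset.sum_congr rfl fun σ _ => ?_
  rw [Ch_eq, cavSys_u_self, cavSys_μ_flip, hg, cavW_flip, neg_dotProduct, cavSys_u_dot, exp_neg
    (β ^ 2 * (1 - 1 / N) / 2), cavNorm]
  have h : cosh (spin (σ i) * (cavW β i a b l σ ⬝ᵥ y)) = cosh (cavW β i a b l σ ⬝ᵥ y) := by
    unfold spin; split_ifs <;> simp
  rw [h, cosh_eq]
  have := (exp_pos (β ^ 2 * (1 - 1 / (N:ℝ)) / 2)).ne'
  field_simp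

lemma sum_exp_Sh (l : Bool) (y : (Fin N × Fin N) ⊕ (Fin N × Fin N) → ℝ) {g : Config N → ℝ}
    (hg : ∀ σ, g (flip i σ) = g σ) :
    ∑ σ, (cavSys β i hab hβ x).μ l σ * exp (cavW β i a b l σ ⬝ᵥ y) * (spin (σ i) * g σ)
      = cavNorm N β * (cavSys β i hab hβ x).av l
        (fun σ => Sh ((cavSys β i hab hβ x).u l σ) y * g σ) := by
  rw [sum_flip i, CavSys.av, Finset.mul_sum]
  refine Finset.sum_congr rfl fun σ _ => ?_
  rw [Sh_eq, cavSys_u_self, cavSys_μ_flip, hg, cavW_flip, neg_dotProduct, cavSys_u_dot, exp_neg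
    (β ^ 2 * (1 - 1 / N) / 2), cavNorm, spin_flip_self]
  have h : sinh (spin (σ i) * (cavW β i a b l σ ⬝ᵥ y))
      = spin (σ i) * sinh (cavW β i a b l σ ⬝ᵥ y) := by
    unfold spin; split_ifs <;> simp
  rw [h, sinh_eq]
  have := (exp_pos (β ^ 2 * (1 - 1 / (N:ℝ)) / 2)).ne'
  field_simp
  ring

lemma cavNorm_pos : 0 < cavNorm N β := exp_pos _

lemma wt_cavSys (l : Bool) (y : (Fin N × Fin N) ⊕ (Fin N × Fin N) → ℝ) (σ : Config N) :
    wt (hv N β) (pr₂ (coefA a l) (coefB b l) (mix (touch₂ i) (x, y))) σ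
      = (cavSys β i hab hβ x).μ l σ * exp (cavW β i a b l σ ⬝ᵥ y) /
        (cavNorm N β * (cavSys β i hab hβ x).Z l y) := by
  rw [pr₂_mix, wt_mix]
  have h := sum_exp_Ch β i hab hβ x l y (g := fun _ => 1) fun _ => rfl
  simp only [mul_one] at h
  rw [CavSys.Z, ← h]
  simp_rw [cavW_dot]
  rfl

lemma cpl_mix_cavSys {ε : Config N → ℝ}
    {ψ : ((Fin N × Fin N) ⊕ (Fin N × Fin N) → ℝ) → ((Fin N × Fin N) ⊕ (Fin N × Fin N) → ℝ) → ℝ}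
    (y : (Fin N × Fin N) ⊕ (Fin N × Fin N) → ℝ)
    (h : ∀ (l : Bool) (g : Config N → ℝ), (∀ σ, g (flip i σ) = g σ) →
      ∑ σ, (cavSys β i hab hβ x).μ l σ * exp (cavW β i a b l σ ⬝ᵥ y) * (ε σ * g σ)
        = cavNorm N β * (cavSys β i hab hβ x).av l
          (fun σ => ψ ((cavSys β i hab hβ x).u l σ) y * g σ))
    {F : Config N → Config N → ℝ} (h1 : ∀ σ τ, F (flip i σ) τ = F σ τ)
    (h2 : ∀ σ τ, F σ (flip i τ) = F σ τ) :
    cpl (hv N β) a b (fun σ τ => ε σ * ε τ * F σ τ) (mix (touch₂ i) (x, y))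
      = (cavSys β i hab hβ x).av₂ false true (fun σ τ => F σ τ *
          (ψ ((cavSys β i hab hβ x).u false σ) y * ψ ((cavSys β i hab hβ x).u true τ) y)) *
        ((cavSys β i hab hβ x).Z false y * (cavSys β i hab hβ x).Z true y)⁻¹ := by
  set s := cavSys β i hab hβ x with hs
  have hf : ∀ σ, wt (hv N β) (pr₁ (mix (touch₂ i) (x, y))) σ
      = s.μ false σ * exp (cavW β i a b false σ ⬝ᵥ y) / (cavNorm N β * s.Z false y) := by
    intro σ
    rw [← pr₂_one_zero]
    exact wt_cavSys β i hab hβ x false y σ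
  have ht : ∀ σ, wt (hv N β) (pr₂ a b (mix (touch₂ i) (x, y))) σ
      = s.μ true σ * exp (cavW β i a b true σ ⬝ᵥ y) / (cavNorm N β * s.Z true y) :=
    fun σ => wt_cavSys β i hab hβ x true y σ
  have hc := (cavNorm_pos (N := N) β).ne'
  have z1 := (s.Z_pos false y).ne'
  have z2 := (s.Z_pos true y).ne'
  unfold cpl
  simp_rw [hf, ht]
  have e1 : ∀ σ, ∑ τ, s.μ true τ * exp (cavW β i a b true τ ⬝ᵥ y) * (ε τ * F σ τ)
      = cavNorm N β * s.av true (fun τ => ψ (s.u true τ) y * F σ τ) := fun σ => h true _ (h2 σ)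
  have e2 : ∑ σ, s.μ false σ * exp (cavW β i a b false σ ⬝ᵥ y) *
      (ε σ * s.av true (fun τ => ψ (s.u true τ) y * F σ τ))
      = cavNorm N β * s.av false (fun σ => ψ (s.u false σ) y *
        s.av true (fun τ => ψ (s.u true τ) y * F σ τ)) := by
    refine h false _ fun σ => ?_
    simp_rw [h1]
  calc _ = (∑ σ, s.μ false σ * exp (cavW β i a b false σ ⬝ᵥ y) * (ε σ *
        ∑ τ, s.μ true τ * exp (cavW β i a b true τ ⬝ᵥ y) * (ε τ * F σ τ))) *
          ((cavNorm N β * s.Z false y) * (cavNorm N β * s.Z true y))⁻¹ := by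
        rw [Finset.sum_mul]
        refine Finset.sum_congr rfl fun σ _ => ?_
        rw [Finset.mul_sum, Finset.mul_sum, Finset.sum_mul]
        refine Finset.sum_congr rfl fun τ _ => ?_
        field_simp
    _ = (cavNorm N β * ∑ σ, s.μ false σ * exp (cavW β i a b false σ ⬝ᵥ y) *
      (ε σ * s.av true (fun τ => ψ (s.u true τ) y * F σ τ))) *
          ((cavNorm N β * s.Z false y) * (cavNorm N β * s.Z true y))⁻¹ := by
        congr 1
        rw [Finset.mul_sum]
        refine Finset.sum_congr rfl fun σ _ => ?_
        rw [e1]; ring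
    _ = _ := by
        rw [e2, CavSys.av₂]
        have e3 : s.av false (fun σ => s.av true (fun τ => F σ τ *
            (ψ (s.u false σ) y * ψ (s.u true τ) y))) = s.av false (fun σ => ψ (s.u false σ) y *
              s.av true (fun τ => ψ (s.u true τ) y * F σ τ)) := by
          congr 1; ext σ
          rw [← s.av_mul_left]
          congr 1; ext τ; ring
        rw [e3]
        field_simp

lemma integrable_integral_cpl_mix (a b : ℝ) (F : Config N → Config N → ℝ) :
    Integrable (fun x => ∫ y, cpl (hv N β) a b F (mix (touch₂ i) (x, y)) ∂stdG _)
      (stdG ((Fin N × Fin N) ⊕ (Fin N × Fin N))) :=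
  ((measurePreserving_mix (touch₂ i)).integrable_comp_of_integrable
    (integrable_cpl (hv N β) a b F)).integral_prod_left

section Expectation

variable {F : Config N → Config N → ℝ}

lemma tilt_Ch_eq (h1 : ∀ σ τ, F (flip i σ) τ = F σ τ)
    (h2 : ∀ σ τ, F σ (flip i τ) = F σ τ) :
    (cavSys β i hab hβ x).tilt Ch F
    = ∫ y, cpl (hv N β) a b F (mix (touch₂ i) (x, y)) ∂stdG _ := by
  rw [CavSys.tilt]
  refine integral_congr_ae (ae_of_all _ fun y => ?_)
  have h := cpl_mix_cavSys β i hab hβ x (ε := fun _ => 1) (ψ := Ch) y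
    (fun l g hg => by simpa using sum_exp_Ch β i hab hβ x l y hg) h1 h2
  simp only [one_mul] at h
  exact h.symm

lemma tilt_Sh_eq (h1 : ∀ σ τ, F (flip i σ) τ = F σ τ)
    (h2 : ∀ σ τ, F σ (flip i τ) = F σ τ) :
    (cavSys β i hab hβ x).tilt Sh F
    = ∫ y, cpl (hv N β) a b (fun σ τ => spin (σ i) * spin (τ i) * F σ τ)
      (mix (touch₂ i) (x, y)) ∂stdG _ := by
  rw [CavSys.tilt]
  refine integral_congr_ae (ae_of_all _ fun y => ?_)
  exact (cpl_mix_cavSys β i hab hβ x (ε := fun σ => spin (σ i)) (ψ := Sh) y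
    (fun l g hg => sum_exp_Sh β i hab hβ x l y hg) h1 h2).symm

lemma integrable_tilt_Ch (h1 : ∀ σ τ, F (flip i σ) τ = F σ τ)
    (h2 : ∀ σ τ, F σ (flip i τ) = F σ τ) :
    Integrable (fun x => (cavSys β i hab hβ x).tilt Ch F) (stdG _) := by
  simp_rw [fun x => tilt_Ch_eq β i hab hβ x h1 h2]
  exact integrable_integral_cpl_mix β i a b F

lemma integrable_tilt_Sh (h1 : ∀ σ τ, F (flip i σ) τ = F σ τ)
    (h2 : ∀ σ τ, F σ (flip i τ) = F σ τ) :
    Integrable (fun x => (cavSys β i hab hβ x).tilt Sh F) (stdG _) := by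
  simp_rw [fun x => tilt_Sh_eq β i hab hβ x h1 h2]
  exact integrable_integral_cpl_mix β i a b _

lemma integral_tilt_Ch (h1 : ∀ σ τ, F (flip i σ) τ = F σ τ)
    (h2 : ∀ σ τ, F σ (flip i τ) = F σ τ) :
    ∫ x, (cavSys β i hab hβ x).tilt Ch F ∂stdG _ = Ecpl (hv N β) a b F := by
  simp_rw [fun x => tilt_Ch_eq β i hab hβ x h1 h2]
  exact (integral_stdG_mix _ (integrable_cpl (hv N β) a b F)).symm

lemma integral_tilt_Sh (h1 : ∀ σ τ, F (flip i σ) τ = F σ τ)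
    (h2 : ∀ σ τ, F σ (flip i τ) = F σ τ) :
    ∫ x, (cavSys β i hab hβ x).tilt Sh F ∂stdG _
    = Ecpl (hv N β) a b (fun σ τ => spin (σ i) * spin (τ i) * F σ τ) := by
  simp_rw [fun x => tilt_Sh_eq β i hab hβ x h1 h2]
  exact (integral_stdG_mix _ (integrable_cpl (hv N β) a b _)).symm

end Expectation

end CavityIdentities

section CavityMoments

variable {N : ℕ} (β : ℝ) (i : Fin N)

lemma sum_sum_cavOvlp_pow_nonneg (c : Config N → ℝ) (m : ℕ) :
    0 ≤ ∑ σ, ∑ τ, c σ * c τ * cavOvlp i σ τ ^ m := by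
  have h := sum_sum_gram_pow_nonneg (fun (σ : Config N) j => if j = i then 0 else spin (σ j)) c m
  have e : ∀ σ τ : Config N, c σ * c τ * cavOvlp i σ τ ^ m = ((N:ℝ) ^ m)⁻¹ *
      (c σ * c τ * (∑ j, (if j = i then 0 else spin (σ j)) * (if j = i then 0 else spin (τ j))) ^ m) := by
    intro σ τ
    have e1 : ∑ j, (if j = i then 0 else spin (σ j)) * (if j = i then 0 else spin (τ j))
        = ∑ j, if j = i then 0 else spin (σ j) * spin (τ j) :=
      Finset.sum_congr rfl fun j _ => by split_ifs <;> simp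
    rw [e1, cavOvlp, div_pow, div_eq_mul_inv]; ring
  simp_rw [e, ← Finset.mul_sum]
  positivity

variable {a b : ℝ} (hab : a ^ 2 + b ^ 2 = 1) (hβ : β ^ 2 ≤ 1)

lemma continuous_av {l : Bool} {G : ((Fin N × Fin N) ⊕ (Fin N × Fin N) → ℝ) → Config N → ℝ}
    (hG : ∀ σ, Continuous fun x => G x σ) :
    Continuous fun x => (cavSys β i hab hβ x).av l (G x) := by
  unfold CavSys.av
  refine continuous_finsetSum _ fun σ _ => Continuous.mul ?_ (hG σ)
  exact (continuous_wt (offH β i) σ).comp (continuous_pr₂ _ _)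

lemma continuous_av₂ {l m : Bool}
    {G : ((Fin N × Fin N) ⊕ (Fin N × Fin N) → ℝ) → Config N → Config N → ℝ}
    (hG : ∀ σ τ, Continuous fun x => G x σ τ) :
    Continuous fun x => (cavSys β i hab hβ x).av₂ l m (G x) :=
  continuous_av β i hab hβ fun σ => continuous_av β i hab hβ fun τ => hG σ τ

lemma integrable_av₂ (l m : Bool) (F : Config N → Config N → ℝ) :
    Integrable (fun x => (cavSys β i hab hβ x).av₂ l m F) (stdG _) := by
  obtain ⟨M, -, hM⟩ := exists_bound F
  have hc : Continuous fun x => (cavSys β i hab hβ x).av₂ l m F :=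
    continuous_av₂ β i hab hβ (G := fun _ => F) fun σ τ => continuous_const
  refine integrable_of_bounded hc.measurable M fun x => ?_
  calc _ ≤ (cavSys β i hab hβ x).av₂ l m (fun σ τ => |F σ τ|) := CavSys.abs_av₂_le _ l m F
    _ ≤ (cavSys β i hab hβ x).av₂ l m (fun _ _ => M) := CavSys.av₂_mono _ hM
    _ = M := CavSys.av₂_const _ _ _ _

lemma integrable_mom (m : ℕ) :
    Integrable (fun x => (cavSys β i hab hβ x).mom m) (stdG _) := by
  unfold CavSys.mom
  exact integrable_finsetSum _ fun k _ => integrable_finsetSum _ fun l _ =>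
    integrable_av₂ β i hab hβ k l fun σ τ => |cavOvlp i σ τ| ^ m

/-- Expected two-replica average for the system without the site `i`. -/
def offAv (F : Config N → Config N → ℝ) : ℝ :=
  ∫ g, ∑ σ, ∑ τ, wt (offH β i) g σ * wt (offH β i) g τ * F σ τ ∂stdG (Fin N × Fin N)

lemma integral_av₂_of_same {l m : Bool} (hA : coefA a l = coefA a m) (hB : coefB b l = coefB b m)
    (F : Config N → Config N → ℝ) :
    ∫ x, (cavSys β i hab hβ x).av₂ l m F ∂stdG _ = offAv β i F := by
  have hc : Continuous fun g => ∑ σ, ∑ τ, wt (offH β i) g σ * wt (offH β i) g τ * F σ τ :=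
    continuous_finsetSum _ fun σ _ => continuous_finsetSum _ fun τ _ =>
      ((continuous_wt _ σ).mul (continuous_wt _ τ)).mul continuous_const
  have hmp := measurePreserving_pr₂ (ι := Fin N × Fin N) (a := coefA a l) (b := coefB b l)
    (by have := coef_same hab l; nlinarith)
  rw [offAv, ← integral_comp_of_mp hmp hc.aestronglyMeasurable]
  refine integral_congr_ae (ae_of_all _ fun x => ?_)
  simp only [CavSys.av₂, CavSys.av, Finset.mul_sum]
  refine Finset.sum_congr rfl fun σ _ => Finset.sum_congr rfl fun τ _ => ?_
  simp only [cavSys, ← hA, ← hB]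
  ring

lemma av₂_cavOvlp_le (x : (Fin N × Fin N) ⊕ (Fin N × Fin N) → ℝ) (l k : Bool) (m : ℕ) :
    (cavSys β i hab hβ x).av₂ l k (fun σ τ => cavOvlp i σ τ ^ m)
      ≤ 1 / 2 * ((cavSys β i hab hβ x).av₂ l l (fun σ τ => cavOvlp i σ τ ^ m) +
        (cavSys β i hab hβ x).av₂ k k (fun σ τ => cavOvlp i σ τ ^ m)) := by
  set s := cavSys β i hab hβ x
  have h := sum_sum_cavOvlp_pow_nonneg i (fun σ => s.μ l σ - s.μ k σ) m
  have e : ∀ p q : Bool, s.av₂ p q (fun σ τ => cavOvlp i σ τ ^ m)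
      = ∑ σ, ∑ τ, s.μ p σ * s.μ q τ * cavOvlp i σ τ ^ m := by
    intro p q
    simp only [CavSys.av₂, CavSys.av, Finset.mul_sum, mul_assoc]
  have e1 : ∑ σ, ∑ τ, s.μ k σ * s.μ l τ * cavOvlp i σ τ ^ m
      = ∑ σ, ∑ τ, s.μ l σ * s.μ k τ * cavOvlp i σ τ ^ m := by
    rw [Finset.sum_comm]
    refine Finset.sum_congr rfl fun σ _ => Finset.sum_congr rfl fun τ _ => ?_
    rw [cavOvlp_comm]; ring
  have e2 : ∑ σ, ∑ τ, (s.μ l σ - s.μ k σ) * (s.μ l τ - s.μ k τ) * cavOvlp i σ τ ^ m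
      = (∑ σ, ∑ τ, s.μ l σ * s.μ l τ * cavOvlp i σ τ ^ m
        - ∑ σ, ∑ τ, s.μ l σ * s.μ k τ * cavOvlp i σ τ ^ m)
        - (∑ σ, ∑ τ, s.μ k σ * s.μ l τ * cavOvlp i σ τ ^ m
        - ∑ σ, ∑ τ, s.μ k σ * s.μ k τ * cavOvlp i σ τ ^ m) := by
    simp only [← Finset.sum_sub_distrib]
    exact Finset.sum_congr rfl fun σ _ => Finset.sum_congr rfl fun τ _ => by ring
  rw [e2, e1] at h
  rw [e, e, e]
  linarith

lemma offAv_cavOvlp_le (hβ : β ^ 2 ≤ 1) {m : ℕ} (hm : Even m) :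
    offAv β i (fun σ τ => cavOvlp i σ τ ^ m)
      ≤ 4 * (1 + tayC) * Ecpl (hv N β) 1 0 (fun σ τ => cavOvlp i σ τ ^ m) := by
  have h10 : (1:ℝ) ^ 2 + 0 ^ 2 = 1 := by norm_num
  have h1 : ∀ σ τ : Config N, cavOvlp i (flip i σ) τ ^ m = cavOvlp i σ τ ^ m := fun σ τ => by
    rw [cavOvlp_flip_left]
  have h2 : ∀ σ τ : Config N, cavOvlp i σ (flip i τ) ^ m = cavOvlp i σ τ ^ m := fun σ τ => by
    rw [cavOvlp_flip_right]
  rw [← integral_av₂_of_same β i h10 hβ (l := false) (m := true) (by simp [coefA])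
    (by simp [coefB]), ← integral_tilt_Ch β i h10 hβ h1 h2, ← integral_const_mul]
  exact integral_mono (integrable_av₂ β i h10 hβ _ _ _)
    ((integrable_tilt_Ch β i h10 hβ h1 h2).const_mul _)
    fun x => CavSys.av₂_le_tilt_Ch _ fun σ τ => hm.pow_nonneg _

lemma integral_mom_le {m : ℕ} (hm : Even m) :
    ∫ x, (cavSys β i hab hβ x).mom m ∂stdG _
      ≤ 16 * (1 + tayC) * Ecpl (hv N β) 1 0 (fun σ τ => cavOvlp i σ τ ^ m) := by
  have hI : ∀ l k, ∫ x, (cavSys β i hab hβ x).av₂ l k (fun σ τ => cavOvlp i σ τ ^ m) ∂stdG _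
      ≤ offAv β i (fun σ τ => cavOvlp i σ τ ^ m) := by
    intro l k
    have h := integral_mono (integrable_av₂ β i hab hβ l k fun σ τ => cavOvlp i σ τ ^ m)
      (((integrable_av₂ β i hab hβ l l fun σ τ => cavOvlp i σ τ ^ m).add
        (integrable_av₂ β i hab hβ k k fun σ τ => cavOvlp i σ τ ^ m)).const_mul (1 / 2))
      fun x => av₂_cavOvlp_le β i hab hβ x l k m
    simp only [Pi.add_apply] at h
    rw [integral_const_mul, integral_add (integrable_av₂ β i hab hβ l l _)
      (integrable_av₂ β i hab hβ k k _), integral_av₂_of_same β i hab hβ rfl rfl,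
      integral_av₂_of_same β i hab hβ rfl rfl] at h
    linarith
  have e : ∀ x, (cavSys β i hab hβ x).mom m
      = ∑ l, ∑ k, (cavSys β i hab hβ x).av₂ l k (fun σ τ => cavOvlp i σ τ ^ m) := by
    intro x
    unfold CavSys.mom
    simp only [cavSys, hm.pow_abs]
  simp_rw [e]
  rw [integral_finsetSum _ fun l _ => integrable_finsetSum _ fun k _ =>
    integrable_av₂ β i hab hβ l k _]
  simp_rw [fun l => integral_finsetSum (μ := stdG ((Fin N × Fin N) ⊕ (Fin N × Fin N))) Finset.univ
    fun k _ => integrable_av₂ β i hab hβ l k fun σ τ => cavOvlp i σ τ ^ m]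
  calc _ ≤ ∑ _l : Bool, ∑ _k : Bool, offAv β i (fun σ τ => cavOvlp i σ τ ^ m) :=
        Finset.sum_le_sum fun l _ => Finset.sum_le_sum fun k _ => hI l k
    _ = 4 * offAv β i (fun σ τ => cavOvlp i σ τ ^ m) := by simp; ring
    _ ≤ _ := by linarith [offAv_cavOvlp_le β i hβ hm]

end CavityMoments

section CavityInequalities

lemma mul_mul_le_of_pos {θ : ℝ} (hθ : 0 < θ) (x y z : ℝ) :
    |x * y * z| ≤ θ / 2 * x ^ 2 + θ⁻¹ / 4 * (y ^ 4 + z ^ 4) := by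
  have h1 : |x * (y * z)| ≤ θ / 2 * x ^ 2 + θ⁻¹ / 2 * (y * z) ^ 2 := by
    have e : θ / 2 * x ^ 2 + θ⁻¹ / 2 * (y * z) ^ 2 - |x * (y * z)|
        = θ / 2 * (|x| - θ⁻¹ * |y * z|) ^ 2 := by
      rw [abs_mul, ← sq_abs x, ← sq_abs (y * z)]
      field_simp
      ring
    have : 0 ≤ θ / 2 * (|x| - θ⁻¹ * |y * z|) ^ 2 := by positivity
    linarith
  have h2 : (y * z) ^ 2 ≤ (y ^ 4 + z ^ 4) / 2 := by nlinarith [sq_nonneg (y ^ 2 - z ^ 2)]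
  rw [mul_assoc]
  have : 0 ≤ θ⁻¹ := by positivity
  nlinarith

variable {N : ℕ} (β : ℝ) (i : Fin N)

/-- Constant of the cavity inequalities. -/
def cavK : ℝ := 16 * (1 + tayC) * (1 + 2028 * tayC)

lemma cavK_pos : 0 < cavK := by have := tayC_pos; unfold cavK; positivity

lemma abs_av₄_triple_le {a b : ℝ} (hab : a ^ 2 + b ^ 2 = 1) (hβ : β ^ 2 ≤ 1)
    (x : (Fin N × Fin N) ⊕ (Fin N × Fin N) → ℝ) (l : Bool) {θ : ℝ} (hθ : 0 < θ) :
    |(cavSys β i hab hβ x).av₄ false true l l (fun σ τ c _ => cavOvlp i σ τ *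
      (((cavSys β i hab hβ x).u false σ ⬝ᵥ (cavSys β i hab hβ x).u l c) *
       ((cavSys β i hab hβ x).u true τ ⬝ᵥ (cavSys β i hab hβ x).u l c)))|
    ≤ θ / 2 * (cavSys β i hab hβ x).av₂ false true (fun σ τ => cavOvlp i σ τ ^ 2)
      + θ⁻¹ / 2 * (cavSys β i hab hβ x).mom 4 := by
  set s := cavSys β i hab hβ x with hs
  have hρ : ∀ σ τ, s.ρ σ τ = |cavOvlp i σ τ| := fun σ τ => rfl
  have hpt : ∀ σ τ c : Config N, |cavOvlp i σ τ * ((s.u false σ ⬝ᵥ s.u l c) * (s.u true τ ⬝ᵥ s.u l c))|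
      ≤ θ / 2 * cavOvlp i σ τ ^ 2 + (θ⁻¹ / 4 * s.ρ σ c ^ 4 + θ⁻¹ / 4 * s.ρ τ c ^ 4) := by
    intro σ τ c
    have h := mul_mul_le_of_pos hθ (cavOvlp i σ τ) (s.ρ σ c) (s.ρ τ c)
    rw [abs_mul, abs_mul, ← mul_assoc]
    rw [abs_mul, abs_mul, abs_of_nonneg (s.ρ_nonneg σ c), abs_of_nonneg (s.ρ_nonneg τ c)] at h
    calc _ ≤ |cavOvlp i σ τ| * s.ρ σ c * s.ρ τ c := by
          gcongr
          · exact mul_nonneg (abs_nonneg _) (s.ρ_nonneg σ c)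
          · exact s.dot_le _ _ _ _
          · exact s.dot_le _ _ _ _
      _ ≤ _ := by linarith
  have e1 : s.av₄ false true l l (fun σ τ c _ => θ / 2 * cavOvlp i σ τ ^ 2 +
      (θ⁻¹ / 4 * s.ρ σ c ^ 4 + θ⁻¹ / 4 * s.ρ τ c ^ 4))
      = θ / 2 * s.av₂ false true (fun σ τ => cavOvlp i σ τ ^ 2) +
        (θ⁻¹ / 4 * s.av₂ false l (fun σ τ => s.ρ σ τ ^ 4)
        + θ⁻¹ / 4 * s.av₂ true l (fun σ τ => s.ρ σ τ ^ 4)) := by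
    simp only [CavSys.av₄, CavSys.av₂, CavSys.av_add, CavSys.av_mul_left, CavSys.av_const]
  calc _ ≤ s.av₄ false true l l (fun σ τ c _ => θ / 2 * cavOvlp i σ τ ^ 2 +
      (θ⁻¹ / 4 * s.ρ σ c ^ 4 + θ⁻¹ / 4 * s.ρ τ c ^ 4)) := by
        unfold CavSys.av₄
        refine (s.abs_av₂_le _ _ _).trans (s.av₂_mono fun σ τ => ?_)
        exact (s.abs_av₂_le _ _ _).trans (s.av₂_mono fun c _ => hpt σ τ c)
    _ ≤ _ := by
        rw [e1]
        have h1 := s.av₂_ρ_le false l 4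
        have h2 := s.av₂_ρ_le true l 4
        have : 0 < θ⁻¹ := by positivity
        nlinarith

/-- Cavity estimate for the second moment of the overlap of coupled replicas. -/
lemma abs_Ecpl_cavity_le {a b : ℝ} (hab : a ^ 2 + b ^ 2 = 1) (hβ : β ^ 2 ≤ 1) {θ : ℝ} (hθ : 0 < θ)
    (hθ1 : θ ≤ 1) :
    |Ecpl (hv N β) a b (fun σ τ => spin (σ i) * spin (τ i) * cavOvlp i σ τ)
      - a * β ^ 2 * Ecpl (hv N β) a b (fun σ τ => cavOvlp i σ τ ^ 2)|
    ≤ θ * Ecpl (hv N β) a b (fun σ τ => cavOvlp i σ τ ^ 2)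
      + cavK * θ⁻¹ * Ecpl (hv N β) 1 0 (fun σ τ => cavOvlp i σ τ ^ 4) := by
  have hT := tayC_pos
  have f1 : ∀ σ τ : Config N, cavOvlp i (flip i σ) τ = cavOvlp i σ τ := cavOvlp_flip_left i
  have f2 : ∀ σ τ : Config N, cavOvlp i σ (flip i τ) = cavOvlp i σ τ := cavOvlp_flip_right i
  have f3 : ∀ σ τ : Config N, cavOvlp i (flip i σ) τ ^ 2 = cavOvlp i σ τ ^ 2 := fun σ τ => by
    rw [cavOvlp_flip_left]
  have f4 : ∀ σ τ : Config N, cavOvlp i σ (flip i τ) ^ 2 = cavOvlp i σ τ ^ 2 := fun σ τ => by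
    rw [cavOvlp_flip_right]
  have hS := integral_tilt_Sh β i hab hβ f1 f2
  have hC := integral_tilt_Ch β i hab hβ (F := fun σ τ => cavOvlp i σ τ ^ 2) f3 f4
  have iS := integrable_tilt_Sh β i hab hβ f1 f2
  have iC := integrable_tilt_Ch β i hab hβ (F := fun σ τ => cavOvlp i σ τ ^ 2) f3 f4
  have iA := integrable_av₂ β i hab hβ false true fun σ τ => cavOvlp i σ τ ^ 2
  have iM := integrable_mom β i hab hβ 4
  set A := fun x => (cavSys β i hab hβ x).av₂ false true fun σ τ => cavOvlp i σ τ ^ 2 with hA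
  have hpS : ∀ x, |(cavSys β i hab hβ x).tilt Sh (cavOvlp i) - a * β ^ 2 * A x|
      ≤ θ * A x + (θ⁻¹ + 1584 * tayC) * (cavSys β i hab hβ x).mom 4 := by
    intro x
    set s := cavSys β i hab hβ x with hs
    have h := s.tilt_Sh (f := cavOvlp i) (n := 1) (fun σ τ => by rw [pow_one]; exact le_rfl) one_pos
    have h1 := abs_av₄_triple_le β i hab hβ x false hθ
    have h2 := abs_av₄_triple_le β i hab hβ x true hθ
    have e : s.av₂ false true (fun σ τ => cavOvlp i σ τ * (s.u false σ ⬝ᵥ s.u true τ))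
        = a * β ^ 2 * A x := by
      rw [hA, ← s.av₂_mul_left]
      congr 1; ext σ τ
      simp only [hs, cavSys]
      rw [gauge_dot]; simp [coefA, coefB]; ring
    rw [e] at h
    rw [← hs] at h1 h2
    rw [abs_le] at h h1 h2 ⊢
    constructor <;> norm_num at h <;> nlinarith
  have hpC : ∀ x, |(cavSys β i hab hβ x).tilt Ch (fun σ τ => cavOvlp i σ τ ^ 2) - A x|
      ≤ 222 * tayC * (cavSys β i hab hβ x).mom 4 := fun x =>
    CavSys.tilt_Ch _ (fun σ τ => sq_nonneg _) fun σ τ => (sq_abs _).ge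
  have b1 : |Ecpl (hv N β) a b (fun σ τ => spin (σ i) * spin (τ i) * cavOvlp i σ τ)
      - a * β ^ 2 * ∫ x, A x ∂stdG _| ≤ θ * (∫ x, A x ∂stdG _)
        + (θ⁻¹ + 1584 * tayC) * ∫ x, (cavSys β i hab hβ x).mom 4 ∂stdG _ := by
    rw [← hS, ← integral_const_mul, ← integral_sub iS (iA.const_mul _), ← integral_const_mul,
      ← integral_const_mul, ← integral_add (iA.const_mul _) (iM.const_mul _)]
    refine abs_integral_le_integral_abs.trans (integral_mono (iS.sub (iA.const_mul _)).abs
      ((iA.const_mul _).add (iM.const_mul _)) hpS)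
  have b2 : |Ecpl (hv N β) a b (fun σ τ => cavOvlp i σ τ ^ 2) - ∫ x, A x ∂stdG _|
      ≤ 222 * tayC * ∫ x, (cavSys β i hab hβ x).mom 4 ∂stdG _ := by
    rw [← hC, ← integral_sub iC iA, ← integral_const_mul]
    exact abs_integral_le_integral_abs.trans (integral_mono (iC.sub iA).abs (iM.const_mul _) hpC)
  have hM := integral_mom_le β i hab hβ (m := 4) (by decide)
  have hM0 : 0 ≤ ∫ x, (cavSys β i hab hβ x).mom 4 ∂stdG _ :=
    integral_nonneg fun x => CavSys.mom_nonneg _ 4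
  set D := ∫ x, (cavSys β i hab hβ x).mom 4 ∂stdG _
  set I := ∫ x, A x ∂stdG _
  set E1 := Ecpl (hv N β) a b (fun σ τ => spin (σ i) * spin (τ i) * cavOvlp i σ τ)
  set E2 := Ecpl (hv N β) a b (fun σ τ => cavOvlp i σ τ ^ 2)
  set Q := Ecpl (hv N β) 1 0 (fun σ τ => cavOvlp i σ τ ^ 4)
  have hi : 1 ≤ θ⁻¹ := (one_le_inv₀ hθ).2 hθ1
  have ha : |a * β ^ 2| ≤ 1 := by
    rw [abs_mul, abs_of_nonneg (sq_nonneg β)]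
    have : |a| ≤ 1 := by rw [abs_le_one_iff_mul_self_le_one]; nlinarith [sq_nonneg b]
    nlinarith [abs_nonneg a, sq_nonneg β]
  have b3 : |a * β ^ 2 * (I - E2)| ≤ 222 * tayC * D := by
    rw [abs_mul, abs_sub_comm]
    calc _ ≤ 1 * (222 * tayC * D) := by gcongr
      _ = _ := one_mul _
  have b4 : θ * I ≤ θ * E2 + 222 * tayC * D := by
    have : I - E2 ≤ 222 * tayC * D := by
      rw [abs_sub_comm] at b2; exact (le_abs_self _).trans b2
    have h0 : 0 ≤ 222 * tayC * D := by positivity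
    nlinarith
  have b5 : (θ⁻¹ + 1584 * tayC) * D + 444 * tayC * D ≤ cavK * θ⁻¹ * Q := by
    have : cavK * θ⁻¹ * Q = (1 + 2028 * tayC) * θ⁻¹ * (16 * (1 + tayC) * Q) := by
      unfold cavK; ring
    rw [this]
    calc _ = (θ⁻¹ + 2028 * tayC * 1) * D := by ring
      _ ≤ (θ⁻¹ + 2028 * tayC * θ⁻¹) * D := by gcongr
      _ = (1 + 2028 * tayC) * θ⁻¹ * D := by ring
      _ ≤ _ := by gcongr
  have e : E1 - a * β ^ 2 * E2 = (E1 - a * β ^ 2 * I) + a * β ^ 2 * (I - E2) := by ring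
  rw [e]
  refine (abs_add_le _ _).trans ?_
  linarith

lemma av₄_triple_nonneg (hβ : β ^ 2 ≤ 1) (h10 : (1:ℝ) ^ 2 + 0 ^ 2 = 1)
    (x : (Fin N × Fin N) ⊕ (Fin N × Fin N) → ℝ) (l : Bool) (n : ℕ) :
    0 ≤ (cavSys β i h10 hβ x).av₄ false true l l (fun σ τ c _ => cavOvlp i σ τ ^ n *
      (((cavSys β i h10 hβ x).u false σ ⬝ᵥ (cavSys β i h10 hβ x).u l c) *
       ((cavSys β i h10 hβ x).u true τ ⬝ᵥ (cavSys β i h10 hβ x).u l c))) := by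
  set s := cavSys β i h10 hβ x with hs
  have hu : ∀ k σ c, s.u k σ ⬝ᵥ s.u l c = β ^ 2 * cavOvlp i σ c := by
    intro k σ c
    simp only [hs, cavSys]
    rw [gauge_dot]
    cases k <;> cases l <;> simp [coefA, coefB]
  have hμ : s.μ true = s.μ false := by
    ext σ
    simp only [hs, cavSys, coefA, coefB, if_true, Bool.false_eq_true, if_false]
  have e : s.av₄ false true l l (fun σ τ c _ => cavOvlp i σ τ ^ n *
      ((s.u false σ ⬝ᵥ s.u l c) * (s.u true τ ⬝ᵥ s.u l c)))
      = β ^ 4 * ∑ c, s.μ l c * ∑ σ, ∑ τ, (s.μ false σ * cavOvlp i σ c) *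
          (s.μ false τ * cavOvlp i τ c) * cavOvlp i σ τ ^ n := by
    simp only [CavSys.av₄, CavSys.av₂, CavSys.av_const, hu]
    simp only [CavSys.av, hμ, Finset.mul_sum]
    conv_rhs => rw [Finset.sum_comm]
    refine Finset.sum_congr rfl fun σ _ => ?_
    rw [Finset.sum_comm]
    refine Finset.sum_congr rfl fun τ _ => Finset.sum_congr rfl fun c _ => ?_
    ring
  rw [e]
  refine mul_nonneg (by positivity) (Finset.sum_nonneg fun c _ => mul_nonneg (s.μ_nonneg l c) ?_)
  exact sum_sum_cavOvlp_pow_nonneg i (fun σ => s.μ false σ * cavOvlp i σ c) n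

/-- One-sided cavity estimate for the moments of the overlap of two replicas. -/
lemma Ecpl_cavity_le (hβ : β ^ 2 ≤ 1) {n : ℕ} (hn : Odd n) {t : ℝ} (ht : 0 < t) :
    Ecpl (hv N β) 1 0 (fun σ τ => spin (σ i) * spin (τ i) * cavOvlp i σ τ ^ n)
      - β ^ 2 * Ecpl (hv N β) 1 0 (fun σ τ => cavOvlp i σ τ ^ (n + 1))
    ≤ cavK * (Ecpl (hv N β) 1 0 (fun σ τ => cavOvlp i σ τ ^ (n + 3))
        + t⁻¹ * Ecpl (hv N β) 1 0 (fun σ τ => cavOvlp i σ τ ^ (2 * n + 2))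
        + t * Ecpl (hv N β) 1 0 (fun σ τ => cavOvlp i σ τ ^ 4)) := by
  have hT := tayC_pos
  have hab : (1:ℝ) ^ 2 + 0 ^ 2 = 1 := by norm_num
  have f1 : ∀ m (σ τ : Config N), cavOvlp i (flip i σ) τ ^ m = cavOvlp i σ τ ^ m := fun m σ τ => by
    rw [cavOvlp_flip_left]
  have f2 : ∀ m (σ τ : Config N), cavOvlp i σ (flip i τ) ^ m = cavOvlp i σ τ ^ m := fun m σ τ => by
    rw [cavOvlp_flip_right]
  have n1 : Even (n + 1) := hn.add_one
  have n3 : Even (n + 3) := by have := hn.add_odd (show Odd 3 by decide); exact this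
  have n2 : Even (2 * n + 2) := ⟨n + 1, by ring⟩
  have hS := integral_tilt_Sh β i hab hβ (F := fun σ τ => cavOvlp i σ τ ^ n) (f1 n) (f2 n)
  have hC := integral_tilt_Ch β i hab hβ (F := fun σ τ => cavOvlp i σ τ ^ (n + 1))
    (f1 (n + 1)) (f2 (n + 1))
  have iS := integrable_tilt_Sh β i hab hβ (F := fun σ τ => cavOvlp i σ τ ^ n) (f1 n) (f2 n)
  have iC := integrable_tilt_Ch β i hab hβ (F := fun σ τ => cavOvlp i σ τ ^ (n + 1))
    (f1 (n + 1)) (f2 (n + 1))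
  have iA := integrable_av₂ β i hab hβ false true fun σ τ => cavOvlp i σ τ ^ (n + 1)
  have iM := integrable_mom β i hab hβ
  have hp : ∀ x, (cavSys β i hab hβ x).tilt Sh (fun σ τ => cavOvlp i σ τ ^ n)
      - β ^ 2 * (cavSys β i hab hβ x).tilt Ch (fun σ τ => cavOvlp i σ τ ^ (n + 1))
      ≤ (1 + 2028 * tayC) * ((cavSys β i hab hβ x).mom (n + 3)
        + t⁻¹ * (cavSys β i hab hβ x).mom (2 * n + 2) + t * (cavSys β i hab hβ x).mom 4) := by
    intro x
    have t1 := av₄_triple_nonneg β i hβ hab x false n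
    have t2 := av₄_triple_nonneg β i hβ hab x true n
    set s := cavSys β i hab hβ x with hs
    have h := s.tilt_Sh (f := fun σ τ => cavOvlp i σ τ ^ n) (n := n)
      (fun σ τ => by rw [abs_pow]; exact le_rfl) ht
    have h' := s.tilt_Ch (f := fun σ τ => cavOvlp i σ τ ^ (n + 1)) (m := n + 1)
      (fun σ τ => n1.pow_nonneg _) (fun σ τ => (n1.pow_abs _).ge)
    have e : s.av₂ false true (fun σ τ => cavOvlp i σ τ ^ n * (s.u false σ ⬝ᵥ s.u true τ))
        = β ^ 2 * s.av₂ false true (fun σ τ => cavOvlp i σ τ ^ (n + 1)) := by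
      rw [← s.av₂_mul_left]
      congr 1; ext σ τ
      simp only [hs, cavSys]
      rw [gauge_dot]; simp [coefA, coefB]; ring
    rw [e] at h
    have m1 := s.mom_nonneg (n + 3)
    have m2 : 0 ≤ t⁻¹ * s.mom (2 * n + 2) := mul_nonneg (by positivity) (s.mom_nonneg _)
    have m3 : 0 ≤ t * s.mom 4 := mul_nonneg ht.le (s.mom_nonneg _)
    have hh := (abs_le.1 h).2
    have hh' := (abs_le.1 h').1
    have hh2 : β ^ 2 * s.av₂ false true (fun σ τ => cavOvlp i σ τ ^ (n + 1))
        - β ^ 2 * s.tilt Ch (fun σ τ => cavOvlp i σ τ ^ (n + 1)) ≤ 222 * tayC * s.mom (n + 3) := by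
      have : s.av₂ false true (fun σ τ => cavOvlp i σ τ ^ (n + 1))
        - s.tilt Ch (fun σ τ => cavOvlp i σ τ ^ (n + 1)) ≤ 222 * tayC * s.mom (n + 3) := by linarith
      have h0 : 0 ≤ 222 * tayC * s.mom (n + 3) := by positivity
      nlinarith [sq_nonneg β]
    have k1 : 0 ≤ tayC * s.mom (n + 3) := by positivity
    have k2 : 0 ≤ tayC * (t⁻¹ * s.mom (2 * n + 2)) := by positivity
    have k3 : 0 ≤ tayC * (t * s.mom 4) := by positivity
    nlinarith
  have i2 := (((iM (n + 3)).add ((iM (2 * n + 2)).const_mul t⁻¹)).add ((iM 4).const_mul t)).const_mul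
    (1 + 2028 * tayC)
  have i3 : Integrable (fun x => (cavSys β i hab hβ x).mom (n + 3)
      + t⁻¹ * (cavSys β i hab hβ x).mom (2 * n + 2)) (stdG _) :=
    (iM (n + 3)).add ((iM (2 * n + 2)).const_mul t⁻¹)
  have h := integral_mono (iS.sub (iC.const_mul (β ^ 2))) i2 hp
  simp only [Pi.add_apply, Pi.sub_apply] at h
  rw [integral_sub iS (iC.const_mul _), integral_const_mul, integral_const_mul, hS, hC,
    integral_add i3 ((iM 4).const_mul t),
    integral_add (iM (n + 3)) ((iM (2 * n + 2)).const_mul t⁻¹), integral_const_mul,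
    integral_const_mul] at h
  have a1 := integral_mom_le β i hab hβ n3
  have a2 := integral_mom_le β i hab hβ n2
  have a3 := integral_mom_le β i hab hβ (m := 4) (by decide)
  refine h.trans ?_
  unfold cavK
  calc _ ≤ (1 + 2028 * tayC) *
      (16 * (1 + tayC) * Ecpl (hv N β) 1 0 (fun σ τ => cavOvlp i σ τ ^ (n + 3))
        + t⁻¹ * (16 * (1 + tayC) * Ecpl (hv N β) 1 0 (fun σ τ => cavOvlp i σ τ ^ (2 * n + 2)))
        + t * (16 * (1 + tayC) * Ecpl (hv N β) 1 0 (fun σ τ => cavOvlp i σ τ ^ 4))) := by gcongr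
    _ = _ := by ring

end CavityInequalities

section Averaging

section Linearity

variable {ι S : Type*} [Fintype ι] [Fintype S] [Nonempty S] (V : S → ι → ℝ) (a b : ℝ)

lemma Ecpl_add (f g : S → S → ℝ) :
    Ecpl V a b (fun s t => f s t + g s t) = Ecpl V a b f + Ecpl V a b g := by
  unfold Ecpl
  rw [← integral_add (integrable_cpl V a b f) (integrable_cpl V a b g)]
  congr 1; ext ω
  simp only [cpl, mul_add, Finset.sum_add_distrib]

lemma Ecpl_mul_left (c : ℝ) (f : S → S → ℝ) :
    Ecpl V a b (fun s t => c * f s t) = c * Ecpl V a b f := by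
  unfold Ecpl
  rw [← integral_const_mul]
  congr 1; ext ω
  simp only [cpl, Finset.mul_sum]
  exact Finset.sum_congr rfl fun s _ => Finset.sum_congr rfl fun t _ => by ring

lemma Ecpl_finsetSum {J : Type*} (A : Finset J) (f : J → S → S → ℝ) :
    Ecpl V a b (fun s t => ∑ j ∈ A, f j s t) = ∑ j ∈ A, Ecpl V a b (f j) := by
  classical
  induction A using Finset.induction_on with
  | empty =>
    have := Ecpl_mul_left V a b 0 (fun _ _ => 0)
    simpa using this
  | insert j A hj ih =>
    simp only [Finset.sum_insert hj]
    rw [Ecpl_add, ih]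

lemma Ecpl_mono {f g : S → S → ℝ} (h : ∀ s t, f s t ≤ g s t) : Ecpl V a b f ≤ Ecpl V a b g := by
  unfold Ecpl
  refine integral_mono (integrable_cpl V a b f) (integrable_cpl V a b g) fun ω => ?_
  exact Finset.sum_le_sum fun s _ => Finset.sum_le_sum fun t _ =>
    mul_le_mul_of_nonneg_left (h s t) (mul_nonneg (wt_nonneg _ _ _) (wt_nonneg _ _ _))

@[simp] lemma Ecpl_const (c : ℝ) : Ecpl V a b (fun _ _ => c) = c := by
  have h : ∀ ω, cpl V a b (fun _ _ => c) ω = c := by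
    intro ω
    simp only [cpl, ← Finset.sum_mul, ← Finset.mul_sum, sum_wt, mul_one, one_mul]
  simp [Ecpl, h]

lemma Ecpl_nonneg {f : S → S → ℝ} (h : ∀ s t, 0 ≤ f s t) : 0 ≤ Ecpl V a b f := by
  have := Ecpl_mono V a b (f := fun _ _ => 0) h
  simpa using this

end Linearity

variable {N : ℕ} (β : ℝ)

/-- Moments of the overlap of two coupled replicas. -/
def ovm (N : ℕ) (β a b : ℝ) (m : ℕ) : ℝ := Ecpl (hv N β) a b fun σ τ => ovlp N σ τ ^ m

lemma sum_spin_mul (hN : 0 < N) (σ τ : Config N) :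
    ∑ i, spin (σ i) * spin (τ i) = N * ovlp N σ τ := by
  have : (N:ℝ) ≠ 0 := by positivity
  unfold ovlp; field_simp

lemma spin_mul_sq (σ τ : Config N) (i : Fin N) : (spin (σ i) * spin (τ i)) ^ 2 = 1 := by
  rw [mul_pow, sq, sq, spin_mul_self, spin_mul_self, one_mul]

lemma sum_spin_cavOvlp (hN : 0 < N) (σ τ : Config N) :
    ∑ i, spin (σ i) * spin (τ i) * cavOvlp i σ τ = N * ovlp N σ τ ^ 2 - 1 := by
  have hN' : (N:ℝ) ≠ 0 := by positivity
  have e : ∀ i, spin (σ i) * spin (τ i) * cavOvlp i σ τ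
      = ovlp N σ τ * (spin (σ i) * spin (τ i)) - 1 / N := by
    intro i
    rw [cavOvlp_eq]
    linear_combination (-(1 / N : ℝ)) * spin_mul_sq σ τ i
  simp_rw [e]
  rw [Finset.sum_sub_distrib, ← Finset.mul_sum, sum_spin_mul hN]
  simp
  field_simp

lemma sum_cavOvlp_sq (hN : 0 < N) (σ τ : Config N) :
    ∑ i, cavOvlp i σ τ ^ 2 = N * ovlp N σ τ ^ 2 - 2 * ovlp N σ τ ^ 2 + 1 / N := by
  have hN' : (N:ℝ) ≠ 0 := by positivity
  have e : ∀ i, cavOvlp i σ τ ^ 2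
      = ovlp N σ τ ^ 2 + 1 / N ^ 2 - 2 * ovlp N σ τ / N * (spin (σ i) * spin (τ i)) := by
    intro i
    rw [cavOvlp_eq]
    linear_combination (1 / N ^ 2 : ℝ) * spin_mul_sq σ τ i
  simp_rw [e]
  rw [Finset.sum_sub_distrib, ← Finset.mul_sum, sum_spin_mul hN]
  simp
  field_simp
  ring

lemma sum_spin_cavOvlp_cube (hN : 0 < N) (σ τ : Config N) :
    ∑ i, spin (σ i) * spin (τ i) * cavOvlp i σ τ ^ 3
      = N * ovlp N σ τ ^ 4 - 3 * ovlp N σ τ ^ 2 + 3 * ovlp N σ τ ^ 2 / N - 1 / N ^ 2 := by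
  have hN' : (N:ℝ) ≠ 0 := by positivity
  have e : ∀ i, spin (σ i) * spin (τ i) * cavOvlp i σ τ ^ 3
      = (ovlp N σ τ ^ 3 + 3 * ovlp N σ τ / N ^ 2) * (spin (σ i) * spin (τ i))
        - (3 * ovlp N σ τ ^ 2 / N + 1 / N ^ 3) := by
    intro i
    rw [cavOvlp_eq]
    linear_combination (-(3 * ovlp N σ τ ^ 2 / N) + 3 * ovlp N σ τ / N ^ 2 *
      (spin (σ i) * spin (τ i)) - 1 / N ^ 3 * ((spin (σ i) * spin (τ i)) ^ 2 + 1))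
        * spin_mul_sq σ τ i
  simp_rw [e]
  rw [Finset.sum_sub_distrib, ← Finset.mul_sum, sum_spin_mul hN]
  simp
  field_simp
  ring

lemma sum_cavOvlp_fourth_le (hN : 0 < N) (σ τ : Config N) :
    ∑ i, cavOvlp i σ τ ^ 4 ≤ N * ovlp N σ τ ^ 4 + 6 * ovlp N σ τ ^ 2 / N + 1 / N ^ 3 := by
  have hN' : (N:ℝ) ≠ 0 := by positivity
  have e : ∀ i, cavOvlp i σ τ ^ 4
      = (ovlp N σ τ ^ 4 + 6 * ovlp N σ τ ^ 2 / N ^ 2 + 1 / N ^ 4)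
        - (4 * ovlp N σ τ ^ 3 / N + 4 * ovlp N σ τ / N ^ 3) * (spin (σ i) * spin (τ i)) := by
    intro i
    rw [cavOvlp_eq]
    linear_combination (6 * ovlp N σ τ ^ 2 / N ^ 2 - 4 * ovlp N σ τ / N ^ 3 *
      (spin (σ i) * spin (τ i)) + 1 / N ^ 4 * ((spin (σ i) * spin (τ i)) ^ 2 + 1))
        * spin_mul_sq σ τ i
  have e2 : ∑ i, cavOvlp i σ τ ^ 4 = N * ovlp N σ τ ^ 4 + 6 * ovlp N σ τ ^ 2 / N + 1 / N ^ 3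
      - (4 * ovlp N σ τ ^ 4 + 4 * ovlp N σ τ ^ 2 / N ^ 2) := by
    simp_rw [e]
    rw [Finset.sum_sub_distrib, ← Finset.mul_sum, sum_spin_mul hN]
    simp
    field_simp
  rw [e2]
  have : 0 ≤ 4 * ovlp N σ τ ^ 4 + 4 * ovlp N σ τ ^ 2 / N ^ 2 := by positivity
  linarith

lemma cavOvlp_pow_le {m : ℕ} (hm : Even m) (i : Fin N) (σ τ : Config N) :
    cavOvlp i σ τ ^ m ≤ 2 ^ m * (ovlp N σ τ ^ m + 1 / N ^ m) := by
  rw [cavOvlp_eq, ← hm.pow_abs (_ - _), ← hm.pow_abs (ovlp N σ τ), ← one_div_pow]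
  have h : |ovlp N σ τ - spin (σ i) * spin (τ i) / N| ≤ |ovlp N σ τ| + 1 / N := by
    refine (abs_sub _ _).trans_eq ?_
    rw [abs_div, abs_mul, abs_spin, abs_spin, Nat.abs_cast, one_mul]
  have h1 : |ovlp N σ τ| + 1 / N ≤ 2 * max |ovlp N σ τ| (1 / N) := by
    linarith [le_max_left |ovlp N σ τ| (1 / N), le_max_right |ovlp N σ τ| (1 / (N:ℝ))]
  calc _ ≤ (2 * max |ovlp N σ τ| (1 / N)) ^ m := pow_le_pow_left₀ (abs_nonneg _) (h.trans h1) m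
    _ = 2 ^ m * max |ovlp N σ τ| (1 / N) ^ m := mul_pow _ _ _
    _ ≤ _ := by
      refine mul_le_mul_of_nonneg_left ?_ (by positivity)
      rcases max_choice |ovlp N σ τ| (1 / (N:ℝ)) with h | h <;> rw [h]
      · have : 0 ≤ (1 / (N:ℝ)) ^ m := by positivity
        linarith
      · have : 0 ≤ |ovlp N σ τ| ^ m := by positivity
        linarith

lemma Ecpl_cavOvlp_pow_le {m : ℕ} (hm : Even m) (i : Fin N) (a b : ℝ) :
    Ecpl (hv N β) a b (fun σ τ => cavOvlp i σ τ ^ m) ≤ 2 ^ m * (ovm N β a b m + 1 / N ^ m) := by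
  refine (Ecpl_mono _ _ _ fun σ τ => cavOvlp_pow_le hm i σ τ).trans_eq ?_
  rw [Ecpl_mul_left, Ecpl_add, Ecpl_const]
  rfl

lemma ovm_nonneg {m : ℕ} (hm : Even m) (a b : ℝ) : 0 ≤ ovm N β a b m :=
  Ecpl_nonneg _ _ _ fun _ _ => hm.pow_nonneg _

lemma sum_Ecpl_spin_cavOvlp (hN : 0 < N) (a b : ℝ) :
    ∑ i, Ecpl (hv N β) a b (fun σ τ => spin (σ i) * spin (τ i) * cavOvlp i σ τ)
      = N * ovm N β a b 2 - 1 := by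
  rw [← Ecpl_finsetSum]
  simp_rw [sum_spin_cavOvlp hN, sub_eq_add_neg]
  rw [Ecpl_add, Ecpl_mul_left, Ecpl_const]; rfl

lemma sum_Ecpl_cavOvlp_sq (hN : 0 < N) (a b : ℝ) :
    ∑ i, Ecpl (hv N β) a b (fun σ τ => cavOvlp i σ τ ^ 2)
      = N * ovm N β a b 2 - 2 * ovm N β a b 2 + 1 / N := by
  rw [← Ecpl_finsetSum]
  simp_rw [sum_cavOvlp_sq hN, ← sub_mul]
  rw [Ecpl_add, Ecpl_mul_left, Ecpl_const]; rfl

lemma sum_Ecpl_spin_cavOvlp_cube (hN : 0 < N) (a b : ℝ) :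
    ∑ i, Ecpl (hv N β) a b (fun σ τ => spin (σ i) * spin (τ i) * cavOvlp i σ τ ^ 3)
      = N * ovm N β a b 4 + (-3 + 3 / N) * ovm N β a b 2 + -(1 / N ^ 2) := by
  rw [← Ecpl_finsetSum]
  have e : ∀ σ τ : Config N, ∑ i, spin (σ i) * spin (τ i) * cavOvlp i σ τ ^ 3
      = N * ovlp N σ τ ^ 4 + (-3 + 3 / N) * ovlp N σ τ ^ 2 + -(1 / N ^ 2) := fun σ τ => by
    rw [sum_spin_cavOvlp_cube hN]; ring
  simp_rw [e]
  rw [Ecpl_add, Ecpl_add, Ecpl_mul_left, Ecpl_mul_left, Ecpl_const]; rfl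

lemma sum_Ecpl_cavOvlp_fourth_le (hN : 0 < N) (a b : ℝ) :
    ∑ i, Ecpl (hv N β) a b (fun σ τ => cavOvlp i σ τ ^ 4)
      ≤ N * ovm N β a b 4 + 6 / N * ovm N β a b 2 + 1 / N ^ 3 := by
  rw [← Ecpl_finsetSum]
  refine (Ecpl_mono _ _ _ fun σ τ => sum_cavOvlp_fourth_le hN σ τ).trans_eq ?_
  have e : ∀ σ τ : Config N, N * ovlp N σ τ ^ 4 + 6 * ovlp N σ τ ^ 2 / N + 1 / (N:ℝ) ^ 3
      = N * ovlp N σ τ ^ 4 + 6 / N * ovlp N σ τ ^ 2 + 1 / N ^ 3 := fun σ τ => by ring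
  simp_rw [e]
  rw [Ecpl_add, Ecpl_add, Ecpl_mul_left, Ecpl_mul_left, Ecpl_const]; rfl

lemma sum_le_card_mul {f : Fin N → ℝ} {M : ℝ} (h : ∀ i, f i ≤ M) : ∑ i, f i ≤ N * M := by
  refine (Finset.sum_le_sum fun i _ => h i).trans_eq ?_
  simp

lemma ovm_two_cavity_le (hN : 0 < N) (hβ : β ^ 2 ≤ 1) :
    (1 - β ^ 2) * ovm N β 1 0 2 ≤ 2 / N + 48 * cavK * (ovm N β 1 0 4 + 1 / N ^ 4) := by
  have hK := cavK_pos
  have hN' : (0:ℝ) < N := by exact_mod_cast hN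
  have h : ∀ i : Fin N, Ecpl (hv N β) 1 0 (fun σ τ => spin (σ i) * spin (τ i) * cavOvlp i σ τ)
      - β ^ 2 * Ecpl (hv N β) 1 0 (fun σ τ => cavOvlp i σ τ ^ 2)
      ≤ 48 * cavK * (ovm N β 1 0 4 + 1 / N ^ 4) := by
    intro i
    have h1 := Ecpl_cavity_le β i hβ (n := 1) (by decide) (t := 1) one_pos
    have h2 := Ecpl_cavOvlp_pow_le β (m := 4) (by decide) i 1 0
    simp only [pow_one, Nat.reduceAdd, Nat.reduceMul, inv_one, one_mul] at h1
    rw [show (2:ℝ) ^ 4 = 16 by norm_num] at h2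
    refine h1.trans ?_
    calc _ ≤ cavK * (3 * (16 * (ovm N β 1 0 4 + 1 / (N:ℝ) ^ 4))) := by gcongr; linarith
      _ = _ := by ring
  have hs := sum_le_card_mul h
  rw [Finset.sum_sub_distrib, ← Finset.mul_sum, sum_Ecpl_spin_cavOvlp β hN,
    sum_Ecpl_cavOvlp_sq β hN] at hs
  have hB := ovm_nonneg (N := N) β (m := 2) (by decide) 1 0
  set B := ovm N β 1 0 2
  set X := 48 * cavK * (ovm N β 1 0 4 + 1 / N ^ 4)
  have h3 : β ^ 2 * (1 / N) ≤ 1 := by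
    have : (1:ℝ) / N ≤ 1 := by rw [div_le_one hN']; exact_mod_cast hN
    have : 0 ≤ (1:ℝ) / N := by positivity
    nlinarith [sq_nonneg β]
  have h4 : N * ((1 - β ^ 2) * B) ≤ 2 + N * X := by nlinarith [mul_nonneg (sq_nonneg β) hB]
  have h5 : (1 - β ^ 2) * B ≤ (2 + N * X) / N := by rw [le_div_iff₀ hN']; linarith
  refine h5.trans_eq ?_
  field_simp

lemma ovm_four_cavity_le (hN : 0 < N) (hβ : β ^ 2 ≤ 1) {t : ℝ} (ht : 0 < t) :
    (1 - β ^ 2) * ovm N β 1 0 4 ≤ 9 / N * ovm N β 1 0 2 + 2 / N ^ 3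
      + cavK * (64 * (ovm N β 1 0 6 + 1 / N ^ 6) + t⁻¹ * (256 * (ovm N β 1 0 8 + 1 / N ^ 8))
        + t * (16 * (ovm N β 1 0 4 + 1 / N ^ 4))) := by
  have hK := cavK_pos
  have hN' : (0:ℝ) < N := by exact_mod_cast hN
  have h : ∀ i : Fin N, Ecpl (hv N β) 1 0 (fun σ τ => spin (σ i) * spin (τ i) * cavOvlp i σ τ ^ 3)
      - β ^ 2 * Ecpl (hv N β) 1 0 (fun σ τ => cavOvlp i σ τ ^ 4)
      ≤ cavK * (64 * (ovm N β 1 0 6 + 1 / N ^ 6) + t⁻¹ * (256 * (ovm N β 1 0 8 + 1 / N ^ 8))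
        + t * (16 * (ovm N β 1 0 4 + 1 / N ^ 4))) := by
    intro i
    have h1 := Ecpl_cavity_le β i hβ (n := 3) (by decide) ht
    have h2 := Ecpl_cavOvlp_pow_le β (m := 4) (by decide) i 1 0
    have h3 := Ecpl_cavOvlp_pow_le β (m := 6) (by decide) i 1 0
    have h4 := Ecpl_cavOvlp_pow_le β (m := 8) (by decide) i 1 0
    rw [show (2:ℝ) ^ 4 = 16 by norm_num] at h2
    rw [show (2:ℝ) ^ 6 = 64 by norm_num] at h3
    rw [show (2:ℝ) ^ 8 = 256 by norm_num] at h4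
    refine h1.trans ?_
    gcongr
  have hs := sum_le_card_mul h
  have h4s := sum_Ecpl_cavOvlp_fourth_le β hN 1 0
  rw [Finset.sum_sub_distrib, ← Finset.mul_sum, sum_Ecpl_spin_cavOvlp_cube β hN] at hs
  have hB := ovm_nonneg (N := N) β (m := 2) (by decide) 1 0
  set B := ovm N β 1 0 2
  set X := cavK * (64 * (ovm N β 1 0 6 + 1 / N ^ 6) + t⁻¹ * (256 * (ovm N β 1 0 8 + 1 / N ^ 8))
        + t * (16 * (ovm N β 1 0 4 + 1 / N ^ 4)))
  set B4 := ovm N β 1 0 4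
  have hi : (1:ℝ) / N ≤ 1 := by rw [div_le_one hN']; exact_mod_cast hN
  have hi0 : 0 ≤ (1:ℝ) / N := by positivity
  have h6 : β ^ 2 * (6 / N * B + 1 / N ^ 3) ≤ 6 * B + 1 / N ^ 2 := by
    have e1 : 6 / N * B ≤ 6 * B := by
      have : 6 / N * B = 6 * B * (1 / N) := by ring
      rw [this]; nlinarith
    have e2 : (1:ℝ) / N ^ 3 ≤ 1 / N ^ 2 := by
      have : (1:ℝ) / N ^ 3 = 1 / N ^ 2 * (1 / N) := by field_simp
      rw [this]
      have : (0:ℝ) ≤ 1 / N ^ 2 := by positivity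
      nlinarith
    have : 0 ≤ 6 / N * B + 1 / (N:ℝ) ^ 3 := by positivity
    nlinarith [sq_nonneg β]
  have h7 : β ^ 2 * ∑ i, Ecpl (hv N β) 1 0 (fun σ τ => cavOvlp i σ τ ^ 4)
      ≤ β ^ 2 * (N * B4) + (6 * B + 1 / N ^ 2) := by
    have := mul_le_mul_of_nonneg_left h4s (sq_nonneg β)
    linarith
  have h9 : 0 ≤ 3 / N * B := by positivity
  have h8 : N * ((1 - β ^ 2) * B4) ≤ 9 * B + 2 / N ^ 2 + N * X := by
    have e : (2:ℝ) / N ^ 2 = 1 / N ^ 2 + 1 / N ^ 2 := by ring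
    rw [e]
    linarith
  have h5 : (1 - β ^ 2) * B4 ≤ (9 * B + 2 / N ^ 2 + N * X) / N := by rw [le_div_iff₀ hN']; linarith
  refine h5.trans_eq ?_
  field_simp

lemma abs_ovm_two_cavity_le (hN : 0 < N) (hβ : β ^ 2 ≤ 1) {a b : ℝ} (hab : a ^ 2 + b ^ 2 = 1)
    {θ : ℝ} (hθ : 0 < θ) (hθ1 : θ ≤ 1) :
    |(1 - a * β ^ 2) * ovm N β a b 2 - 1 / N|
      ≤ 2 / N * ovm N β a b 2 + 2 / N ^ 2 + θ * ovm N β a b 2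
        + 16 * cavK * θ⁻¹ * (ovm N β 1 0 4 + 1 / N ^ 4) := by
  have hK := cavK_pos
  have hN' : (0:ℝ) < N := by exact_mod_cast hN
  have h : ∀ i : Fin N, |Ecpl (hv N β) a b (fun σ τ => spin (σ i) * spin (τ i) * cavOvlp i σ τ)
      - a * β ^ 2 * Ecpl (hv N β) a b (fun σ τ => cavOvlp i σ τ ^ 2)|
      ≤ θ * Ecpl (hv N β) a b (fun σ τ => cavOvlp i σ τ ^ 2)
        + 16 * cavK * θ⁻¹ * (ovm N β 1 0 4 + 1 / N ^ 4) := by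
    intro i
    have h2 := Ecpl_cavOvlp_pow_le β (m := 4) (by decide) i 1 0
    rw [show (2:ℝ) ^ 4 = 16 by norm_num] at h2
    refine (abs_Ecpl_cavity_le β i hab hβ hθ hθ1).trans ?_
    calc _ ≤ θ * Ecpl (hv N β) a b (fun σ τ => cavOvlp i σ τ ^ 2)
        + cavK * θ⁻¹ * (16 * (ovm N β 1 0 4 + 1 / N ^ 4)) := by gcongr
      _ = _ := by ring
  have hs := (Finset.abs_sum_le_sum_abs _ _).trans (Finset.sum_le_sum fun i (_ : i ∈ Finset.univ) => h i)
  rw [Finset.sum_sub_distrib, ← Finset.mul_sum, sum_Ecpl_spin_cavOvlp β hN,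
    sum_Ecpl_cavOvlp_sq β hN, Finset.sum_add_distrib, ← Finset.mul_sum,
    sum_Ecpl_cavOvlp_sq β hN] at hs
  simp only [Finset.sum_const, Finset.card_univ, Fintype.card_fin, nsmul_eq_mul] at hs
  have hB := ovm_nonneg (N := N) β (m := 2) (by decide) a b
  set B := ovm N β a b 2
  set X := 16 * cavK * θ⁻¹ * (ovm N β 1 0 4 + 1 / N ^ 4)
  have ha : |a * β ^ 2| ≤ 1 := by
    rw [abs_mul, abs_of_nonneg (sq_nonneg β)]
    have : |a| ≤ 1 := by rw [abs_le_one_iff_mul_self_le_one]; nlinarith [sq_nonneg b]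
    nlinarith [abs_nonneg a, sq_nonneg β]
  have h0 : (0:ℝ) ≤ 1 / N := by positivity
  have hc : |a * β ^ 2 * (2 * B - 1 / N)| ≤ 2 * B + 1 / N := by
    rw [abs_mul]
    have : |2 * B - 1 / N| ≤ 2 * B + 1 / N := by
      rw [abs_le]; constructor <;> linarith
    nlinarith [abs_nonneg (a * β ^ 2), abs_nonneg (2 * B - 1 / N)]
  have hN1 : |N * ((1 - a * β ^ 2) * B - 1 / N)|
      ≤ N * (2 / N * B + 2 / N ^ 2 + θ * B + X) := by
    have e1 : N * ((1 - a * β ^ 2) * B - 1 / N) = (N * B - 1 - a * β ^ 2 * (N * B - 2 * B + 1 / N))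
        - a * β ^ 2 * (2 * B - 1 / N) := by field_simp; ring
    have e2 : N * (2 / N * B + 2 / N ^ 2 + θ * B + X) = 2 * B + 2 * (1 / N) + θ * (N * B) + N * X := by
      field_simp
    rw [e1, e2]
    refine (abs_sub _ _).trans ?_
    nlinarith
  rw [abs_mul, abs_of_pos hN'] at hN1
  exact le_of_mul_le_mul_left hN1 hN'

end Averaging

section MomentBounds

lemma Ecpl_one_zero {ι S : Type*} [Fintype ι] [Fintype S] [Nonempty S] (V : S → ι → ℝ)
    (f : S → S → ℝ) :
    Ecpl V 1 0 f = ∫ ω, (∑ s, ∑ t, wt V ω s * wt V ω t * f s t) ∂stdG ι := by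
  unfold Ecpl cpl
  simp_rw [pr₂_one_zero]
  refine integral_comp_of_mp (f := fun ω => ∑ s, ∑ t, wt V ω s * wt V ω t * f s t)
    measurePreserving_pr₁ ?_
  refine Continuous.aestronglyMeasurable ?_
  exact continuous_finsetSum _ fun s _ => continuous_finsetSum _ fun t _ =>
    ((continuous_wt V s).mul (continuous_wt V t)).mul continuous_const

variable {N : ℕ} (β : ℝ)

/-- The annealed probability that the overlap of two replicas exceeds `x` in absolute value. -/
def ovTail (N : ℕ) (β x : ℝ) : ℝ :=
  Ecpl (hv N β) 1 0 fun σ τ => if x ^ 2 < ovlp N σ τ ^ 2 then 1 else 0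

lemma ovTail_nonneg (x : ℝ) : 0 ≤ ovTail N β x :=
  Ecpl_nonneg _ _ _ fun _ _ => by split_ifs <;> norm_num

lemma ovm_add_two_le {m : ℕ} (hm : Even m) (x : ℝ) :
    ovm N β 1 0 (m + 2) ≤ x ^ 2 * ovm N β 1 0 m + ovTail N β x := by
  unfold ovm ovTail
  rw [← Ecpl_mul_left, ← Ecpl_add]
  refine Ecpl_mono _ _ _ fun σ τ => ?_
  have h0 : 0 ≤ ovlp N σ τ ^ m := hm.pow_nonneg _
  rw [pow_add]
  split_ifs with h
  · have h1 : ovlp N σ τ ^ m ≤ 1 := by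
      rw [← hm.pow_abs]; exact pow_le_one₀ (abs_nonneg _) (abs_ovlp_le_one N σ τ)
    have h2 : ovlp N σ τ ^ 2 ≤ 1 := by
      rw [← sq_abs]; exact pow_le_one₀ (abs_nonneg _) (abs_ovlp_le_one N σ τ)
    have : 0 ≤ x ^ 2 * ovlp N σ τ ^ m := by positivity
    have := mul_le_one₀ h1 (sq_nonneg _) h2
    linarith
  · push Not at h
    rw [add_zero, mul_comm]
    exact mul_le_mul_of_nonneg_right h h0

/-- The constant in the bound on the fourth moment of the overlap. -/
def momK : ℝ := 2 * (9 * (4 + 192 * cavK) + 2 + cavK * (144 + 768 * (672 * cavK + 1)))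

lemma momK_pos : 0 < momK := by
  have := cavK_pos
  unfold momK; positivity

lemma ovm_four_le (hN : 0 < N) {δ : ℝ} (hδ : δ = 1 - β ^ 2) (hδ0 : 0 < δ) (hδ1 : δ ≤ 1)
    (hNδ : 1 / (N:ℝ) ≤ δ) {x : ℝ} (hx : x ^ 2 = δ / (672 * cavK + 1))
    (hp : ovTail N β x ≤ (1 / (N:ℝ)) ^ 6) :
    ovm N β 1 0 4 ≤ momK * (1 / N) ^ 2 / δ ^ 2 := by
  have hK := cavK_pos
  have hN' : (0:ℝ) < N := by exact_mod_cast hN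
  have hβ : β ^ 2 ≤ 1 := by linarith
  have hL : 0 < 672 * cavK + 1 := by positivity
  have hx0 : 0 < x ^ 2 := by rw [hx]; positivity
  have hxL : x ^ 2 * (672 * cavK + 1) = δ := by rw [hx]; field_simp
  have h2 := ovm_two_cavity_le (N := N) β hN hβ
  have h4 := ovm_four_cavity_le (N := N) β hN hβ hx0
  have m4 := ovm_add_two_le (N := N) β (m := 2) (by decide) x
  have m6 := ovm_add_two_le (N := N) β (m := 4) (by decide) x
  have m8 := ovm_add_two_le (N := N) β (m := 6) (by decide) x
  have hp0 := ovTail_nonneg (N := N) β x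
  have b2 := ovm_nonneg (N := N) β (m := 2) (by decide) 1 0
  have b4 := ovm_nonneg (N := N) β (m := 4) (by decide) 1 0
  have b6 := ovm_nonneg (N := N) β (m := 6) (by decide) 1 0
  simp only [Nat.reduceAdd] at m4 m6 m8
  rw [← hδ] at h2 h4
  have hu1 : (1:ℝ) / N ≤ 1 := hNδ.trans hδ1
  have hu0 : (0:ℝ) < 1 / N := by positivity
  simp only [← one_div_pow] at h2 h4
  rw [show (2:ℝ) / N = 2 * (1 / N) by ring] at h2
  rw [show (9:ℝ) / N = 9 * (1 / N) by ring, show (2:ℝ) / N ^ 3 = 2 * (1 / N) ^ 3 by ring] at h4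
  unfold momK
  generalize ovm N β 1 0 2 = B2 at *
  generalize ovm N β 1 0 4 = B4 at *
  generalize ovm N β 1 0 6 = B6 at *
  generalize ovm N β 1 0 8 = B8 at *
  generalize ovTail N β x = p at *
  generalize (1:ℝ) / N = u at *
  generalize cavK = K at *
  generalize x ^ 2 = X at *
  have hXδ : X ≤ δ := by nlinarith
  have hX1 : X ≤ 1 := hXδ.trans hδ1
  have u4 : u ^ 4 ≤ u := by simpa using pow_le_pow_of_le_one hu0.le hu1 (show 1 ≤ 4 by norm_num)
  have u64 : u ^ 6 ≤ u ^ 4 := pow_le_pow_of_le_one hu0.le hu1 (by norm_num)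
  have u32 : u ^ 3 ≤ u ^ 2 := pow_le_pow_of_le_one hu0.le hu1 (by norm_num)
  have u62 : u ^ 6 ≤ u ^ 2 := pow_le_pow_of_le_one hu0.le hu1 (by norm_num)
  have u42 : u ^ 4 ≤ u ^ 2 := pow_le_pow_of_le_one hu0.le hu1 (by norm_num)
  have u52 : u ^ 5 ≤ u ^ 2 := pow_le_pow_of_le_one hu0.le hu1 (by norm_num)
  have u86 : u ^ 8 ≤ u ^ 6 := pow_le_pow_of_le_one hu0.le hu1 (by norm_num)
  -- the second moment
  have hB2 : δ * B2 ≤ (4 + 192 * K) * u := by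
    have e1 : K * (B4 + u ^ 4) ≤ K * (X * B2 + 2 * u) :=
      mul_le_mul_of_nonneg_left (by linarith) hK.le
    have e2 : 96 * (K * X) * B2 ≤ δ * B2 := by gcongr; nlinarith [mul_pos hK hx0]
    nlinarith
  have hB2' : B2 ≤ (4 + 192 * K) * u / δ := by rw [le_div_iff₀ hδ0]; linarith
  have hB8 : B8 ≤ X ^ 2 * B4 + 2 * u ^ 6 := by
    have : X * B6 ≤ X * (X * B4 + p) := by gcongr
    have : X * p ≤ 1 * u ^ 6 := by gcongr
    linarith
  have hXi : X⁻¹ * u ^ 6 ≤ (672 * K + 1) * u ^ 5 := by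
    have : u ^ 6 ≤ X * ((672 * K + 1) * u ^ 5) := by
      calc u ^ 6 = u * u ^ 5 := by ring
        _ ≤ δ * u ^ 5 := by gcongr
        _ = _ := by rw [← hxL]; ring
    rwa [inv_mul_le_iff₀ hx0]
  have h8 : X⁻¹ * (256 * (B8 + u ^ 8)) ≤ 256 * X * B4 + 768 * ((672 * K + 1) * u ^ 2) := by
    have e1 : X⁻¹ * (256 * (B8 + u ^ 8)) ≤ X⁻¹ * (256 * (X ^ 2 * B4 + 3 * u ^ 6)) := by
      refine mul_le_mul_of_nonneg_left ?_ (inv_pos.2 hx0).le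
      linarith
    have e2 : X⁻¹ * (256 * (X ^ 2 * B4 + 3 * u ^ 6)) = 256 * X * B4 + 768 * (X⁻¹ * u ^ 6) := by
      field_simp
      ring
    have e3 : (672 * K + 1) * u ^ 5 ≤ (672 * K + 1) * u ^ 2 := by gcongr
    linarith
  have h6 : 64 * (B6 + u ^ 6) ≤ 64 * X * B4 + 128 * u ^ 2 := by linarith
  have h44 : X * (16 * (B4 + u ^ 4)) ≤ 16 * X * B4 + 16 * u ^ 2 := by
    have : X * u ^ 4 ≤ 1 * u ^ 2 := by gcongr
    linarith
  have hsum : K * (64 * (B6 + u ^ 6) + X⁻¹ * (256 * (B8 + u ^ 8)) + X * (16 * (B4 + u ^ 4)))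
      ≤ K * (336 * X * B4 + (144 + 768 * (672 * K + 1)) * u ^ 2) :=
    mul_le_mul_of_nonneg_left (by linarith) hK.le
  have hd : 336 * (K * X) * B4 ≤ δ / 2 * B4 := by gcongr; nlinarith [mul_pos hK hx0]
  have hfin : δ * B4 ≤ 2 * (9 * u * ((4 + 192 * K) * u / δ) + 2 * u ^ 2
      + K * (144 + 768 * (672 * K + 1)) * u ^ 2) := by
    have : 9 * u * B2 ≤ 9 * u * ((4 + 192 * K) * u / δ) := by gcongr
    linarith
  have hfin2 : 2 * (9 * u * ((4 + 192 * K) * u / δ) + 2 * u ^ 2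
      + K * (144 + 768 * (672 * K + 1)) * u ^ 2)
      ≤ 2 * (9 * (4 + 192 * K) + 2 + K * (144 + 768 * (672 * K + 1))) * u ^ 2 / δ := by
    rw [le_div_iff₀ hδ0]
    have e : 2 * (9 * u * ((4 + 192 * K) * u / δ) + 2 * u ^ 2
      + K * (144 + 768 * (672 * K + 1)) * u ^ 2) * δ = 18 * (4 + 192 * K) * u ^ 2
        + (2 * (2 + K * (144 + 768 * (672 * K + 1))) * u ^ 2) * δ := by
      field_simp; ring
    rw [e]
    have : (2 * (2 + K * (144 + 768 * (672 * K + 1))) * u ^ 2) * δ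
      ≤ (2 * (2 + K * (144 + 768 * (672 * K + 1))) * u ^ 2) * 1 := by gcongr
    linarith
  rw [le_div_iff₀ (by positivity)]
  have h := hfin.trans hfin2
  rw [le_div_iff₀ hδ0] at h
  linarith

/-- The constant in the comparison of the second moment with its limit. -/
def devK (c : ℝ) : ℝ := 2 * (3 + 64 * cavK * (momK + 1) / c) + 1 + 64 * cavK * (momK + 1) / c

lemma abs_sub_inv_le_of_cavity {r s u U W E : ℝ} (hr : 0 < r) (hrs : r ≤ s) (hs : s ≤ 1)
    (hu : 0 ≤ u) (hur : 8 * u ≤ r ^ 2) (hU : 0 ≤ U) (hE : 0 ≤ E)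
    (hW : W ≤ E * (r / s))
    (h : |s ^ 2 * U - 1| ≤ 2 * u * U + 2 * u + r * s / 4 * U + W) :
    |U - 1 / s ^ 2| ≤ (2 * (3 + E) + 1 + E) * (r / (s * s ^ 2)) := by
  have hs0 : 0 < s := hr.trans_le hrs
  have hrs1 : r / s ≤ 1 := by rw [div_le_one hs0]; exact hrs
  have hq0 : 0 ≤ r / s := by positivity
  have hq : r = r / s * s := by field_simp
  set q := r / s
  have hWE : W ≤ E := by nlinarith
  have hr1 : r ^ 2 ≤ 1 := by nlinarith
  have hrs2 : r * s ≤ s ^ 2 := by nlinarith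
  have hr2 : r ^ 2 ≤ s ^ 2 := by nlinarith
  have hsU : s ^ 2 * U ≤ 2 * (3 + E) := by
    have := (abs_le.1 h).2
    have e1 : 2 * u * U ≤ s ^ 2 / 4 * U := by gcongr; linarith
    have e2 : r * s / 4 * U ≤ s ^ 2 / 4 * U := by gcongr
    nlinarith
  have e1 : 2 * u * U ≤ q * (s ^ 2 * U) / 4 := by
    have : 2 * u * U ≤ (q * s ^ 2) / 4 * U := by
      gcongr
      have : r ^ 2 ≤ q * s ^ 2 := by rw [hq]; nlinarith [sq_nonneg s, mul_nonneg hq0 (sq_nonneg s)]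
      linarith
    linarith
  have e2 : r * s / 4 * U = q * (s ^ 2 * U) / 4 := by rw [hq]; ring
  have e3 : 2 * u ≤ q := by
    have : r ^ 2 ≤ q := by
      have : r ≤ q := by rw [le_div_iff₀ hs0]; nlinarith
      nlinarith
    linarith
  have e4 : q * (s ^ 2 * U) ≤ q * (2 * (3 + E)) := by gcongr
  have hmain : |s ^ 2 * U - 1| ≤ (2 * (3 + E) + 1 + E) * q := by
    refine h.trans ?_
    nlinarith [mul_nonneg hq0 hE]
  have e5 : U - 1 / s ^ 2 = (s ^ 2 * U - 1) / s ^ 2 := by field_simp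
  rw [e5, abs_div, abs_of_pos (show 0 < s ^ 2 by positivity), div_le_iff₀ (by positivity)]
  refine hmain.trans_eq ?_
  simp only [q]
  field_simp

lemma abs_ovm_two_sub_le (hN : 0 < N) {δ : ℝ} (hδ : δ = 1 - β ^ 2) (hδ0 : 0 < δ) (hδ1 : δ ≤ 1)
    (hNδ : 8 * (1 / (N:ℝ)) ≤ δ) {c : ℝ} (hc : 0 < c) (hcδ : c ≤ N * δ ^ 3)
    {x : ℝ} (hx : x ^ 2 = δ / (672 * cavK + 1)) (hp : ovTail N β x ≤ (1 / (N:ℝ)) ^ 6)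
    {a b : ℝ} (hab : a ^ 2 + b ^ 2 = 1) (ha : 0 ≤ a) :
    |N * ovm N β a b 2 - 1 / (1 - a * β ^ 2)|
      ≤ devK c * (√δ / (√(1 - a * β ^ 2) * (1 - a * β ^ 2))) := by
  have hK := cavK_pos
  have hM := momK_pos
  have hN' : (0:ℝ) < N := by exact_mod_cast hN
  have hu0 : (0:ℝ) < 1 / N := by positivity
  have hβ : β ^ 2 ≤ 1 := by linarith
  have ha1 : a ≤ 1 := by nlinarith [sq_nonneg b]
  have hy : δ ≤ 1 - a * β ^ 2 := by rw [hδ]; nlinarith [sq_nonneg β]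
  have hy1 : 1 - a * β ^ 2 ≤ 1 := by nlinarith [mul_nonneg ha (sq_nonneg β)]
  have hB4 := ovm_four_le (N := N) β hN hδ hδ0 hδ1 (by linarith) hx hp
  have hr : 0 < √δ := Real.sqrt_pos.2 hδ0
  have hrs : √δ ≤ √(1 - a * β ^ 2) := Real.sqrt_le_sqrt hy
  have hs1 : √(1 - a * β ^ 2) ≤ 1 := Real.sqrt_le_one.2 hy1
  have hr2 : √δ ^ 2 = δ := Real.sq_sqrt hδ0.le
  have hs2 : √(1 - a * β ^ 2) ^ 2 = 1 - a * β ^ 2 := Real.sq_sqrt (by linarith)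
  have hs0 := hr.trans_le hrs
  have hB := ovm_nonneg (N := N) β (m := 2) (by decide) a b
  generalize hrr : √δ = r at *
  generalize hss : √(1 - a * β ^ 2) = s at *
  have hθ : 0 < r * s / 4 := by positivity
  have hθ1 : r * s / 4 ≤ 1 := by nlinarith
  have h := abs_ovm_two_cavity_le (N := N) β hN hβ hab hθ hθ1
  have hE : 0 ≤ 64 * cavK * (momK + 1) / c := by positivity
  rw [← hs2] at h ⊢
  refine abs_sub_inv_le_of_cavity (u := 1 / N) (U := N * ovm N β a b 2)
    (W := N * (16 * cavK * (r * s / 4)⁻¹ * (ovm N β 1 0 4 + 1 / N ^ 4)))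
    hr hrs hs1 hu0.le (by rw [hr2]; exact hNδ) (by positivity) hE ?_ ?_
  · have hN4 : 1 / (N:ℝ) ^ 4 ≤ 1 * (1 / N) ^ 2 / δ ^ 2 := by
      rw [← one_div_pow, one_mul, le_div_iff₀ (by positivity)]
      have : (1 / (N:ℝ)) ^ 2 * δ ^ 2 ≤ 1 * 1 := by
        gcongr
        · exact pow_le_one₀ hu0.le (by linarith)
        · exact pow_le_one₀ hδ0.le hδ1
      nlinarith [sq_nonneg (1 / (N:ℝ))]
    have h1 : ovm N β 1 0 4 + 1 / N ^ 4 ≤ (momK + 1) * (1 / N) ^ 2 / δ ^ 2 := by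
      refine (add_le_add hB4 hN4).trans_eq ?_
      ring
    have h2 : 1 / (N * δ ^ 2) ≤ δ / c := by
      rw [div_le_div_iff₀ (by positivity) hc]; nlinarith
    calc _ ≤ N * (16 * cavK * (r * s / 4)⁻¹ * ((momK + 1) * (1 / N) ^ 2 / δ ^ 2)) := by gcongr
      _ = 64 * cavK * (momK + 1) / (r * s) * (1 / (N * δ ^ 2)) := by field_simp; norm_num
      _ ≤ 64 * cavK * (momK + 1) / (r * s) * (δ / c) := by gcongr
      _ = _ := by rw [← hr2]; field_simp
  · have e : s ^ 2 * (N * ovm N β a b 2) - 1 = N * (s ^ 2 * ovm N β a b 2 - 1 / N) := by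
      field_simp
    rw [e, abs_mul, abs_of_pos hN']
    refine (mul_le_mul_of_nonneg_left h hN'.le).trans_eq ?_
    field_simp

end MomentBounds

section CriticalWindow

lemma ovTail_le_of_large {N : ℕ} {β δ d z : ℝ} (hN : 0 < N) (hδ : δ = 1 - β ^ 2) (hδ1 : δ ≤ 1)
    (hd : 0 < d) (hz : 0 < z) (hNz : (N:ℝ) = z ^ 12) (hdz : d ≤ δ * z ^ 4)
    (hz1 : 152 ≤ d * z) (hNδ : 8 * (1 / (N:ℝ)) ≤ δ) {x : ℝ}
    (hx : x ^ 2 = δ / (672 * cavK + 1))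
    (hexp : 12 * rexp 1 * z ^ 84 * rexp (-(d ^ 2 / (16 * (672 * cavK + 1)) * z)) ≤ 1) :
    ovTail N β x ≤ (1 / (N:ℝ)) ^ 6 := by
  have hK := cavK_pos
  have hN' : (0:ℝ) < N := by exact_mod_cast hN
  have hδ0 : 0 < δ := lt_of_lt_of_le (by positivity) hNδ
  have hN1 : (1:ℝ) ≤ N := by exact_mod_cast hN
  have hz1' : 1 ≤ z := by
    by_contra h
    push Not at h
    have : z ^ 12 < 1 := pow_lt_one₀ hz.le h (by norm_num)
    linarith
  have hNδ' : 8 ≤ N * δ := by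
    have := mul_le_mul_of_nonneg_left hNδ hN'.le
    have e : (N:ℝ) * (8 * (1 / N)) = 8 := by field_simp
    linarith
  set L := 672 * cavK + 1 with hL
  have hL0 : 0 < L := by positivity
  have hκ : (0:ℝ) ≤ (z ^ 3)⁻¹ := by positivity
  have h := integral_ovlp_tail N β hN hδ hδ0 hδ1 hκ x (δ ^ 2 * N / (16 * L))
  rw [← Ecpl_one_zero (hv N β) (fun σ τ => if x ^ 2 < ovlp N σ τ ^ 2 then 1 else 0)] at h
  change ovTail N β x ≤ _ at h
  have hlog : log (512 / δ) ≤ 76 * z := by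
    have e1 : 512 / δ ≤ 64 * z ^ 12 := by
      rw [div_le_iff₀ hδ0, ← hNz]; linarith
    have e2 : log (512 / δ) ≤ log (64 * z ^ 12) := Real.log_le_log (by positivity) e1
    have e3 : log (64 * z ^ 12) = log 64 + 12 * log z := by
      rw [Real.log_mul (by norm_num) (by positivity), Real.log_pow]; norm_num
    have e4 : log 64 ≤ 64 - 1 := Real.log_le_sub_one_of_pos (by norm_num)
    have e5 : log z ≤ z - 1 := Real.log_le_sub_one_of_pos hz
    linarith
  have hA : ((z ^ 3)⁻¹) ^ 2 * (2 / δ * log (512 / δ)) ≤ 1 := by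
    have e1 : ((z ^ 3)⁻¹) ^ 2 * (2 / δ * log (512 / δ)) ≤ ((z ^ 3)⁻¹) ^ 2 * (2 / δ * (76 * z)) := by
      gcongr
    refine e1.trans ?_
    have e2 : ((z ^ 3)⁻¹) ^ 2 * (2 / δ * (76 * z)) = 152 / (δ * z ^ 4 * z) := by
      field_simp; norm_num
    rw [e2, div_le_one (by positivity)]
    nlinarith
  have hy0 : 0 ≤ δ ^ 2 * N / (16 * L) := by positivity
  have hky : d ^ 2 / (16 * L) * z ≤ (z ^ 3)⁻¹ * (δ ^ 2 * N / (16 * L)) := by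
    have e : (z ^ 3)⁻¹ * (δ ^ 2 * N / (16 * L)) = (δ * z ^ 4) ^ 2 / (16 * L) * z := by
      rw [hNz]; field_simp
    rw [e]
    gcongr
  have hκ1 : (z ^ 3)⁻¹ ≤ 1 := inv_le_one_of_one_le₀ (one_le_pow₀ hz1')
  have hky2 : (z ^ 3)⁻¹ * (δ ^ 2 * N / (16 * L)) ≤ 1 * (δ ^ 2 * N / (16 * L)) := by gcongr
  have hsq : (√(δ / 2))⁻¹ ≤ N := by
    refine inv_le_of_inv_le₀ hN' (Real.le_sqrt_of_sq_le ?_)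
    rw [← one_div]
    have : (1 / (N:ℝ)) ^ 2 ≤ 1 * (1 / N) := by
      rw [sq]; gcongr; rw [div_le_one hN']; exact hN1
    linarith [show 0 < 1 / (N:ℝ) by positivity]
  set k := d ^ 2 / (16 * L) * z
  have e1 : rexp (((z ^ 3)⁻¹) ^ 2 * (2 / δ * log (512 / δ))
      - (z ^ 3)⁻¹ * (δ ^ 2 * N / (16 * L))) ≤ rexp 1 * rexp (-k) := by
    rw [← Real.exp_add]
    exact Real.exp_le_exp.2 (by linarith)
  have e2 : rexp (2 * (δ ^ 2 * N / (16 * L)) - δ * N * x ^ 2 / 4) ≤ rexp 1 * rexp (-k) := by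
    rw [← Real.exp_add]
    refine Real.exp_le_exp.2 ?_
    have : 2 * (δ ^ 2 * N / (16 * L)) - δ * N * x ^ 2 / 4 = - (2 * (δ ^ 2 * N / (16 * L))) := by
      rw [hx]; field_simp; ring
    linarith
  have hfin : ovTail N β x ≤ 12 * N * (rexp 1 * rexp (-k)) := by
    refine h.trans ?_
    calc _ ≤ 8 * (N:ℝ) * (rexp 1 * rexp (-k)) + 4 * N * (rexp 1 * rexp (-k)) := by gcongr
      _ = _ := by ring
  refine hfin.trans ?_
  rw [one_div_pow, le_div_iff₀ (by positivity)]
  calc 12 * N * (rexp 1 * rexp (-k)) * (N:ℝ) ^ 6 = 12 * rexp 1 * z ^ 84 * rexp (-k) := by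
        rw [hNz]; ring
    _ ≤ 1 := hexp

lemma eventually_pow_mul_exp_le (A : ℝ) {k : ℝ} (hk : 0 < k) (n : ℕ) :
    ∀ᶠ z : ℝ in atTop, A * z ^ n * rexp (-(k * z)) ≤ 1 := by
  have h1 : Tendsto (fun z : ℝ => (k * z) ^ n * rexp (-(k * z))) atTop (nhds 0) :=
    (Real.tendsto_pow_mul_exp_neg_atTop_nhds_zero n).comp (tendsto_id.const_mul_atTop hk)
  have h2 := h1.const_mul (A / k ^ n)
  rw [mul_zero] at h2
  filter_upwards [h2.eventually (ge_mem_nhds (show (0:ℝ) < 1 by norm_num))] with z hz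
  refine le_trans (le_of_eq ?_) hz
  rw [mul_pow]
  field_simp

section Integrals

variable {b : ℝ}

lemma one_sub_mul_cos_pos (hb0 : 0 ≤ b) (hb : b < 1) (θ : ℝ) : 0 < 1 - cos θ * b := by
  nlinarith [Real.cos_le_one θ, Real.neg_one_le_cos θ]

lemma hasDerivAt_one_sub_mul_cos (θ : ℝ) :
    HasDerivAt (fun θ => 1 - cos θ * b) (sin θ * b) θ :=
  (((Real.hasDerivAt_cos θ).mul_const b).const_sub 1).congr_deriv (by ring)

lemma continuous_one_sub_mul_cos : Continuous fun θ : ℝ => 1 - cos θ * b := by fun_prop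

lemma continuous_sin_mul_inv_sub_one (hb0 : 0 ≤ b) (hb : b < 1) :
    Continuous fun θ => sin θ * (b / 2 * (1 / (1 - cos θ * b) - 1)) :=
  Real.continuous_sin.mul (continuous_const.mul
    ((continuous_const.div continuous_one_sub_mul_cos
      fun θ => (one_sub_mul_cos_pos hb0 hb θ).ne').sub continuous_const))

lemma integral_sin_mul_inv_sub_one (hb0 : 0 ≤ b) (hb : b < 1) :
    ∫ θ in (0:ℝ)..(π / 2), sin θ * (b / 2 * (1 / (1 - cos θ * b) - 1))
      = -(1 / 2) * log (1 - b) - b / 2 := by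
  have hpos := one_sub_mul_cos_pos hb0 hb
  have hd : ∀ θ ∈ Set.uIcc (0:ℝ) (π / 2),
      HasDerivAt (fun θ => 1 / 2 * log (1 - cos θ * b) + b / 2 * cos θ)
        (sin θ * (b / 2 * (1 / (1 - cos θ * b) - 1))) θ := by
    intro θ _
    refine ((((hasDerivAt_one_sub_mul_cos θ).log (hpos θ).ne').const_mul (1 / 2)).add
      ((Real.hasDerivAt_cos θ).const_mul (b / 2))).congr_deriv ?_
    have := (hpos θ).ne'
    field_simp
    ring
  rw [intervalIntegral.integral_eq_sub_of_hasDerivAt hd]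
  · simp
    ring
  · exact (continuous_sin_mul_inv_sub_one hb0 hb).intervalIntegrable _ _

lemma continuous_sin_mul_rpow (hb0 : 0 ≤ b) (hb : b < 1) (D r : ℝ) :
    Continuous fun θ => sin θ * (b / 2 * (D * (r / (√(1 - cos θ * b) * (1 - cos θ * b))))) := by
  have hpos := one_sub_mul_cos_pos hb0 hb
  exact Real.continuous_sin.mul (continuous_const.mul (continuous_const.mul
    (continuous_const.div (continuous_one_sub_mul_cos.sqrt.mul continuous_one_sub_mul_cos)
      fun θ => (mul_pos (Real.sqrt_pos.2 (hpos θ)) (hpos θ)).ne')))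

lemma integral_sin_mul_rpow_le (hb0 : 0 ≤ b) (hb : b < 1) {D : ℝ} (hD : 0 ≤ D) :
    ∫ θ in (0:ℝ)..(π / 2),
      sin θ * (b / 2 * (D * (√(1 - b) / (√(1 - cos θ * b) * (1 - cos θ * b))))) ≤ D := by
  have hpos := one_sub_mul_cos_pos hb0 hb
  have hd : ∀ θ ∈ Set.uIcc (0:ℝ) (π / 2),
      HasDerivAt (fun θ => -(D * √(1 - b)) * (√(1 - cos θ * b))⁻¹)
        (sin θ * (b / 2 * (D * (√(1 - b) / (√(1 - cos θ * b) * (1 - cos θ * b)))))) θ := by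
    intro θ _
    have hs := Real.sqrt_pos.2 (hpos θ)
    refine ((((hasDerivAt_one_sub_mul_cos θ).sqrt (hpos θ).ne').inv hs.ne').const_mul
      (-(D * √(1 - b)))).congr_deriv ?_
    rw [Real.sq_sqrt (hpos θ).le]
    have := (hpos θ).ne'
    field_simp
  rw [intervalIntegral.integral_eq_sub_of_hasDerivAt hd
    ((continuous_sin_mul_rpow hb0 hb D _).intervalIntegrable _ _)]
  have h1 : √(1 - b) ≠ 0 := (Real.sqrt_pos.2 (by linarith)).ne'
  simp [h1]
  positivity

end Integrals

lemma variance_freeEnergy_eq {N : ℕ} (hN : 0 < N) (β : ℝ) :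
    variance (freeEnergy N β) (gaussPi N)
      = ∫ θ in (0:ℝ)..(π / 2), sin θ * (β ^ 2 / 2 * (N * ovm N β (cos θ) (sin θ) 2 - 1)) := by
  rw [freeEnergy_eq]
  refine (variance_logZf (hv N β)).trans ?_
  congr 1; ext θ
  congr 1
  simp_rw [hv_dot N β hN, sub_eq_add_neg]
  rw [Ecpl_mul_left, Ecpl_add, Ecpl_mul_left, Ecpl_const]
  rfl

lemma abs_variance_sub_nuSK_le {N : ℕ} (hN : 0 < N) {β D : ℝ} (hβ : β ^ 2 < 1) (hD : 0 ≤ D)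
    (h : ∀ a b : ℝ, a ^ 2 + b ^ 2 = 1 → 0 ≤ a → |N * ovm N β a b 2 - 1 / (1 - a * β ^ 2)|
      ≤ D * (√(1 - β ^ 2) / (√(1 - a * β ^ 2) * (1 - a * β ^ 2)))) :
    |variance (freeEnergy N β) (gaussPi N) - nuSK β| ≤ D := by
  have hb0 := sq_nonneg β
  have hpi : (0:ℝ) ≤ π / 2 := by positivity
  have hc1 : Continuous fun θ =>
      sin θ * (β ^ 2 / 2 * (N * ovm N β (cos θ) (sin θ) 2 - 1)) := by
    have := continuous_Ecpl (hv N β) (fun σ τ => ovlp N σ τ ^ 2)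
    unfold ovm
    fun_prop
  have hc2 := continuous_sin_mul_inv_sub_one hb0 hβ
  rw [variance_freeEnergy_eq hN, nuSK, ← integral_sin_mul_inv_sub_one hb0 hβ,
    ← intervalIntegral.integral_sub (hc1.intervalIntegrable _ _) (hc2.intervalIntegrable _ _)]
  refine le_trans ?_ (integral_sin_mul_rpow_le hb0 hβ hD)
  rw [← Real.norm_eq_abs]
  refine intervalIntegral.norm_integral_le_of_norm_le hpi (Eventually.of_forall fun θ hθ => ?_)
    ((continuous_sin_mul_rpow hb0 hβ D _).intervalIntegrable _ _)
  have hs : 0 ≤ sin θ := Real.sin_nonneg_of_nonneg_of_le_pi hθ.1.le (by linarith [hθ.2, Real.pi_pos])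
  have hcos : 0 ≤ cos θ := Real.cos_nonneg_of_neg_pi_div_two_le_of_le (by linarith [hθ.1]) hθ.2
  have e : sin θ * (β ^ 2 / 2 * (N * ovm N β (cos θ) (sin θ) 2 - 1))
      - sin θ * (β ^ 2 / 2 * (1 / (1 - cos θ * β ^ 2) - 1))
      = sin θ * (β ^ 2 / 2 * (N * ovm N β (cos θ) (sin θ) 2 - 1 / (1 - cos θ * β ^ 2))) := by ring
  rw [e, Real.norm_eq_abs, abs_mul, abs_mul, abs_of_nonneg hs,
    abs_of_nonneg (show 0 ≤ β ^ 2 / 2 by positivity)]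
  have := h (cos θ) (sin θ) (by rw [add_comm]; exact Real.sin_sq_add_cos_sq θ) hcos
  gcongr

lemma devK_nonneg {c : ℝ} (hc : 0 < c) : 0 ≤ devK c := by
  have := cavK_pos
  have := momK_pos
  unfold devK; positivity

lemma eventually_abs_variance_sub_le {β : ℕ → ℝ} (hβmem : ∀ N, β N ∈ Set.Ioo (0 : ℝ) 1)
    {c : ℝ} (hc0 : 0 < c)
    (hc : Tendsto (fun N : ℕ => (N : ℝ) ^ ((1 : ℝ) / 3) * (1 - β N ^ 2)) atTop (nhds c)) :
    ∃ C : ℝ, ∀ᶠ N : ℕ in atTop,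
      |variance (freeEnergy N (β N)) (gaussPi N) - 1 / 6 * Real.log N| ≤ C := by
  have hK := cavK_pos
  set d := c / 2 with hd
  have hd0 : 0 < d := by positivity
  have hd3 : 0 < d ^ 3 := by positivity
  refine ⟨devK (d ^ 3) + 1 / 2 + 1 / 2 * (|log c| + 1), ?_⟩
  have hz : Tendsto (fun N : ℕ => (N : ℝ) ^ ((1 : ℝ) / 12)) atTop atTop :=
    (tendsto_rpow_atTop (by norm_num)).comp tendsto_natCast_atTop_atTop
  have hlog : Tendsto (fun N : ℕ => |log ((N : ℝ) ^ ((1 : ℝ) / 3) * (1 - β N ^ 2))|) atTop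
      (nhds |log c|) := (hc.log hc0.ne').abs
  have hexp := hz.eventually (eventually_pow_mul_exp_le (12 * rexp 1)
    (show 0 < d ^ 2 / (16 * (672 * cavK + 1)) by positivity) 84)
  filter_upwards [hz.eventually_ge_atTop (152 / d), hz.eventually_ge_atTop (8 / d), hexp,
    hz.eventually_ge_atTop 1, eventually_gt_atTop 0,
    hc.eventually (le_mem_nhds (show d < c by linarith)),
    hlog.eventually (ge_mem_nhds (lt_add_one |log c|))] with N hz1 hz2 hexp hz3 hN hdc hlogc
  have hN' : (0:ℝ) < N := by exact_mod_cast hN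
  obtain ⟨hb0, hb1⟩ := hβmem N
  have hβ2 : β N ^ 2 < 1 := by nlinarith
  have hNz : (N:ℝ) = ((N : ℝ) ^ ((1 : ℝ) / 12)) ^ 12 := by
    rw [← Real.rpow_natCast, ← Real.rpow_mul hN'.le]; norm_num
  have hz4 : (N : ℝ) ^ ((1 : ℝ) / 3) = ((N : ℝ) ^ ((1 : ℝ) / 12)) ^ 4 := by
    rw [← Real.rpow_natCast, ← Real.rpow_mul hN'.le]; norm_num
  have hL : log N = 3 * log ((N : ℝ) ^ ((1 : ℝ) / 3)) := by
    rw [Real.log_rpow hN']; ring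
  have hz40 : 0 < (N : ℝ) ^ ((1 : ℝ) / 3) := by positivity
  rw [Real.log_mul hz40.ne' (by linarith)] at hlogc
  rw [hz4] at hdc
  set z := (N : ℝ) ^ ((1 : ℝ) / 12)
  have hz0 : 0 < z := by linarith
  rw [div_le_iff₀ hd0] at hz1 hz2
  have hδ0 : 0 < 1 - β N ^ 2 := by linarith
  have hδ1 : 1 - β N ^ 2 ≤ 1 := by nlinarith
  have hdz : d ≤ (1 - β N ^ 2) * z ^ 4 := by linarith
  have hNδ : 8 * (1 / (N:ℝ)) ≤ 1 - β N ^ 2 := by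
    rw [mul_one_div, div_le_iff₀ hN', hNz]
    have e1 : z ≤ z ^ 8 := by simpa using pow_le_pow_right₀ hz3 (show 1 ≤ 8 by norm_num)
    have e2 : d * z ≤ (1 - β N ^ 2) * z ^ 4 * z ^ 8 := by gcongr
    linarith
  have hcδ : d ^ 3 ≤ N * (1 - β N ^ 2) ^ 3 := by
    have : d ^ 3 ≤ ((1 - β N ^ 2) * z ^ 4) ^ 3 := by gcongr
    refine this.trans_eq ?_
    rw [hNz]; ring
  have hx : √((1 - β N ^ 2) / (672 * cavK + 1)) ^ 2 = (1 - β N ^ 2) / (672 * cavK + 1) :=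
    Real.sq_sqrt (by positivity)
  have hp := ovTail_le_of_large hN rfl hδ1 hd0 hz0 hNz hdz (by linarith) hNδ hx hexp
  have hV := abs_variance_sub_nuSK_le hN hβ2 (devK_nonneg hd3) fun a b hab ha =>
    abs_ovm_two_sub_le (β N) hN rfl hδ0 hδ1 hNδ hd3 hcδ hx hp hab ha
  have e : variance (freeEnergy N (β N)) (gaussPi N) - 1 / 6 * Real.log N
      = (variance (freeEnergy N (β N)) (gaussPi N) - nuSK (β N)) - β N ^ 2 / 2
        - 1 / 2 * (log ((N : ℝ) ^ ((1 : ℝ) / 3)) + log (1 - β N ^ 2)) := by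
    rw [hL, nuSK]; ring
  rw [e]
  rw [abs_le] at hV hlogc ⊢
  constructor <;> nlinarith [sq_nonneg (β N)]

end CriticalWindow

end SKVariance

/-- In the critical window `N^{1/3}(1−β_N²) → c ∈ (0,∞)`, the variance of
the SK free energy is `(1/6)·ln N + O(1)`. -/
theorem sk_variance_log_sixth
    (β : ℕ → ℝ) (hβmem : ∀ N, β N ∈ Set.Ioo (0 : ℝ) 1)
    (hβlim : Tendsto β atTop (nhds 1))
    (c : ℝ) (hc0 : 0 < c)
    (hc : Tendsto (fun N : ℕ => (N : ℝ) ^ ((1 : ℝ) / 3) * (1 - β N ^ 2)) atTop (nhds c)) :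
    ∃ C : ℝ, ∀ N : ℕ, 2 ≤ N →
      |variance (freeEnergy N (β N)) (gaussPi N) - 1 / 6 * Real.log N| ≤ C := by
  obtain ⟨C, hC⟩ := SKVariance.eventually_abs_variance_sub_le hβmem hc0 hc
  obtain ⟨n, hn⟩ := eventually_atTop.1 hC
  set f : ℕ → ℝ := fun N => |variance (freeEnergy N (β N)) (gaussPi N) - 1 / 6 * Real.log N|
  refine ⟨max C (∑ i ∈ Finset.range n, f i), fun N _ => ?_⟩
  rcases le_or_gt n N with h | h
  · exact (hn N h).trans (le_max_left _ _)
  · refine le_trans ?_ (le_max_right _ _)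
    exact Finset.single_le_sum (f := f) (fun i _ => abs_nonneg _) (Finset.mem_range.2 h)
end
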